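/- arXiv:2001.09962 — 2 statements merged into one kernel-verified Lean document; each statement's English description precedes it below -/
import Mathlib

section
/- Let Φ be a unital positive linear map on B(H) and let f : (0,∞) → (0,∞) be a continuous function such that f² is operator concave. Then for every positive invertible operator A ∈ B(H), |Φ(f(A)) Φ(A)| ≤ Φ(A f(A)). -/
open scoped NNReal

variable {H : Type*} [NormedAddCommGroup H] [InnerProductSpace ℂ H] [CompleteSpace H]

/-- The absolute value `|X| = (X*X)^(1/2)` of a bounded operator `X` on a Hilbert space. -/
noncomputable def opAbs (X : H →L[ℂ] H) : H →L[ℂ] H := CFC.sqrt (star X * X)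

/-- `Φ` is a unital positive linear map on `B(H)`: `Φ(I) = I` and `Φ(X) ≥ 0` whenever `X ≥ 0`
(with respect to the Löwner order). -/
def IsUnitalPositiveMap (Φ : (H →L[ℂ] H) →ₗ[ℂ] (H →L[ℂ] H)) : Prop :=
  Φ 1 = 1 ∧ ∀ X : H →L[ℂ] H, 0 ≤ X → 0 ≤ Φ X

/-- `f : (0,∞) → (0,∞)` is operator convex: for all positive invertible operators `A, B` on `H`
and all `c ∈ [0,1]`, `f(cA + (1-c)B) ≤ c f(A) + (1-c) f(B)` in the Löwner order, where `f(A)` is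
given by the continuous functional calculus. -/
def IsOperatorConvexOn (H : Type*) [NormedAddCommGroup H] [InnerProductSpace ℂ H]
    [CompleteSpace H] (f : ℝ → ℝ) : Prop :=
  ∀ (A B : H →L[ℂ] H), 0 ≤ A → IsUnit A → 0 ≤ B → IsUnit B →
    ∀ c : ℝ, c ∈ Set.Icc (0 : ℝ) 1 →
      cfc f (c • A + (1 - c) • B) ≤ c • cfc f A + (1 - c) • cfc f B

/-- `f : (0,∞) → (0,∞)` is operator concave if `-f` is operator convex. -/
def IsOperatorConcaveOn (H : Type*) [NormedAddCommGroup H] [InnerProductSpace ℂ H]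
    [CompleteSpace H] (f : ℝ → ℝ) : Prop :=
  IsOperatorConvexOn H (fun t => -(f t))

section HalfLine

open Polynomial Finset

/-- Sums of polynomials of the forms `q ^ 2` and `X * q ^ 2` of degree at most `d`. -/
noncomputable def halfLineSquares (d : ℕ) : AddSubmonoid ℝ[X] :=
  AddSubmonoid.closure
    {p | ∃ q : ℝ[X], (2 * q.natDegree ≤ d ∧ p = q ^ 2) ∨ (2 * q.natDegree + 1 ≤ d ∧ p = X * q ^ 2)}

theorem sq_mem_halfLineSquares {d : ℕ} {q : ℝ[X]} (h : 2 * q.natDegree ≤ d) :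
    q ^ 2 ∈ halfLineSquares d :=
  AddSubmonoid.subset_closure ⟨q, Or.inl ⟨h, rfl⟩⟩

theorem X_mul_sq_mem_halfLineSquares {d : ℕ} {q : ℝ[X]} (h : 2 * q.natDegree + 1 ≤ d) :
    X * q ^ 2 ∈ halfLineSquares d :=
  AddSubmonoid.subset_closure ⟨q, Or.inr ⟨h, rfl⟩⟩

theorem halfLineSquares_mono {d e : ℕ} (h : d ≤ e) : halfLineSquares d ≤ halfLineSquares e := by
  apply AddSubmonoid.closure_mono
  rintro p ⟨q, ⟨hq, rfl⟩ | ⟨hq, rfl⟩⟩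
  · exact ⟨q, Or.inl ⟨hq.trans h, rfl⟩⟩
  · exact ⟨q, Or.inr ⟨hq.trans h, rfl⟩⟩

theorem mul_mem_halfLineSquares {d e : ℕ} {P Q : ℝ[X]} (hP : P ∈ halfLineSquares d)
    (hQ : Q ∈ halfLineSquares e) : P * Q ∈ halfLineSquares (d + e) := by
  induction hP using AddSubmonoid.closure_induction with
  | zero => simp
  | add p₁ p₂ _ _ h₁ h₂ => rw [add_mul]; exact add_mem h₁ h₂
  | mem p hp =>
    induction hQ using AddSubmonoid.closure_induction with
    | zero => simp
    | add p₁ p₂ _ _ h₁ h₂ => rw [mul_add]; exact add_mem h₁ h₂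
    | mem r hr =>
      obtain ⟨q, ⟨hq, rfl⟩ | ⟨hq, rfl⟩⟩ := hp <;> obtain ⟨s, ⟨hs, rfl⟩ | ⟨hs, rfl⟩⟩ := hr
      · have := natDegree_mul_le (p := q) (q := s)
        convert sq_mem_halfLineSquares (d := d + e) (q := q * s) (by omega) using 1; ring
      · have := natDegree_mul_le (p := q) (q := s)
        convert X_mul_sq_mem_halfLineSquares (d := d + e) (q := q * s) (by omega) using 1; ring
      · have := natDegree_mul_le (p := q) (q := s)
        convert X_mul_sq_mem_halfLineSquares (d := d + e) (q := q * s) (by omega) using 1; ring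
      · have := natDegree_mul_le (p := q) (q := s)
        have h2 := natDegree_mul_le (p := X) (q := q * s)
        rw [natDegree_X] at h2
        convert sq_mem_halfLineSquares (d := d + e) (q := X * (q * s)) (by omega) using 1; ring

theorem eval_nonneg_of_right {Q : ℝ[X]} {r : ℝ}
    (h : ∀ s, r < s → 0 ≤ Q.eval s) : 0 ≤ Q.eval r := by
  have hc : Filter.Tendsto (fun s => Q.eval s) (nhdsWithin r (Set.Ioi r)) (nhds (Q.eval r)) :=
    Q.continuous.continuousAt.tendsto.mono_left nhdsWithin_le_nhds
  exact ge_of_tendsto hc (by filter_upwards [self_mem_nhdsWithin] with s hs using h s hs)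

theorem eval_nonpos_of_left {Q : ℝ[X]} {r : ℝ} (hr : 0 < r)
    (h : ∀ s, 0 < s → s < r → Q.eval s ≤ 0) : Q.eval r ≤ 0 := by
  have hc : Filter.Tendsto (fun s => Q.eval s) (nhdsWithin r (Set.Iio r)) (nhds (Q.eval r)) :=
    Q.continuous.continuousAt.tendsto.mono_left nhdsWithin_le_nhds
  refine le_of_tendsto hc ?_
  filter_upwards [Ioo_mem_nhdsLT hr] with s hs using h s hs.1 hs.2

/-- A real polynomial which is nonnegative on the half-line is a sum of terms `q ^ 2` and
`X * q ^ 2`, without increase of degree. -/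
theorem mem_halfLineSquares_of_nonneg (n : ℕ) : ∀ Q : ℝ[X], Q.natDegree = n →
    (∀ s, 0 < s → 0 ≤ Q.eval s) → Q ∈ halfLineSquares n := by
  induction n using Nat.strong_induction_on with
  | _ n ih =>
  intro Q hn hQ
  rcases Nat.eq_zero_or_pos n with rfl | hpos
  · obtain ⟨c, rfl⟩ := natDegree_eq_zero.mp hn
    have hc : 0 ≤ c := by simpa using hQ 1 one_pos
    have : (C c : ℝ[X]) = (C (√c)) ^ 2 := by rw [← C_pow, Real.sq_sqrt hc]
    rw [this]
    exact sq_mem_halfLineSquares (by simp)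
  have hQ0 : Q ≠ 0 := by rintro rfl; simp at hn; omega
  obtain ⟨z, hz⟩ : ∃ z : ℂ, aeval z Q = 0 := by
    apply IsAlgClosed.exists_aeval_eq_zero
    rw [degree_eq_natDegree hQ0, hn]
    exact_mod_cast hpos.ne'
  by_cases him : z.im = 0
  · obtain ⟨r, rfl⟩ : ∃ r : ℝ, z = (r : ℂ) := ⟨z.re, Complex.ext rfl (by simpa using him)⟩
    have hroot : Q.IsRoot r := by
      have : aeval ((algebraMap ℝ ℂ) r) Q = 0 := hz
      rw [aeval_algebraMap_apply] at this
      simpa using this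
    obtain ⟨R, rfl⟩ := dvd_iff_isRoot.mpr hroot
    have hR0 : R ≠ 0 := right_ne_zero_of_mul hQ0
    have hdeg : n = 1 + R.natDegree := by
      rw [← hn, natDegree_mul (X_sub_C_ne_zero r) hR0, natDegree_X_sub_C]
    simp only [eval_mul, eval_sub, eval_X, eval_C] at hQ
    rcases le_or_gt r 0 with hr | hr
    · have h1 : (X - C r : ℝ[X]) ∈ halfLineSquares 1 := by
        have : (X - C r : ℝ[X]) = X * 1 ^ 2 + (C (√(-r))) ^ 2 := by
          rw [← C_pow, Real.sq_sqrt (by linarith), C_neg]; ring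
        rw [this]
        exact add_mem (X_mul_sq_mem_halfLineSquares (by simp)) (sq_mem_halfLineSquares (by simp))
      rw [hdeg]
      refine mul_mem_halfLineSquares h1 (ih _ (by omega) R rfl fun s hs => ?_)
      exact nonneg_of_mul_nonneg_right (hQ s hs) (by linarith)
    · have hRr : R.IsRoot r := by
        refine le_antisymm (eval_nonpos_of_left hr fun s hs hsr => ?_)
          (eval_nonneg_of_right fun s hs => ?_)
        · nlinarith [hQ s hs]
        · exact nonneg_of_mul_nonneg_right (hQ s (by linarith)) (by linarith)
      obtain ⟨S, rfl⟩ := dvd_iff_isRoot.mpr hRr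
      have hS0 : S ≠ 0 := right_ne_zero_of_mul hR0
      rw [natDegree_mul (X_sub_C_ne_zero r) hS0, natDegree_X_sub_C] at hdeg
      have hS : ∀ s, 0 < s → s ≠ r → 0 ≤ S.eval s := fun s hs hsr => by
        have h := hQ s hs
        simp only [eval_mul, eval_sub, eval_X, eval_C] at h
        rw [← mul_assoc] at h
        exact nonneg_of_mul_nonneg_right h (mul_self_pos.mpr (sub_ne_zero.mpr hsr))
      have hSmem := ih S.natDegree (by omega) S rfl fun s hs => by
        rcases eq_or_ne s r with rfl | hsr
        · exact eval_nonneg_of_right fun u hu => hS u (by linarith) hu.ne'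
        · exact hS s hs hsr
      have h2 : (X - C r : ℝ[X]) ^ 2 ∈ halfLineSquares 2 :=
        sq_mem_halfLineSquares (by simp)
      have := mul_mem_halfLineSquares h2 hSmem
      rw [show n = 2 + S.natDegree by omega]
      convert this using 1
      ring
  · obtain ⟨R, rfl⟩ := quadratic_dvd_of_aeval_eq_zero_im_ne_zero Q hz him
    set P : ℝ[X] := X ^ 2 - C (2 * z.re) * X + C (‖z‖ ^ 2) with hP
    have hPeq : P = (X - C z.re) ^ 2 + (C z.im) ^ 2 := by
      have : ‖z‖ ^ 2 = z.re ^ 2 + z.im ^ 2 := by rw [Complex.sq_norm, Complex.normSq_apply]; ring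
      rw [hP, this]
      simp only [C_add, C_mul, C_pow]
      rw [show (C (2 : ℝ) : ℝ[X]) = 2 from rfl]
      ring
    have hPdeg : P.natDegree = 2 := by
      rw [hP]
      compute_degree!
    have hR0 : R ≠ 0 := right_ne_zero_of_mul hQ0
    have hP0 : P ≠ 0 := left_ne_zero_of_mul hQ0
    rw [natDegree_mul hP0 hR0, hPdeg] at hn
    rw [← hn]
    refine mul_mem_halfLineSquares ?_ (ih _ (by omega) R rfl fun s hs => ?_)
    · rw [hPeq]
      exact add_mem (sq_mem_halfLineSquares (by simp)) (sq_mem_halfLineSquares (by simp))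
    · have h := hQ s hs
      rw [eval_mul] at h
      refine nonneg_of_mul_nonneg_right h ?_
      rw [hPeq]
      simp only [eval_add, eval_pow, eval_sub, eval_X, eval_C]
      positivity

theorem degree_lt_natCast_of_natDegree_lt {q : ℝ[X]} {n : ℕ} (h : q.natDegree < n) : q.degree < n :=
  degree_le_natDegree.trans_lt (by exact_mod_cast h)

theorem natDegree_le_pred_of_degree_lt {q : ℝ[X]} {n : ℕ} (h : q.degree < n) :
    q.natDegree ≤ n - 1 := by
  rcases eq_or_ne q 0 with rfl | h0
  · simp
  · exact Nat.le_pred_of_lt ((natDegree_lt_iff_degree_lt h0).mpr h)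

/-- The values `h` at the points `a` are monotone with respect to real contractions: a contraction
`t` from the coordinates in `Y` to the coordinates in `X` with `tᵀ a t ≤ a` satisfies
`tᵀ h t ≤ h`. -/
def ContractionMonotone {ι : Type*} (a h : ι → ℝ) : Prop :=
  ∀ (X Y : Finset ι), Disjoint X Y → ∀ t : ι → ι → ℝ,
    (∀ r : ι → ℝ, ∑ x ∈ X, (∑ y ∈ Y, t x y * r y) ^ 2 ≤ ∑ y ∈ Y, r y ^ 2) →
    (∀ r : ι → ℝ, ∑ x ∈ X, a x * (∑ y ∈ Y, t x y * r y) ^ 2 ≤ ∑ y ∈ Y, a y * r y ^ 2) →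
    ∀ r : ι → ℝ, ∑ x ∈ X, h x * (∑ y ∈ Y, t x y * r y) ^ 2 ≤ ∑ y ∈ Y, h y * r y ^ 2

theorem sum_mul_filter_pos_neg {ι : Type*} [Fintype ι] (w g : ι → ℝ) :
    ∑ i, w i * g i = ∑ i with 0 < w i, |w i| * g i - ∑ i with ¬ 0 < w i, |w i| * g i := by
  rw [← sum_filter_add_sum_filter_not univ (fun i => 0 < w i), sub_eq_add_neg, ← sum_neg_distrib]
  congr 1
  · refine sum_congr rfl fun i hi => ?_
    rw [abs_of_pos (mem_filter.mp hi).2]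
  · refine sum_congr rfl fun i hi => ?_
    rw [abs_of_nonpos (not_lt.mp (mem_filter.mp hi).2)]
    ring

theorem ContractionMonotone.sum_weight_nonneg {ι : Type*} [Fintype ι] [DecidableEq ι]
    {a h : ι → ℝ} (hJ : ContractionMonotone a h) {w v : ι → ℝ} (hw : ∀ i, w i ≠ 0)
    (hv : Function.Injective v)
    (h₀ : ∀ q : ℝ[X], q.degree < #{i | 0 < w i} → 0 ≤ ∑ i, w i * q.eval (v i) ^ 2)
    (h₁ : ∀ q : ℝ[X], q.degree < #{i | 0 < w i} → 0 ≤ ∑ i, w i * (a i * q.eval (v i) ^ 2))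
    {q : ℝ[X]} (hq : q.degree < #{i | 0 < w i}) :
    0 ≤ ∑ i, w i * (h i * q.eval (v i) ^ 2) := by
  set Y : Finset ι := {i | 0 < w i} with hY
  set Z : Finset ι := {i | ¬ 0 < w i} with hZ
  have hvY : Set.InjOn v Y := hv.injOn
  have habs : ∀ i, 0 < √|w i| := fun i => Real.sqrt_pos.mpr (abs_pos.mpr (hw i))
  have hsq : ∀ i, √|w i| ^ 2 = |w i| := fun i => Real.sq_sqrt (abs_nonneg _)
  let I : (ι → ℝ) → ℝ[X] := fun r => Lagrange.interpolate Y v fun y => r y / √|w y|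
  let t : ι → ι → ℝ := fun x y => √|w x| * (Lagrange.basis Y v y).eval (v x) / √|w y|
  have hIdeg : ∀ r, (I r).degree < #Y := fun r => Lagrange.degree_interpolate_lt _ hvY
  have ht : ∀ r x, ∑ y ∈ Y, t x y * r y = √|w x| * (I r).eval (v x) := fun r x => by
    simp only [I, Lagrange.interpolate_apply, eval_finsetSum, eval_mul, eval_C, mul_sum]
    refine sum_congr rfl fun y _ => ?_
    simp only [t]
    ring
  have hr : ∀ r, ∀ y ∈ Y, r y = √|w y| * (I r).eval (v y) := fun r y hy => by
    simp only [I]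
    rw [Lagrange.eval_interpolate_at_node _ hvY hy, mul_div_cancel₀ _ (habs y).ne']
  have hX : ∀ (g : ι → ℝ) r, ∑ x ∈ Z, g x * (∑ y ∈ Y, t x y * r y) ^ 2 =
      ∑ x ∈ Z, |w x| * (g x * (I r).eval (v x) ^ 2) := fun g r =>
    sum_congr rfl fun x _ => by rw [ht, mul_pow, hsq]; ring
  have hYs : ∀ (g : ι → ℝ) r, ∑ y ∈ Y, g y * r y ^ 2 =
      ∑ y ∈ Y, |w y| * (g y * (I r).eval (v y) ^ 2) := fun g r =>
    sum_congr rfl fun y hy => by rw [hr r y hy, mul_pow, hsq]; ring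
  have key := hJ Z Y (disjoint_filter_filter_not univ univ fun i => 0 < w i).symm t
    (fun r => by
      have h2 := h₀ (I r) (hIdeg r)
      rw [sum_mul_filter_pos_neg w _] at h2
      have e1 := hX (fun _ => 1) r
      have e2 := hYs (fun _ => 1) r
      simp only [one_mul] at e1 e2
      rw [e1, e2]
      exact sub_nonneg.mp h2)
    (fun r => by
      have h2 := h₁ (I r) (hIdeg r)
      rw [sum_mul_filter_pos_neg w _] at h2
      rw [hX, hYs]
      exact sub_nonneg.mp h2)
    (fun y => √|w y| * q.eval (v y))
  have hIq : I (fun y => √|w y| * q.eval (v y)) = q := by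
    simp only [I]
    rw [Lagrange.eq_interpolate hvY hq]
    refine Lagrange.interpolate_eq_of_values_eq_on _ _ fun y hy => ?_
    rw [← Lagrange.eq_interpolate hvY hq, mul_div_cancel_left₀ _ (habs y).ne']
  rw [hX, hYs, hIq] at key
  rw [sum_mul_filter_pos_neg w _]
  exact sub_nonneg.mpr key

theorem nodalWeight_sign {k : ℕ} {a : Fin k → ℝ} (ha : StrictMono a) (i : Fin k) :
    0 < (-1) ^ (i : ℕ) * Lagrange.nodalWeight univ (fun j => -a j) i := by
  have hsplit : univ.erase i = Iio i ∪ Ioi i := by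
    ext j
    simp [lt_or_lt_iff_ne]
  have hdisj : Disjoint (Iio i) (Ioi i) :=
    disjoint_left.mpr fun j hj hj' => lt_asymm (mem_Iio.mp hj) (mem_Ioi.mp hj')
  rw [Lagrange.nodalWeight, hsplit, prod_union hdisj, ← mul_assoc, ← Fin.card_Iio,
    ← prod_const, ← prod_mul_distrib]
  refine mul_pos (prod_pos fun j hj => ?_) (prod_pos fun j hj => inv_pos.mpr ?_)
  · have := ha (mem_Iio.mp hj)
    rw [neg_one_mul, neg_pos, inv_lt_zero]
    linarith
  · have := ha (mem_Ioi.mp hj)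
    linarith

theorem card_filter_even_fin (k : ℕ) : #{i : Fin k | Even (i : ℕ)} = (k + 1) / 2 := by
  have h : ∀ n : ℕ, #{i ∈ range n | Even i} = (n + 1) / 2 := fun n => by
    induction n with
    | zero => simp
    | succ n ih =>
      rw [range_add_one, filter_insert]
      split_ifs with hn
      · rw [card_insert_of_notMem (by simp), ih]
        obtain ⟨m, rfl⟩ := hn
        omega
      · rw [ih]
        obtain ⟨m, rfl⟩ := Nat.not_even_iff_odd.mp hn
        omega
  rw [← h k, ← card_map Fin.valEmbedding]
  congr 1
  ext i
  simp only [mem_map, mem_filter, mem_univ, true_and, Fin.valEmbedding_apply, mem_range]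
  exact ⟨by rintro ⟨j, hj, rfl⟩; exact ⟨j.2, hj⟩, fun hi => ⟨⟨i, hi.1⟩, hi.2, rfl⟩⟩

theorem sum_nodalWeight_mul_eval {k : ℕ} {v : Fin k → ℝ} (hv : Function.Injective v) {P : ℝ[X]}
    (hP : P.degree < k) :
    ∑ i, Lagrange.nodalWeight univ v i * P.eval (v i) = P.coeff (k - 1) := by
  have := Lagrange.coeff_eq_sum (s := univ) (v := v) hv.injOn (P := P) (by simpa using hP)
  rw [card_univ, Fintype.card_fin] at this
  rw [this]
  refine sum_congr rfl fun i _ => ?_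
  rw [Lagrange.nodalWeight, prod_inv_distrib]
  field_simp

theorem coeff_sq_nonneg {q : ℝ[X]} {n : ℕ} (h : 2 * q.natDegree ≤ n) : 0 ≤ (q ^ 2).coeff n := by
  rcases h.eq_or_lt with rfl | h
  · rw [coeff_pow_mul_natDegree]; positivity
  · rw [coeff_eq_zero_of_natDegree_lt (by rw [natDegree_pow]; exact h)]

theorem sum_nodalWeight_mul_eval_div {k : ℕ} {a : Fin k → ℝ} (ha : StrictMono a)
    (hpos : ∀ i, 0 < a i) {P : ℝ[X]} (hP : P.degree < k) (h0 : 0 ≤ P.eval 0) :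
    0 ≤ ∑ i, Lagrange.nodalWeight univ (fun j => -a j) i / a i * P.eval (-a i) := by
  have hv : Function.Injective fun j => -a j := neg_injective.comp ha.injective
  have := Lagrange.eval_interpolate_not_at_node (s := univ) (v := fun j => -a j) (x := 0)
    (fun i => P.eval (-a i)) (fun i _ => by simpa using (hpos i).ne')
  rw [← Lagrange.eq_interpolate (v := fun j => -a j) hv.injOn (by simpa using hP),
    Lagrange.eval_nodal] at this
  simp only [zero_sub, neg_neg] at this
  rw [this] at h0
  simpa only [div_eq_mul_inv] using nonneg_of_mul_nonneg_right h0 (prod_pos fun i _ => hpos i)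

/-- The functional `Q ↦ ∑ i, wᵢ Q(-aᵢ) hᵢ / aᵢ` is nonnegative on `halfLineSquares`. -/
theorem ContractionMonotone.sum_nodalWeight_nonneg {k : ℕ} {a h : Fin k → ℝ}
    (hJ : ContractionMonotone a h) (ha : StrictMono a) (hpos : ∀ i, 0 < a i) {Q : ℝ[X]}
    (hQ : Q ∈ halfLineSquares (k - 1)) :
    0 ≤ ∑ i, Lagrange.nodalWeight univ (fun j => -a j) i / a i * (h i * Q.eval (-a i)) := by
  have hv : Function.Injective fun j => -a j := neg_injective.comp ha.injective
  set W := Lagrange.nodalWeight univ (fun j => -a j) with hW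
  have hsign : ∀ i, 0 < W i ↔ Even (i : ℕ) := fun i => by
    have := nodalWeight_sign ha i
    rcases Nat.even_or_odd (i : ℕ) with he | ho
    · simp_all [he.neg_one_pow]
    · rw [ho.neg_one_pow] at this
      simp only [Nat.not_even_iff_odd.mpr ho, iff_false]
      linarith
  have hW0 : ∀ i, W i ≠ 0 := fun i => right_ne_zero_of_mul (nodalWeight_sign ha i).ne'
  have hcard : #{i | 0 < W i} = (k + 1) / 2 := by simp only [hsign, card_filter_even_fin]
  have hcard' : #{i | W i < 0} = k / 2 := by
    have h1 := card_filter_add_card_filter_not (s := univ) (fun i => 0 < W i)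
    have h2 : ({i | ¬ 0 < W i} : Finset (Fin k)) = ({i | W i < 0} : Finset (Fin k)) := by
      ext i; simp [(hW0 i).le_iff_lt]
    rw [h2, hcard, card_univ, Fintype.card_fin] at h1
    omega
  induction hQ using AddSubmonoid.closure_induction with
  | zero => simp
  | add p₁ p₂ _ _ h₁ h₂ =>
    simp only [eval_add, mul_add, sum_add_distrib]
    exact add_nonneg h₁ h₂
  | mem p hp =>
    rcases Nat.eq_zero_or_pos k with rfl | hk
    · simp
    obtain ⟨q, ⟨hq, rfl⟩ | ⟨hq, rfl⟩⟩ := hp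
    · simp only [eval_pow]
      have hc : #{i | 0 < W i / a i} = (k + 1) / 2 := by
        rw [← hcard]
        congr 1 with i
        simp [div_pos_iff_of_pos_right (hpos i)]
      refine hJ.sum_weight_nonneg (fun i => div_ne_zero (hW0 i) (hpos i).ne') hv
        (fun r hr => ?_) (fun r hr => ?_) ?_
      · rw [hc] at hr
        have hr' := natDegree_le_pred_of_degree_lt hr
        simp only [← eval_pow]
        refine sum_nodalWeight_mul_eval_div ha hpos ?_ (by rw [eval_pow]; positivity)
        refine degree_lt_natCast_of_natDegree_lt ?_
        rw [natDegree_pow]; omega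
      · rw [hc] at hr
        have hr' := natDegree_le_pred_of_degree_lt hr
        have e : ∀ i, W i / a i * (a i * eval (-a i) r ^ 2) = W i * eval (-a i) (r ^ 2) :=
          fun i => by rw [eval_pow]; field_simp [(hpos i).ne']
        simp only [e]
        rw [sum_nodalWeight_mul_eval hv
          (degree_lt_natCast_of_natDegree_lt (by rw [natDegree_pow]; omega))]
        exact coeff_sq_nonneg (by omega)
      · rw [hc]
        exact degree_lt_natCast_of_natDegree_lt (by omega)
    · have hc : #{i | 0 < -W i} = k / 2 := by simpa using hcard'
      have e : ∀ i, W i / a i * (h i * eval (-a i) (X * q ^ 2)) =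
          -W i * (h i * eval (-a i) q ^ 2) := fun i => by
        simp only [eval_mul, eval_X, eval_pow]; field_simp [(hpos i).ne']
      simp only [e]
      refine hJ.sum_weight_nonneg (fun i => neg_ne_zero.mpr (hW0 i)) hv
        (fun r hr => ?_) (fun r hr => ?_) ?_
      · rw [hc] at hr
        have hr' := natDegree_le_pred_of_degree_lt hr
        simp only [← eval_pow, neg_mul, sum_neg_distrib]
        have hd : (r ^ 2).natDegree < k - 1 := by rw [natDegree_pow]; omega
        rw [sum_nodalWeight_mul_eval hv (degree_lt_natCast_of_natDegree_lt (by omega)),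
          coeff_eq_zero_of_natDegree_lt hd, neg_zero]
      · rw [hc] at hr
        have hr' := natDegree_le_pred_of_degree_lt hr
        have e : ∀ i, -W i * (a i * eval (-a i) r ^ 2) = W i * eval (-a i) (X * r ^ 2) :=
          fun i => by simp only [eval_mul, eval_X, eval_pow]; ring
        simp only [e]
        have hd := natDegree_mul_le (p := X) (q := r ^ 2)
        rw [natDegree_X, natDegree_pow] at hd
        rw [sum_nodalWeight_mul_eval hv (degree_lt_natCast_of_natDegree_lt (by omega)),
          show k - 1 = (k - 2) + 1 by omega, coeff_X_mul]
        exact coeff_sq_nonneg (by omega)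
      · rw [hc]
        exact degree_lt_natCast_of_natDegree_lt (by omega)

theorem ContractionMonotone.sum_nonneg_of_forall_sum_div {k : ℕ} {a h : Fin k → ℝ}
    (hJ : ContractionMonotone a h) (ha : StrictMono a) (hpos : ∀ i, 0 < a i) {c : Fin k → ℝ}
    (hc : ∀ s, 0 < s → 0 ≤ ∑ i, c i * (a i / (a i + s))) : 0 ≤ ∑ i, c i * h i := by
  set Q : ℝ[X] := ∑ i, C (c i * a i) * ∏ j ∈ univ.erase i, (X + C (a j)) with hQ
  have hdeg : Q.natDegree ≤ k - 1 := by
    refine natDegree_sum_le_of_forall_le _ _ fun i _ => (natDegree_C_mul_le _ _).trans ?_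
    refine (natDegree_prod_le _ _).trans ?_
    simp
  have heval : ∀ s, Q.eval s = ∑ i, c i * a i * ∏ j ∈ univ.erase i, (s + a j) := by
    intro s
    simp [hQ, eval_finsetSum, eval_prod]
  have hQpos : ∀ s, 0 < s → 0 ≤ Q.eval s := by
    intro s hs
    have : Q.eval s = (∏ j, (s + a j)) * ∑ i, c i * (a i / (a i + s)) := by
      rw [heval, Finset.mul_sum]
      refine sum_congr rfl fun i _ => ?_
      rw [← Finset.mul_prod_erase univ _ (mem_univ i)]
      have := hpos i
      have : a i + s ≠ 0 := by positivity
      field_simp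
      ring
    rw [this]
    exact mul_nonneg (prod_nonneg fun j _ => by have := hpos j; positivity) (hc s hs)
  have hmem := halfLineSquares_mono hdeg (mem_halfLineSquares_of_nonneg _ Q rfl hQpos)
  have key := hJ.sum_nodalWeight_nonneg ha hpos hmem
  refine key.trans_eq (sum_congr rfl fun i _ => ?_)
  have h1 : Q.eval (-a i) = c i * a i * ∏ j ∈ univ.erase i, (-a i + a j) := by
    rw [heval]
    refine sum_eq_single i (fun j _ hj => ?_) (by simp)
    rw [prod_eq_zero (mem_erase.2 ⟨hj.symm, mem_univ i⟩) (by simp), mul_zero]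
  have h2 : ∏ j ∈ univ.erase i, (-a i + a j) ≠ 0 := by
    refine prod_ne_zero_iff.2 fun j hj h => (mem_erase.1 hj).1 (ha.injective ?_)
    linarith
  have h3 : Lagrange.nodalWeight univ (fun j => -a j) i =
      (∏ j ∈ univ.erase i, (-a i + a j))⁻¹ := by
    rw [Lagrange.nodalWeight, prod_inv_distrib]
    simp
  rw [h1, h3]
  have := (hpos i).ne'
  field_simp

/-- A contraction monotone family of values is approximated by nonnegative combinations of the
functions `x ↦ x / (x + s)`, `s > 0`. -/
theorem ContractionMonotone.exists_sum_div_near {k : ℕ} {a h : Fin k → ℝ}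
    (hJ : ContractionMonotone a h) (ha : StrictMono a) (hpos : ∀ i, 0 < a i) {ε : ℝ}
    (hε : 0 < ε) :
    ∃ (n : ℕ) (m s : Fin n → ℝ), (∀ j, 0 ≤ m j) ∧ (∀ j, 0 < s j) ∧
      ∀ i, |∑ j, m j * (a i / (a i + s j)) - h i| < ε := by
  set g : ℝ → Fin k → ℝ := fun s i => a i / (a i + s)
  set K : PointedCone ℝ (Fin k → ℝ) := PointedCone.hull ℝ (g '' Set.Ioi 0) with hK
  have hmem : h ∈ closure (K : Set (Fin k → ℝ)) := by
    by_contra hcon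
    let P : ProperCone ℝ (Fin k → ℝ) := ⟨K.closure, isClosed_closure⟩
    obtain ⟨φ, hφ, hneg⟩ := P.hyperplane_separation_point (x₀ := h) hcon
    have hφ' : ∀ x, φ x = ∑ i, φ (Pi.single i 1) * x i := by
      intro x
      conv_lhs => rw [pi_eq_sum_univ' x]
      simp [map_sum, mul_comm]
    refine absurd (hJ.sum_nonneg_of_forall_sum_div ha hpos (c := fun i => φ (Pi.single i 1)) ?_)
      (by rw [← hφ']; exact not_le.2 hneg)
    intro s hs
    have := hφ (g s) (subset_closure (Submodule.subset_span ⟨s, hs, rfl⟩))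
    rwa [hφ'] at this
  obtain ⟨p, hp, hd⟩ := Metric.mem_closure_iff.1 hmem ε hε
  obtain ⟨n, m, t, rfl⟩ := Submodule.mem_span_set'.1 hp
  choose s hs hst using fun j => (t j).2
  refine ⟨n, fun j => m j, s, fun j => (m j).2, hs, fun i => ?_⟩
  have := (dist_le_pi_dist _ _ i).trans_lt hd
  rw [dist_comm, Real.dist_eq] at this
  have hsum : (∑ j, m j • (t j : Fin k → ℝ)) i = ∑ j, (m j : ℝ) * (a i / (a i + s j)) := by
    rw [Finset.sum_apply]
    refine sum_congr rfl fun j _ => ?_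
    rw [← hst j]
    rfl
  rwa [hsum] at this

end HalfLine

section Operators

set_option linter.unusedSectionVars false

open Finset

theorem le_of_forall_reApplyInnerSelf_le {S T : H →L[ℂ] H} (hS : IsSelfAdjoint S)
    (hT : IsSelfAdjoint T) (h : ∀ v, S.reApplyInnerSelf v ≤ T.reApplyInnerSelf v) : S ≤ T := by
  rw [ContinuousLinearMap.le_def, ContinuousLinearMap.isPositive_def']
  refine ⟨hT.sub hS, fun v => ?_⟩
  have := h v
  simp only [ContinuousLinearMap.reApplyInnerSelf_apply] at this ⊢
  simpa [inner_sub_left] using this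

theorem reApplyInnerSelf_le_of_le {S T : H →L[ℂ] H} (h : S ≤ T) (v : H) :
    S.reApplyInnerSelf v ≤ T.reApplyInnerSelf v := by
  rw [ContinuousLinearMap.le_def] at h
  have := h.re_inner_nonneg_left v
  simp only [ContinuousLinearMap.reApplyInnerSelf_apply]
  simpa [inner_sub_left] using this

theorem mem_spectrum_of_apply_eq_smul {D : H →L[ℂ] H} {v : H} (hv : v ≠ 0) {c : ℝ}
    (h : D v = (c : ℂ) • v) : c ∈ spectrum ℝ D := by
  rw [spectrum.mem_iff]
  rintro ⟨u, hu⟩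
  apply hv
  have h0 : (u : H →L[ℂ] H) v = 0 := by
    rw [hu, sub_apply, h, Algebra.algebraMap_eq_smul_one]
    simp
  calc v = ((↑u⁻¹ * (u : H →L[ℂ] H) : H →L[ℂ] H)) v := by rw [u.inv_mul]; rfl
    _ = (↑u⁻¹ : H →L[ℂ] H) ((u : H →L[ℂ] H) v) := rfl
    _ = 0 := by rw [h0, map_zero]

theorem cfc_apply_eq_smul_of_apply_eq_smul {D : H →L[ℂ] H} (hD : IsSelfAdjoint D) {v : H} {c : ℝ}
    (h : D v = (c : ℂ) • v) {f : ℝ → ℝ} (hf : ContinuousOn f (spectrum ℝ D)) :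
    cfc f D v = (f c : ℂ) • v := by
  rcases eq_or_ne v 0 with rfl | hv
  · simp
  have hc := mem_spectrum_of_apply_eq_smul hv h
  have key : ∀ g : C(spectrum ℝ D, ℝ), cfcHom hD g v = (g ⟨c, hc⟩ : ℂ) • v := by
    intro g
    induction g using ContinuousMap.induction_on_of_compact with
    | const r =>
      have : ContinuousMap.const (spectrum ℝ D) r = algebraMap ℝ _ r := rfl
      rw [this, AlgHomClass.commutes, Algebra.algebraMap_eq_smul_one]
      simp
    | id => rw [cfcHom_id]; simpa using h
    | star_id => rw [map_star, cfcHom_id, hD.star_eq]; simpa using h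
    | add f g hf hg => simp [hf, hg, add_smul]
    | mul f g hf hg =>
      rw [map_mul, mul_apply_eq_comp, hg, map_smul, hf, smul_smul, mul_comm]
      simp
    | frequently f hf =>
      refine hf.mem_of_closed (isClosed_eq ?_ ?_)
      · exact (ContinuousLinearMap.apply ℂ H v).continuous.comp (cfcHom_continuous hD)
      · fun_prop
  rw [cfc_apply f D hD hf, key]
  rfl

theorem cfc_star_conj_of_unitary {U D : H →L[ℂ] H} (hU : U ∈ unitary (H →L[ℂ] H))
    (hD : IsSelfAdjoint D) {f : ℝ → ℝ} (hf : ContinuousOn f (spectrum ℝ D)) :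
    cfc f (star U * D * U) = star U * cfc f D * U := by
  have h := StarAlgHomClass.map_cfc (Unitary.conjStarAlgAut ℝ (H →L[ℂ] H) (star ⟨U, hU⟩)) f D hf
    (by change Continuous fun x => star U * x * star (star U); fun_prop) hD
    (by simpa using hD.conjugate' U)
  simpa using h.symm

/-- For orthonormal `e`, the operator acting as `b i` on `e i`, `i ∈ s`, and as `c` on the
orthogonal complement of these vectors. -/
noncomputable def diagOp {ι : Type*} (e : ι → H) (s : Finset ι) (b : ι → ℝ) (c : ℝ) : H →L[ℂ] H :=
  (c : ℂ) • 1 + ∑ i ∈ s, ((b i - c : ℝ) : ℂ) • InnerProductSpace.rankOne ℂ (e i) (e i)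

theorem isSelfAdjoint_diagOp {ι : Type*} (e : ι → H) (s : Finset ι) (b : ι → ℝ) (c : ℝ) :
    IsSelfAdjoint (diagOp e s b c) := by
  simp [diagOp, IsSelfAdjoint, star_sum, ContinuousLinearMap.star_eq_adjoint]

theorem reApplyInnerSelf_diagOp {ι : Type*} (e : ι → H) (s : Finset ι) (b : ι → ℝ) (c : ℝ) (v : H) :
    (diagOp e s b c).reApplyInnerSelf v =
      c * ‖v‖ ^ 2 + ∑ i ∈ s, (b i - c) * ‖inner ℂ (e i) v‖ ^ 2 := by
  have h : ∀ z : ℂ, ((starRingEnd ℂ) z * z) = ((‖z‖ ^ 2 : ℝ) : ℂ) := fun z => by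
    rw [mul_comm, Complex.mul_conj, Complex.normSq_eq_norm_sq]
  rw [ContinuousLinearMap.reApplyInnerSelf_apply]
  have : inner ℂ (diagOp e s b c v) v =
      ((c * ‖v‖ ^ 2 + ∑ i ∈ s, (b i - c) * ‖inner ℂ (e i) v‖ ^ 2 : ℝ) : ℂ) := by
    simp only [diagOp, add_apply, smul_apply, one_apply_eq_self, inner_add_left,
      inner_smul_left, _root_.sum_apply, sum_inner, InnerProductSpace.rankOne_apply,
      Complex.conj_ofReal, h, inner_self_eq_norm_sq_to_K]
    push_cast
    rfl
  rw [this]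
  exact Complex.ofReal_re _

theorem diagOp_apply_mem {ι : Type*} {e : ι → H} (he : Orthonormal ℂ e) {s : Finset ι} (b : ι → ℝ)
    (c : ℝ) {i : ι} (hi : i ∈ s) : diagOp e s b c (e i) = (b i : ℂ) • e i := by
  classical
  simp only [diagOp, add_apply, smul_apply, one_apply_eq_self,
      _root_.sum_apply, InnerProductSpace.rankOne_apply]
  rw [Finset.sum_eq_single i]
  · rw [inner_self_eq_norm_sq_to_K, he.1 i, ← sub_eq_zero]
    push_cast
    module
  · intro j _ hj
    rw [he.2 hj]
    simp
  · exact fun h => absurd hi h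

theorem smul_one_le_diagOp {ι : Type*} {e : ι → H} (he : Orthonormal ℂ e) {s : Finset ι}
    {b : ι → ℝ} {c δ : ℝ} (hc : δ ≤ c) (hb : ∀ i ∈ s, δ ≤ b i) :
    algebraMap ℝ (H →L[ℂ] H) δ ≤ diagOp e s b c := by
  have h0 : algebraMap ℝ (H →L[ℂ] H) δ = diagOp e ∅ b δ := by
    simp [diagOp, Algebra.algebraMap_eq_smul_one]
  rw [h0]
  refine le_of_forall_reApplyInnerSelf_le (isSelfAdjoint_diagOp ..) (isSelfAdjoint_diagOp ..) ?_
  intro v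
  simp only [reApplyInnerSelf_diagOp, sum_empty, add_zero]
  have h1 := he.sum_inner_products_le v (s := s)
  have h2 : 0 ≤ ∑ i ∈ s, (b i - δ) * ‖inner ℂ (e i) v‖ ^ 2 :=
    sum_nonneg fun i hi => mul_nonneg (sub_nonneg.2 (hb i hi)) (by positivity)
  have h3 : ∑ i ∈ s, (b i - c) * ‖inner ℂ (e i) v‖ ^ 2 =
      ∑ i ∈ s, (b i - δ) * ‖inner ℂ (e i) v‖ ^ 2 - (c - δ) * ∑ i ∈ s, ‖inner ℂ (e i) v‖ ^ 2 := by
    rw [mul_sum, ← sum_sub_distrib]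
    exact sum_congr rfl fun i _ => by ring
  nlinarith [mul_nonneg (sub_nonneg.2 hc) (sub_nonneg.2 h1)]

theorem isStrictlyPositive_diagOp {ι : Type*} {e : ι → H} (he : Orthonormal ℂ e) {s : Finset ι}
    {b : ι → ℝ} {c : ℝ} (hc : 0 < c) (hb : ∀ i ∈ s, 0 < b i) :
    IsStrictlyPositive (diagOp e s b c) := by
  obtain ⟨δ, hδ, hδc, hδb⟩ : ∃ δ, 0 < δ ∧ δ ≤ c ∧ ∀ i ∈ s, δ ≤ b i := by
    induction s using Finset.cons_induction with
    | empty => exact ⟨c, hc, le_rfl, by simp⟩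
    | cons i s hi ih =>
      obtain ⟨δ, h1, h2, h3⟩ := ih fun j hj => hb j (mem_cons_of_mem hj)
      refine ⟨min δ (b i), lt_min h1 (hb i (mem_cons_self i s)), (min_le_left _ _).trans h2, ?_⟩
      intro j hj
      rcases mem_cons.1 hj with rfl | hj
      · exact min_le_right _ _
      · exact (min_le_left _ _).trans (h3 j hj)
  exact IsStrictlyPositive.of_le (isStrictlyPositive_algebraMap hδ) (smul_one_le_diagOp he hδc hδb)

theorem sqrt_one_sub_add_sub_star_mem_unitary {T : H →L[ℂ] H} (hT2 : T * T = 0) (hT : ‖T‖ ≤ 1) :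
    CFC.sqrt (1 - (star T * T + T * star T)) + (T - star T) ∈ unitary (H →L[ℂ] H) := by
  set W := 1 - (star T * T + T * star T) with hW
  have hT2' : star T * star T = 0 := by rw [← star_mul, hT2, star_zero]
  have hle : ∀ R : H →L[ℂ] H, ‖R‖ ≤ 1 → 0 ≤ 1 - star R * R := by
    intro R hR
    rw [sub_nonneg]
    refine le_of_forall_reApplyInnerSelf_le (.star_mul_self R) (.one _) fun v => ?_
    simp only [ContinuousLinearMap.reApplyInnerSelf_apply, mul_apply_eq_comp,
      ContinuousLinearMap.star_eq_adjoint, ContinuousLinearMap.adjoint_inner_left,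
      one_apply_eq_self, inner_self_eq_norm_sq]
    gcongr
    simpa using R.le_of_opNorm_le hR v
  have hWnn : 0 ≤ W := by
    have h1 := hle T hT
    have h2 := hle (star T) (by rwa [norm_star])
    rw [star_star] at h2
    have e1 : star T * T * (T * star T) = 0 := by
      rw [mul_assoc, ← mul_assoc T T, hT2, zero_mul, mul_zero]
    have e2 : T * star T * (star T * T) = 0 := by
      rw [mul_assoc, ← mul_assoc (star T) (star T), hT2', zero_mul, mul_zero]
    have := Commute.mul_nonneg h1 h2 (by
      rw [commute_iff_eq]
      simp only [sub_mul, mul_sub, one_mul, mul_one, e1, e2]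
      abel)
    convert this using 1
    simp only [sub_mul, mul_sub, one_mul, mul_one, e1, hW]
    abel
  have hKK : (T - star T) * (T - star T) = W - 1 := by
    simp only [sub_mul, mul_sub, hT2, hT2', hW]
    abel
  have hWK : Commute W (T - star T) := by
    have : W = (T - star T) * (T - star T) + 1 := by rw [hKK]; abel
    rw [this]
    exact ((Commute.refl _).mul_left (Commute.refl _)).add_left (Commute.one_left _)
  have hSK : Commute (CFC.sqrt W) (T - star T) := hWK.cfcₙ_nnreal _
  have hSS : CFC.sqrt W * CFC.sqrt W = W := CFC.sqrt_mul_sqrt_self W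
  have hSstar : star (CFC.sqrt W) = CFC.sqrt W := (CFC.sqrt_nonneg W).isSelfAdjoint
  have hKstar : star (T - star T) = -(T - star T) := by rw [star_sub, star_star]; abel
  rw [Unitary.mem_iff, star_add, hSstar, hKstar]
  constructor
  · simp only [add_mul, mul_add, neg_mul, hSS, hKK, hSK.eq]
    abel
  · simp only [add_mul, mul_add, mul_neg, hSS, hKK, hSK.eq]
    abel

theorem sum_mul_norm_sq_le_of_real {ι : Type*} {X Y : Finset ι} {t : ι → ι → ℝ} {α β : ι → ℝ}
    (h : ∀ r : ι → ℝ, ∑ x ∈ X, α x * (∑ y ∈ Y, t x y * r y) ^ 2 ≤ ∑ y ∈ Y, β y * r y ^ 2)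
    (z : ι → ℂ) :
    ∑ x ∈ X, α x * ‖∑ y ∈ Y, (t x y : ℂ) * z y‖ ^ 2 ≤ ∑ y ∈ Y, β y * ‖z y‖ ^ 2 := by
  have key : ∀ w : ℂ, ‖w‖ ^ 2 = w.re ^ 2 + w.im ^ 2 := fun w => by
    rw [← Complex.normSq_eq_norm_sq, Complex.normSq_apply]; ring
  have h1 := add_le_add (h fun y => (z y).re) (h fun y => (z y).im)
  simp only [key, mul_add, sum_add_distrib, Complex.re_sum, Complex.im_sum, Complex.re_ofReal_mul,
    Complex.im_ofReal_mul]
  exact h1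

/-- The operator with matrix `t` from the span of `e y`, `y ∈ Y`, to the span of `e x`, `x ∈ X`. -/
noncomputable def matrixOp {ι : Type*} (e : ι → H) (X Y : Finset ι) (t : ι → ι → ℝ) : H →L[ℂ] H :=
  ∑ x ∈ X, ∑ y ∈ Y, (t x y : ℂ) • InnerProductSpace.rankOne ℂ (e x) (e y)

section matrixOp
variable {ι : Type*} {e : ι → H} {X Y : Finset ι} {t : ι → ι → ℝ}

theorem inner_eq_zero_of_disjoint (he : Orthonormal ℂ e) (hXY : Disjoint X Y) {x y : ι}
    (hx : x ∈ X) (hy : y ∈ Y) : inner ℂ (e y) (e x) = 0 := by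
  refine he.2 ?_
  rintro rfl
  exact Finset.disjoint_left.1 hXY hx hy

theorem matrixOp_apply (v : H) :
    matrixOp e X Y t v = ∑ x ∈ X, (∑ y ∈ Y, (t x y : ℂ) * inner ℂ (e y) v) • e x := by
  simp only [matrixOp, _root_.sum_apply, smul_apply, InnerProductSpace.rankOne_apply, sum_smul,
    smul_smul]

theorem inner_matrixOp_apply (he : Orthonormal ℂ e) (v : H) {x : ι} (hx : x ∈ X) :
    inner ℂ (e x) (matrixOp e X Y t v) = ∑ y ∈ Y, (t x y : ℂ) * inner ℂ (e y) v := by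
  rw [matrixOp_apply, he.inner_right_sum _ hx]

theorem inner_matrixOp_apply_of_disjoint (he : Orthonormal ℂ e) (hXY : Disjoint X Y) (v : H)
    {y : ι} (hy : y ∈ Y) : inner ℂ (e y) (matrixOp e X Y t v) = 0 := by
  rw [matrixOp_apply, inner_sum]
  refine sum_eq_zero fun x hx => ?_
  rw [inner_smul_right, inner_eq_zero_of_disjoint he hXY hx hy, mul_zero]

theorem matrixOp_mul_self (he : Orthonormal ℂ e) (hXY : Disjoint X Y) :
    matrixOp e X Y t * matrixOp e X Y t = 0 := by
  ext v
  rw [mul_apply_eq_comp, matrixOp_apply]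
  refine sum_eq_zero fun x _ => ?_
  rw [sum_eq_zero fun y hy => by rw [inner_matrixOp_apply_of_disjoint he hXY v hy, mul_zero],
    zero_smul]

theorem matrixOp_apply_of_disjoint (he : Orthonormal ℂ e) (hXY : Disjoint X Y)
    {x : ι} (hx : x ∈ X) : matrixOp e X Y t (e x) = 0 := by
  rw [matrixOp_apply]
  refine sum_eq_zero fun x' _ => ?_
  rw [sum_eq_zero fun y hy => by
    rw [inner_eq_zero_of_disjoint he hXY hx hy, mul_zero], zero_smul]

theorem norm_matrixOp_le_one (he : Orthonormal ℂ e)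
    (ht : ∀ r : ι → ℝ, ∑ x ∈ X, (∑ y ∈ Y, t x y * r y) ^ 2 ≤ ∑ y ∈ Y, r y ^ 2) :
    ‖matrixOp e X Y t‖ ≤ 1 := by
  refine ContinuousLinearMap.opNorm_le_bound _ zero_le_one fun v => ?_
  rw [one_mul]
  refine (sq_le_sq₀ (norm_nonneg _) (norm_nonneg _)).1 ?_
  calc ‖matrixOp e X Y t v‖ ^ 2 = ∑ x ∈ X, ‖∑ y ∈ Y, (t x y : ℂ) * inner ℂ (e y) v‖ ^ 2 := by
        rw [matrixOp_apply]
        have := he.inner_sum (fun x => ∑ y ∈ Y, (t x y : ℂ) * inner ℂ (e y) v)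
          (fun x => ∑ y ∈ Y, (t x y : ℂ) * inner ℂ (e y) v) X
        rw [inner_self_eq_norm_sq_to_K] at this
        have h2 : ∀ z : ℂ, ((starRingEnd ℂ) z * z) = ((‖z‖ ^ 2 : ℝ) : ℂ) := fun z => by
          rw [mul_comm, Complex.mul_conj, Complex.normSq_eq_norm_sq]
        simp only [h2] at this
        refine Complex.ofReal_injective ?_
        push_cast at this ⊢
        exact this
    _ ≤ ∑ y ∈ Y, ‖inner ℂ (e y) v‖ ^ 2 := by
        simpa using sum_mul_norm_sq_le_of_real (α := fun _ => 1) (β := fun _ => 1)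
          (by simpa using ht) (fun y => inner ℂ (e y) v)
    _ ≤ ‖v‖ ^ 2 := he.sum_inner_products_le v

end matrixOp

theorem IsOperatorConcaveOn.smul_cfc_le_cfc_smul {h : ℝ → ℝ} (hconc : IsOperatorConcaveOn H h)
    (hpos : ∀ t, 0 < t → 0 < h t) {N D : H →L[ℂ] H} (hN : IsStrictlyPositive N)
    (hND : IsStrictlyPositive (D - N)) {c : ℝ} (hc0 : 0 < c) (hc1 : c < 1) :
    c • cfc h N ≤ cfc h (c • D) := by
  have hd : 0 < 1 - c := by linarith
  have hB : IsStrictlyPositive ((c / (1 - c)) • (D - N)) := hND.smul (by positivity)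
  have key := hconc N _ hN.nonneg hN.isUnit hB.nonneg hB.isUnit c ⟨hc0.le, hc1.le⟩
  have hD : c • N + (1 - c) • (c / (1 - c)) • (D - N) = c • D := by
    rw [smul_smul, mul_div_cancel₀ _ hd.ne', ← smul_add]
    simp
  rw [hD, cfc_neg, cfc_neg, cfc_neg] at key
  have hnn : 0 ≤ cfc h ((c / (1 - c)) • (D - N)) :=
    cfc_nonneg fun x hx => (hpos x (hB.spectrum_pos hx)).le
  have := smul_nonneg hd.le hnn
  rw [smul_neg, smul_neg, ← neg_add, neg_le_neg_iff] at key
  exact (le_add_of_nonneg_right this).trans key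

theorem sum_mul_norm_inner_sq_le_reApplyInnerSelf {ι : Type*} {e : ι → H} (he : Orthonormal ℂ e)
    {X : Finset ι} {G : H →L[ℂ] H} (hG : 0 ≤ G) {g : ι → ℝ}
    (hg : ∀ x ∈ X, G (e x) = (g x : ℂ) • e x) (w : H) :
    ∑ x ∈ X, g x * ‖inner ℂ (e x) w‖ ^ 2 ≤ G.reApplyInnerSelf w := by
  set u := ∑ x ∈ X, inner ℂ (e x) w • e x with hu
  have hGu : G u = ∑ x ∈ X, ((g x : ℂ) * inner ℂ (e x) w) • e x := by
    rw [hu, map_sum]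
    refine sum_congr rfl fun x hx => ?_
    rw [map_smul, hg x hx, smul_smul, mul_comm]
  have h2 : ∀ z : ℂ, ((starRingEnd ℂ) z * z) = ((‖z‖ ^ 2 : ℝ) : ℂ) := fun z => by
    rw [mul_comm, Complex.mul_conj, Complex.normSq_eq_norm_sq]
  have h3 : inner ℂ (G u) u = ((∑ x ∈ X, g x * ‖inner ℂ (e x) w‖ ^ 2 : ℝ) : ℂ) := by
    rw [hGu, hu, he.inner_sum]
    push_cast
    refine sum_congr rfl fun x _ => ?_
    rw [map_mul, Complex.conj_ofReal, mul_assoc, h2]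
    push_cast
    rfl
  have h4 : inner ℂ (G u) w = ((∑ x ∈ X, g x * ‖inner ℂ (e x) w‖ ^ 2 : ℝ) : ℂ) := by
    rw [hGu, sum_inner]
    push_cast
    refine sum_congr rfl fun x _ => ?_
    rw [inner_smul_left, map_mul, Complex.conj_ofReal, mul_assoc, h2]
    push_cast
    rfl
  have hGp := (ContinuousLinearMap.nonneg_iff_isPositive _).1 hG
  have h5 := hGp.re_inner_nonneg_left (w - u)
  have h6 : inner ℂ (G w) u = (starRingEnd ℂ) (inner ℂ (G u) w) := by
    rw [hGp.inner_left_eq_inner_right, inner_conj_symm]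
  rw [map_sub, inner_sub_left, inner_sub_right, inner_sub_right, h6, h3, h4] at h5
  simp only [map_sub, Complex.conj_ofReal] at h5
  have h7 : ∀ s : ℝ, RCLike.re (s : ℂ) = s := fun s => Complex.ofReal_re s
  rw [h7] at h5
  rw [ContinuousLinearMap.reApplyInnerSelf_apply]
  linarith

theorem reApplyInnerSelf_add_le {N : H →L[ℂ] H} (hN : 0 ≤ N) {ε : ℝ} (hε : 0 < ε) (u w : H) :
    N.reApplyInnerSelf (u + w) ≤
      (1 + ε) * N.reApplyInnerSelf u + (1 + ε⁻¹) * N.reApplyInnerSelf w := by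
  have hNp := (ContinuousLinearMap.nonneg_iff_isPositive _).1 hN
  have h1 := hNp.re_inner_nonneg_left ((ε : ℂ) • u - w)
  have h6 : RCLike.re (inner ℂ (N w) u) = RCLike.re (inner ℂ (N u) w) := by
    rw [hNp.inner_left_eq_inner_right, ← inner_conj_symm, RCLike.conj_re]
  have h7 : ∀ (s : ℝ) (z : ℂ), RCLike.re ((s : ℂ) * z) = s * RCLike.re z :=
    fun s z => Complex.re_ofReal_mul s z
  simp only [map_sub, map_smul, inner_sub_left, inner_sub_right, inner_smul_left,
    inner_smul_right, Complex.conj_ofReal, h7, h6] at h1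
  simp only [ContinuousLinearMap.reApplyInnerSelf_apply, map_add, inner_add_left,
    inner_add_right, h6]
  have h8 := mul_nonneg (inv_nonneg.2 hε.le) h1
  have h9 : ε⁻¹ * ε = 1 := inv_mul_cancel₀ hε.ne'
  linear_combination h8 + (ε * RCLike.re (inner ℂ (N u) u) - 2 * RCLike.re (inner ℂ (N u) w)) * h9

section
variable {ι : Type*} {e : ι → H} {X Y : Finset ι} {t : ι → ι → ℝ}

theorem diagOp_one_zero_apply (v : H) :
    diagOp e Y (fun _ => 1) 0 v = ∑ y ∈ Y, inner ℂ (e y) v • e y := by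
  simp [diagOp]

theorem inner_diagOp_one_zero_apply (he : Orthonormal ℂ e) (v : H) {y : ι} (hy : y ∈ Y) :
    inner ℂ (e y) (diagOp e Y (fun _ => 1) 0 v) = inner ℂ (e y) v := by
  rw [diagOp_one_zero_apply, he.inner_right_sum _ hy]

theorem diagOp_one_zero_apply_apply (he : Orthonormal ℂ e) (v : H) :
    diagOp e Y (fun _ => 1) 0 (diagOp e Y (fun _ => 1) 0 v) = diagOp e Y (fun _ => 1) 0 v := by
  rw [diagOp_one_zero_apply (diagOp e Y (fun _ => 1) 0 v), diagOp_one_zero_apply v]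
  refine sum_congr rfl fun y hy => ?_
  rw [← diagOp_one_zero_apply, inner_diagOp_one_zero_apply he v hy]

theorem inner_unitary_apply (he : Orthonormal ℂ e) (hXY : Disjoint X Y) {x : ι} (hx : x ∈ X)
    {u : H} (hu : diagOp e Y (fun _ => 1) 0 u = u) :
    inner ℂ (e x) ((CFC.sqrt (1 - (star (matrixOp e X Y t) * matrixOp e X Y t +
      matrixOp e X Y t * star (matrixOp e X Y t))) +
        (matrixOp e X Y t - star (matrixOp e X Y t))) u) =
      ∑ y ∈ Y, (t x y : ℂ) * inner ℂ (e y) u := by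
  set P := diagOp e Y (fun _ => 1) 0 with hP
  set T := matrixOp e X Y t with hT
  have hPs : star P = P := (isSelfAdjoint_diagOp e Y _ 0).star_eq
  have hPT : P * T = 0 := by
    ext v
    rw [mul_apply_eq_comp, hP, diagOp_one_zero_apply]
    exact sum_eq_zero fun y hy => by
      rw [inner_matrixOp_apply_of_disjoint he hXY v hy, zero_smul]
  have hTP : T * P = T := by
    ext v
    rw [mul_apply_eq_comp, hT, matrixOp_apply, matrixOp_apply]
    refine sum_congr rfl fun x _ => ?_
    rw [sum_congr rfl fun y hy => by rw [inner_diagOp_one_zero_apply he v hy]]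
  have hPT' : P * star T = star T := by rw [← hPs, ← star_mul, hTP]
  have hTP' : star T * P = 0 := by rw [← hPs, ← star_mul, hPT, star_zero]
  have hcomm : Commute (1 - (star T * T + T * star T)) P := by
    refine (Commute.one_left _).sub_left ?_
    rw [commute_iff_eq, add_mul, mul_add, mul_assoc, hTP, mul_assoc, hTP', ← mul_assoc, hPT',
      ← mul_assoc, hPT, mul_zero, zero_mul]
  have hSP : Commute (CFC.sqrt (1 - (star T * T + T * star T))) P := hcomm.cfcₙ_nnreal _
  have hPx : P (e x) = 0 := by
    rw [hP, diagOp_one_zero_apply]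
    exact sum_eq_zero fun y hy => by rw [inner_eq_zero_of_disjoint he hXY hx hy, zero_smul]
  have h1 : inner ℂ (e x) (CFC.sqrt (1 - (star T * T + T * star T)) u) = 0 := by
    conv_lhs => rw [← hu]
    rw [← mul_apply_eq_comp, hSP.eq, mul_apply_eq_comp, ← hPs,
      ContinuousLinearMap.star_eq_adjoint, ContinuousLinearMap.adjoint_inner_right, hPx,
      inner_zero_left]
  have h2 : inner ℂ (e x) (star T u) = 0 := by
    rw [ContinuousLinearMap.star_eq_adjoint, ContinuousLinearMap.adjoint_inner_right, hT,
      matrixOp_apply_of_disjoint he hXY hx, inner_zero_left]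
  rw [add_apply, sub_apply, inner_add_right, inner_sub_right, h1, h2, hT,
    inner_matrixOp_apply he u hx]
  simp

end

theorem reApplyInnerSelf_star_mul_mul (U D : H →L[ℂ] H) (v : H) :
    (star U * D * U).reApplyInnerSelf v = D.reApplyInnerSelf (U v) := by
  simp only [ContinuousLinearMap.reApplyInnerSelf_apply, mul_apply_eq_comp,
    ContinuousLinearMap.star_eq_adjoint, ContinuousLinearMap.adjoint_inner_left]

theorem reApplyInnerSelf_real_smul (c : ℝ) (D : H →L[ℂ] H) (v : H) :
    (c • D).reApplyInnerSelf v = c * D.reApplyInnerSelf v := by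
  rw [ContinuousLinearMap.reApplyInnerSelf_apply, smul_apply,
    RCLike.real_smul_eq_coe_smul (K := ℂ), inner_smul_left]
  exact (congrArg Complex.re (by rw [RCLike.conj_ofReal]; rfl)).trans (Complex.re_ofReal_mul c _)

theorem norm_unitary_apply {U : H →L[ℂ] H} (hU : U ∈ unitary (H →L[ℂ] H)) (v : H) :
    ‖U v‖ = ‖v‖ := by
  have : inner ℂ (U v) (U v) = inner ℂ v v := by
    rw [← ContinuousLinearMap.adjoint_inner_left, ← ContinuousLinearMap.star_eq_adjoint,
      ← mul_apply_eq_comp, (Unitary.mem_iff.1 hU).1, one_apply_eq_self]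
  rw [norm_eq_sqrt_re_inner (𝕜 := ℂ), norm_eq_sqrt_re_inner (𝕜 := ℂ) v, this]

theorem reApplyInnerSelf_le_norm_mul (N : H →L[ℂ] H) (w : H) :
    N.reApplyInnerSelf w ≤ ‖N‖ * ‖w‖ ^ 2 := by
  rw [ContinuousLinearMap.reApplyInnerSelf_apply]
  calc RCLike.re (inner ℂ (N w) w) ≤ ‖N w‖ * ‖w‖ := re_inner_le_norm _ _
    _ ≤ ‖N‖ * ‖w‖ * ‖w‖ := by gcongr; exact N.le_opNorm w
    _ = ‖N‖ * ‖w‖ ^ 2 := by ring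

section
variable {ι : Type*} {e : ι → H} {X Y : Finset ι}

theorem reApplyInnerSelf_diagOp_eq_add (he : Orthonormal ℂ e) (b : ι → ℝ) (c : ℝ) (v : H) :
    (diagOp e Y b c).reApplyInnerSelf v =
      ∑ y ∈ Y, b y * ‖inner ℂ (e y) v‖ ^ 2 +
        c * ‖v - diagOp e Y (fun _ => 1) 0 v‖ ^ 2 := by
  set P := diagOp e Y (fun _ => 1) 0 with hP
  have hid : P (P v) = P v := diagOp_one_zero_apply_apply he v
  have h1 : RCLike.re (inner ℂ (P v) v) = ∑ y ∈ Y, ‖inner ℂ (e y) v‖ ^ 2 := by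
    have := reApplyInnerSelf_diagOp e Y (fun _ => 1) 0 v
    simpa [ContinuousLinearMap.reApplyInnerSelf_apply] using this
  have h2 : RCLike.re (inner ℂ (P v) (P v)) = RCLike.re (inner ℂ (P v) v) := by
    have hs := isSelfAdjoint_diagOp e Y (fun _ => 1) 0
    rw [← ContinuousLinearMap.adjoint_inner_left, ← ContinuousLinearMap.star_eq_adjoint,
      hs.star_eq, hid]
  have h3 : ‖v - P v‖ ^ 2 = ‖v‖ ^ 2 - ∑ y ∈ Y, ‖inner ℂ (e y) v‖ ^ 2 := by
    rw [norm_sub_sq (𝕜 := ℂ), ← inner_self_eq_norm_sq (𝕜 := ℂ) (P v), h2, inner_re_symm, h1]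
    ring
  rw [h3, reApplyInnerSelf_diagOp, mul_sub, mul_sum, add_sub_left_comm, ← sum_sub_distrib]
  congr 1
  exact sum_congr rfl fun y _ => by ring

theorem norm_diagOp_one_zero_apply_sq (he : Orthonormal ℂ e) (v : H) :
    ‖diagOp e Y (fun _ => 1) 0 v‖ ^ 2 = ∑ y ∈ Y, ‖inner ℂ (e y) v‖ ^ 2 := by
  have h := he.inner_sum (fun y => inner ℂ (e y) v) (fun y => inner ℂ (e y) v) Y
  rw [← diagOp_one_zero_apply, inner_self_eq_norm_sq_to_K] at h
  refine Complex.ofReal_injective ?_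
  push_cast
  refine h.trans (sum_congr rfl fun y _ => ?_)
  rw [mul_comm, Complex.mul_conj, Complex.normSq_eq_norm_sq]
  push_cast
  rfl

/-- A positive operator concave function is contraction monotone on any family of points indexed by
an orthonormal family of the underlying Hilbert space. -/
theorem contractionMonotone_of_isOperatorConcaveOn (he : Orthonormal ℂ e) {a : ι → ℝ}
    (ha : ∀ i, 0 < a i) {h : ℝ → ℝ} (hcont : ContinuousOn h (Set.Ioi 0))
    (hpos : ∀ t, 0 < t → 0 < h t) (hconc : IsOperatorConcaveOn H h) :
    ContractionMonotone a (fun i => h (a i)) := by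
  intro X Y hXY t ht hta r
  have key : ∀ ε : ℝ, 0 < ε → (1 + ε)⁻¹ * ∑ x ∈ X, h (a x) * (∑ y ∈ Y, t x y * r y) ^ 2 ≤
      ∑ y ∈ Y, h ((1 + ε)⁻¹ * ((1 + ε) * (a y + ε) + ε)) * r y ^ 2 := by
    intro ε hε
    set T := matrixOp e X Y t with hT
    set P := diagOp e Y (fun _ => 1) 0 with hP
    set U := CFC.sqrt (1 - (star T * T + T * star T)) + (T - star T) with hUdef
    have hU : U ∈ unitary (H →L[ℂ] H) :=
      sqrt_one_sub_add_sub_star_mem_unitary (matrixOp_mul_self he hXY) (norm_matrixOp_le_one he ht)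
    have hUx : ∀ x ∈ X, ∀ u, P u = u → inner ℂ (e x) (U u) =
        ∑ y ∈ Y, (t x y : ℂ) * inner ℂ (e y) u :=
      fun x hx u hu => inner_unitary_apply he hXY hx hu
    set D₀ := diagOp e X a ε with hD₀
    have hD₀pos : IsStrictlyPositive D₀ := isStrictlyPositive_diagOp he hε fun i _ => ha i
    set N := star U * D₀ * U with hNdef
    have hUunit : IsUnit U :=
      ⟨⟨U, star U, (Unitary.mem_iff.1 hU).2, (Unitary.mem_iff.1 hU).1⟩, rfl⟩
    have hN : IsStrictlyPositive N :=
      ⟨star_left_conjugate_nonneg hD₀pos.nonneg U, (hUunit.star.mul hD₀pos.isUnit).mul hUunit⟩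
    set b : ι → ℝ := fun y => (1 + ε) * (a y + ε) + ε with hb
    set c : ℝ := (1 + ε⁻¹) * ‖N‖ + ε with hc
    set D := diagOp e Y b c with hD
    have hbpos : ∀ y, 0 < b y := fun y => by have := ha y; positivity
    have hDN : IsStrictlyPositive (D - N) := by
      refine IsStrictlyPositive.of_le (isStrictlyPositive_algebraMap hε) (le_sub_iff_add_le.2 ?_)
      refine le_of_forall_reApplyInnerSelf_le ((IsSelfAdjoint.algebraMap _ (.all _)).add
        hN.nonneg.isSelfAdjoint) (isSelfAdjoint_diagOp ..) fun v => ?_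
      have h0 : (algebraMap ℝ (H →L[ℂ] H) ε + N).reApplyInnerSelf v =
          ε * ‖v‖ ^ 2 + N.reApplyInnerSelf v := by
        have h7 : ∀ (s : ℝ) (z : ℂ), RCLike.re ((s : ℂ) * z) = s * RCLike.re z :=
          fun s z => Complex.re_ofReal_mul s z
        have h8 : algebraMap ℝ (H →L[ℂ] H) ε v = (ε : ℂ) • v := by
          rw [Algebra.algebraMap_eq_smul_one]; simp
        rw [ContinuousLinearMap.reApplyInnerSelf_apply, add_apply, inner_add_left, h8,
          inner_smul_left, Complex.conj_ofReal, map_add, h7, inner_self_eq_norm_sq]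
        rfl
      have hPv : P (P v) = P v := diagOp_one_zero_apply_apply he v
      have h1 := reApplyInnerSelf_add_le hN.nonneg hε (P v) (v - P v)
      rw [add_sub_cancel] at h1
      have h2 := reApplyInnerSelf_le_norm_mul N (v - P v)
      have h3 : N.reApplyInnerSelf (P v) ≤ ∑ y ∈ Y, (a y + ε) * ‖inner ℂ (e y) v‖ ^ 2 := by
        rw [hNdef, reApplyInnerSelf_star_mul_mul, hD₀, reApplyInnerSelf_diagOp,
          norm_unitary_apply hU, hP, norm_diagOp_one_zero_apply_sq he, mul_sum]
        simp only [add_mul, sum_add_distrib]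
        rw [add_comm]
        refine add_le_add ?_ le_rfl
        calc ∑ x ∈ X, (a x - ε) * ‖inner ℂ (e x) (U (P v))‖ ^ 2
            ≤ ∑ x ∈ X, a x * ‖∑ y ∈ Y, (t x y : ℂ) * inner ℂ (e y) (P v)‖ ^ 2 := by
              refine sum_le_sum fun x hx => ?_
              rw [hUx x hx _ hPv]
              gcongr
              linarith
          _ ≤ ∑ y ∈ Y, a y * ‖inner ℂ (e y) (P v)‖ ^ 2 :=
              sum_mul_norm_sq_le_of_real hta _
          _ = ∑ y ∈ Y, a y * ‖inner ℂ (e y) v‖ ^ 2 :=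
              sum_congr rfl fun y hy => by rw [inner_diagOp_one_zero_apply he v hy]
      have h4 := reApplyInnerSelf_diagOp_eq_add (Y := Y) he (fun _ => ε) ε v
      have h5 : (diagOp e Y (fun _ => ε) ε).reApplyInnerSelf v = ε * ‖v‖ ^ 2 := by
        rw [reApplyInnerSelf_diagOp]; simp
      have h6 : ∑ y ∈ Y, b y * ‖inner ℂ (e y) v‖ ^ 2 =
          (1 + ε) * ∑ y ∈ Y, (a y + ε) * ‖inner ℂ (e y) v‖ ^ 2 +
            ∑ y ∈ Y, ε * ‖inner ℂ (e y) v‖ ^ 2 := by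
        rw [mul_sum, ← sum_add_distrib]
        exact sum_congr rfl fun y _ => by simp only [hb]; ring
      rw [h0, hD, reApplyInnerSelf_diagOp_eq_add he, h6, ← h5, h4, hc]
      have h9 := mul_le_mul_of_nonneg_left h3 (by positivity : 0 ≤ 1 + ε)
      have h10 := mul_le_mul_of_nonneg_left h2 (by positivity : 0 ≤ 1 + ε⁻¹)
      linarith
    have hl0 : 0 < (1 + ε)⁻¹ := by positivity
    have hl1 : (1 + ε)⁻¹ < 1 := inv_lt_one_of_one_lt₀ (by linarith)
    have hmono := hconc.smul_cfc_le_cfc_smul hpos hN hDN hl0 hl1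
    set v := ∑ y ∈ Y, (r y : ℂ) • e y with hv
    have hvy : ∀ y ∈ Y, inner ℂ (e y) v = (r y : ℂ) := fun y hy => by
      rw [hv, he.inner_right_sum _ hy]
    have hPv : P v = v := by
      rw [hP, diagOp_one_zero_apply, hv]
      exact sum_congr rfl fun y hy => by rw [hvy y hy]
    have hcontD₀ : ContinuousOn h (spectrum ℝ D₀) := hcont.mono fun x hx => hD₀pos.spectrum_pos hx
    have hev := reApplyInnerSelf_le_of_le hmono v
    have hDpos : IsStrictlyPositive ((1 + ε)⁻¹ • D) := by
      have h1 : IsStrictlyPositive D := by simpa using hN.add_nonneg hDN.nonneg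
      exact h1.smul hl0
    have hcontD : ContinuousOn h (spectrum ℝ ((1 + ε)⁻¹ • D)) :=
      hcont.mono fun x hx => hDpos.spectrum_pos hx
    have hright : (cfc h ((1 + ε)⁻¹ • D)).reApplyInnerSelf v =
        ∑ y ∈ Y, h ((1 + ε)⁻¹ * b y) * r y ^ 2 := by
      have h1 : cfc h ((1 + ε)⁻¹ • D) v =
          ∑ y ∈ Y, ((h ((1 + ε)⁻¹ * b y) * r y : ℝ) : ℂ) • e y := by
        rw [hv, map_sum]
        refine sum_congr rfl fun y hy => ?_
        rw [map_smul, cfc_apply_eq_smul_of_apply_eq_smul hDpos.nonneg.isSelfAdjoint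
          (c := (1 + ε)⁻¹ * b y) _ hcontD, smul_smul]
        · push_cast
          rw [mul_comm]
        · rw [smul_apply, hD, diagOp_apply_mem he b c hy, RCLike.real_smul_eq_coe_smul (K := ℂ),
            smul_smul]
          push_cast
          rfl
      rw [ContinuousLinearMap.reApplyInnerSelf_apply, h1, hv, he.inner_sum]
      rw [← Complex.ofReal_re (∑ y ∈ Y, h ((1 + ε)⁻¹ * b y) * r y ^ 2)]
      push_cast
      refine congrArg Complex.re (sum_congr rfl fun y _ => ?_)
      rw [map_mul, Complex.conj_ofReal, Complex.conj_ofReal]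
      ring
    have hleft : (1 + ε)⁻¹ * ∑ x ∈ X, h (a x) * (∑ y ∈ Y, t x y * r y) ^ 2 ≤
        ((1 + ε)⁻¹ • cfc h N).reApplyInnerSelf v := by
      rw [reApplyInnerSelf_real_smul, hNdef,
        cfc_star_conj_of_unitary hU hD₀pos.nonneg.isSelfAdjoint hcontD₀,
        reApplyInnerSelf_star_mul_mul]
      refine mul_le_mul_of_nonneg_left ?_ hl0.le
      refine le_trans (le_of_eq ?_) (sum_mul_norm_inner_sq_le_reApplyInnerSelf he (X := X)
        (cfc_nonneg fun x hx => (hpos x (hD₀pos.spectrum_pos hx)).le) (g := fun x => h (a x))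
        (fun x hx => cfc_apply_eq_smul_of_apply_eq_smul hD₀pos.nonneg.isSelfAdjoint
          (diagOp_apply_mem he a ε hx) hcontD₀) (U v))
      refine sum_congr rfl fun x hx => ?_
      have h1 : inner ℂ (e x) (U v) = ((∑ y ∈ Y, t x y * r y : ℝ) : ℂ) := by
        rw [hUx x hx v hPv]
        push_cast
        exact sum_congr rfl fun y hy => by rw [hvy y hy]
      rw [h1, Complex.norm_real, Real.norm_eq_abs, sq_abs]
    exact hleft.trans (hev.trans_eq hright)
  have hl : Filter.Tendsto (fun ε : ℝ => (1 + ε)⁻¹ *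
      ∑ x ∈ X, h (a x) * (∑ y ∈ Y, t x y * r y) ^ 2) (nhdsWithin 0 (Set.Ioi 0))
      (nhds (∑ x ∈ X, h (a x) * (∑ y ∈ Y, t x y * r y) ^ 2)) := by
    have : ContinuousAt (fun ε : ℝ => (1 + ε)⁻¹ *
      ∑ x ∈ X, h (a x) * (∑ y ∈ Y, t x y * r y) ^ 2) 0 := by fun_prop (disch := norm_num)
    simpa using this.tendsto.mono_left nhdsWithin_le_nhds
  have hr : Filter.Tendsto (fun ε : ℝ => ∑ y ∈ Y,
      h ((1 + ε)⁻¹ * ((1 + ε) * (a y + ε) + ε)) * r y ^ 2) (nhdsWithin 0 (Set.Ioi 0))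
      (nhds (∑ y ∈ Y, h (a y) * r y ^ 2)) := by
    refine tendsto_finsetSum _ fun y _ => Filter.Tendsto.mul_const _ ?_
    have h1 : ContinuousAt (fun ε : ℝ => (1 + ε)⁻¹ * ((1 + ε) * (a y + ε) + ε)) 0 := by
      fun_prop (disch := norm_num)
    have h2 : ContinuousAt h (a y) := hcont.continuousAt (Ioi_mem_nhds (ha y))
    have h3 := h1.tendsto
    norm_num at h3
    exact (h2.tendsto.comp h3).mono_left nhdsWithin_le_nhds
  exact le_of_tendsto_of_tendsto hl hr (eventually_nhdsWithin_of_forall fun ε hε => key ε hε)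

end

/-- Diagonal operators with real entries on a finite Hilbert sum of copies of `H`, as a star algebra
homomorphism. -/
noncomputable def piLpDiag (H : Type*) [NormedAddCommGroup H] [InnerProductSpace ℂ H]
    [CompleteSpace H] {ι : Type*} [Fintype ι] :
    (ι → ℝ) →⋆ₐ[ℝ] (PiLp 2 (fun _ : ι => H) →L[ℂ] PiLp 2 (fun _ : ι => H)) where
  toFun b := ((PiLp.continuousLinearEquiv 2 ℂ (fun _ : ι => H)).symm : _ →L[ℂ] _) ∘L
    ContinuousLinearMap.pi fun i => (b i : ℂ) • PiLp.proj 2 (fun _ : ι => H) i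
  map_one' := by ext v i; simp
  map_zero' := by ext v i; simp
  map_mul' b c := by ext v i; simp [mul_smul]
  map_add' b c := by ext v i; simp [add_smul]
  commutes' r := by
    ext v i
    simp [Algebra.algebraMap_eq_smul_one]
  map_star' b := by
    rw [ContinuousLinearMap.star_eq_adjoint, ContinuousLinearMap.eq_adjoint_iff]
    intro v w
    simp only [PiLp.inner_apply]
    refine sum_congr rfl fun i _ => ?_
    change inner ℂ (((b i : ℝ) : ℂ) • v i) (w i) = inner ℂ (v i) (((b i : ℝ) : ℂ) • w i)
    rw [inner_smul_left, inner_smul_right, Complex.conj_ofReal]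

theorem piLpDiag_apply {ι : Type*} [Fintype ι] (b : ι → ℝ) (v : PiLp 2 (fun _ : ι => H)) (i : ι) :
    piLpDiag H b v i = (b i : ℂ) • v i := rfl

theorem exists_adjoint_comp_piLpDiag_comp {ι : Type*} [Fintype ι] {E : ι → H →L[ℂ] H}
    (hE : ∀ i, 0 ≤ E i) : ∃ V : H →L[ℂ] PiLp 2 (fun _ : ι => H),
      ∀ b : ι → ℝ, V.adjoint ∘L piLpDiag H b ∘L V = ∑ i, b i • E i := by
  refine ⟨((PiLp.continuousLinearEquiv 2 ℂ (fun _ : ι => H)).symm : _ →L[ℂ] _) ∘L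
    ContinuousLinearMap.pi fun i => CFC.sqrt (E i), fun b => ?_⟩
  refine ContinuousLinearMap.ext fun v => ext_inner_right ℂ fun w => ?_
  rw [ContinuousLinearMap.comp_apply, ContinuousLinearMap.adjoint_inner_left, PiLp.inner_apply,
    _root_.sum_apply, sum_inner]
  refine sum_congr rfl fun i _ => ?_
  have h1 : CFC.sqrt (E i) * CFC.sqrt (E i) = E i := CFC.sqrt_mul_sqrt_self _ (hE i)
  have h2 : star (CFC.sqrt (E i)) = CFC.sqrt (E i) := (CFC.sqrt_nonneg (E i)).isSelfAdjoint
  rw [ContinuousLinearMap.comp_apply, piLpDiag_apply, smul_apply,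
    RCLike.real_smul_eq_coe_smul (K := ℂ), inner_smul_left, inner_smul_left]
  congr 1
  conv_rhs => rw [← h1, mul_apply_eq_comp]
  conv_rhs => rw [← h2, ContinuousLinearMap.star_eq_adjoint,
    ContinuousLinearMap.adjoint_inner_left, ← ContinuousLinearMap.star_eq_adjoint, h2]
  rfl

theorem piLpDiag_nonneg {ι : Type*} [Fintype ι] {b : ι → ℝ} (hb : ∀ i, 0 ≤ b i) :
    0 ≤ piLpDiag H b := by
  have : piLpDiag H b = star (piLpDiag H fun i => √(b i)) * piLpDiag H fun i => √(b i) := by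
    rw [← map_star, ← map_mul]
    congr 1
    ext i
    simp [Real.mul_self_sqrt (hb i)]
  rw [this]
  exact star_mul_self_nonneg _

section Compression

variable {K : Type*} [NormedAddCommGroup K] [InnerProductSpace ℂ K] [CompleteSpace K]

theorem adjoint_comp_comp_le {S T : K →L[ℂ] K} (hST : S ≤ T) (V : H →L[ℂ] K) :
    V.adjoint ∘L S ∘L V ≤ V.adjoint ∘L T ∘L V := by
  rw [ContinuousLinearMap.le_def] at hST ⊢
  have := hST.adjoint_conj V
  rwa [ContinuousLinearMap.sub_comp, ContinuousLinearMap.comp_sub] at this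

theorem adjoint_comp_comp_nonneg {T : K →L[ℂ] K} (hT : 0 ≤ T) (V : H →L[ℂ] K) :
    0 ≤ V.adjoint ∘L T ∘L V := by
  simpa using adjoint_comp_comp_le hT V

theorem adjoint_comp_nonneg (X : H →L[ℂ] K) : 0 ≤ X.adjoint ∘L X :=
  adjoint_comp_comp_nonneg zero_le_one X

theorem comp_adjoint_nonneg (X : H →L[ℂ] K) : 0 ≤ X ∘L X.adjoint := by
  simpa using adjoint_comp_nonneg X.adjoint

theorem comp_adjoint_le_one {V : H →L[ℂ] K} (hV : V.adjoint ∘L V = 1) : V ∘L V.adjoint ≤ 1 := by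
  have hidem : (V ∘L V.adjoint) ∘L (V ∘L V.adjoint) = V ∘L V.adjoint := by
    rw [ContinuousLinearMap.comp_assoc, ← ContinuousLinearMap.comp_assoc V.adjoint, hV]
    rfl
  have hadj : star (1 - V ∘L V.adjoint) = 1 - V ∘L V.adjoint := by
    rw [star_sub, star_one, ContinuousLinearMap.star_eq_adjoint, ContinuousLinearMap.adjoint_comp,
      ContinuousLinearMap.adjoint_adjoint]
  have h : 1 - V ∘L V.adjoint = star (1 - V ∘L V.adjoint) * (1 - V ∘L V.adjoint) := by
    rw [hadj]
    have : (V ∘L V.adjoint) * (V ∘L V.adjoint) = V ∘L V.adjoint := hidem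
    rw [sub_mul, mul_sub, mul_sub, this]
    simp
  rw [← sub_nonneg, h]
  exact star_mul_self_nonneg _

theorem isStrictlyPositive_add_algebraMap {T : H →L[ℂ] H} (hT : 0 ≤ T) {s : ℝ} (hs : 0 < s) :
    IsStrictlyPositive (T + algebraMap ℝ (H →L[ℂ] H) s) :=
  IsStrictlyPositive.nonneg_add hT (isStrictlyPositive_algebraMap hs)

/-- The operator `∑ j, m j • T (T + s j)⁻¹`, written in terms of resolvents of `T`. -/
noncomputable def resolventSum {n : ℕ} (m s : Fin n → ℝ) (T : H →L[ℂ] H) : H →L[ℂ] H :=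
  ∑ j, m j • (1 - s j • Ring.inverse (T + algebraMap ℝ (H →L[ℂ] H) (s j)))

variable {n : ℕ} {m s : Fin n → ℝ}

theorem resolventSum_mono (hm : ∀ j, 0 ≤ m j) (hs : ∀ j, 0 < s j) {S T : H →L[ℂ] H} (hS : 0 ≤ S)
    (hST : S ≤ T) : resolventSum m s S ≤ resolventSum m s T := by
  refine sum_le_sum fun j _ => smul_le_smul_of_nonneg_left (sub_le_sub_left
    (smul_le_smul_of_nonneg_left ?_ (hs j).le) _) (hm j)
  exact CStarAlgebra.ringInverse_le_ringInverse (add_le_add_left hST _)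
    (isStrictlyPositive_add_algebraMap hS (hs j))

theorem resolventSum_zero (hs : ∀ j, 0 < s j) : resolventSum m s (0 : H →L[ℂ] H) = 0 := by
  refine sum_eq_zero fun j _ => ?_
  have h := Ring.mul_inverse_cancel _
    (isStrictlyPositive_add_algebraMap (le_refl (0 : H →L[ℂ] H)) (hs j)).isUnit
  nth_rewrite 1 [zero_add] at h
  rw [← Algebra.smul_def] at h
  rw [h, sub_self, smul_zero]

theorem resolventSum_nonneg (hm : ∀ j, 0 ≤ m j) (hs : ∀ j, 0 < s j) {T : H →L[ℂ] H} (hT : 0 ≤ T) :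
    0 ≤ resolventSum m s T := by
  rw [← resolventSum_zero (H := H) (m := m) hs]
  exact resolventSum_mono hm hs le_rfl hT

theorem commute_resolventSum (hs : ∀ j, 0 < s j) {T : H →L[ℂ] H} (hT : 0 ≤ T) :
    Commute (resolventSum m s T) T := by
  refine Commute.sum_left _ _ _ fun j _ => Commute.smul_left (Commute.sub_left
    (Commute.one_left _) (Commute.smul_left ?_ _)) _
  have hu := (isStrictlyPositive_add_algebraMap hT (hs j)).isUnit
  have h : Commute (Ring.inverse (T + algebraMap ℝ (H →L[ℂ] H) (s j)))
      (T + algebraMap ℝ (H →L[ℂ] H) (s j)) :=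
    (Ring.inverse_mul_cancel _ hu).trans (Ring.mul_inverse_cancel _ hu).symm
  simpa using h.sub_right (Algebra.commute_algebraMap_right (s j) _)

theorem ringInverse_adjoint_comp_comp_le {V : H →L[ℂ] K} (hV : V.adjoint ∘L V = 1)
    {T : K →L[ℂ] K} (hT : IsStrictlyPositive T) (hVT : IsStrictlyPositive (V.adjoint ∘L T ∘L V)) :
    Ring.inverse (V.adjoint ∘L T ∘L V) ≤ V.adjoint ∘L Ring.inverse T ∘L V := by
  set R := Ring.inverse (V.adjoint ∘L T ∘L V) with hR
  have hN : 0 ≤ Ring.inverse T := hT.ringInverse.nonneg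
  have hNT : Ring.inverse T * T = 1 := Ring.inverse_mul_cancel _ hT.isUnit
  have hTN : T * Ring.inverse T = 1 := Ring.mul_inverse_cancel _ hT.isUnit
  have hRB : R ∘L (V.adjoint ∘L T ∘L V) = 1 := Ring.inverse_mul_cancel _ hVT.isUnit
  have hRadj : R.adjoint = R := hVT.ringInverse.nonneg.isSelfAdjoint
  have hTadj : T.adjoint = T := hT.nonneg.isSelfAdjoint
  have hNY : Ring.inverse T ∘L (T ∘L V ∘L R - V) = V ∘L R - Ring.inverse T ∘L V := by
    rw [ContinuousLinearMap.comp_sub]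
    congr 1
    calc Ring.inverse T ∘L T ∘L V ∘L R = (Ring.inverse T * T) ∘L V ∘L R := rfl
      _ = V ∘L R := by rw [hNT]; rfl
  have hY : (T ∘L V ∘L R - V).adjoint = R ∘L V.adjoint ∘L T - V.adjoint := by
    rw [map_sub, ContinuousLinearMap.adjoint_comp, ContinuousLinearMap.adjoint_comp, hRadj, hTadj]
    rfl
  have h := adjoint_comp_comp_nonneg hN (T ∘L V ∘L R - V)
  rw [hNY, hY, ContinuousLinearMap.sub_comp, ContinuousLinearMap.comp_sub,
    ContinuousLinearMap.comp_sub] at h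
  have h1 : (R ∘L V.adjoint ∘L T) ∘L V ∘L R = R := by
    calc (R ∘L V.adjoint ∘L T) ∘L V ∘L R = (R ∘L (V.adjoint ∘L T ∘L V)) ∘L R := rfl
      _ = R := by rw [hRB]; rfl
  have h2 : (R ∘L V.adjoint ∘L T) ∘L Ring.inverse T ∘L V = R := by
    calc (R ∘L V.adjoint ∘L T) ∘L Ring.inverse T ∘L V
        = R ∘L V.adjoint ∘L (T * Ring.inverse T) ∘L V := rfl
      _ = R ∘L (V.adjoint ∘L V) := by rw [hTN]; rfl
      _ = R := by rw [hV]; rfl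
  have h3 : V.adjoint ∘L V ∘L R = R := by
    rw [← ContinuousLinearMap.comp_assoc, hV]; rfl
  rw [h1, h2, h3, sub_self, zero_sub, neg_sub, sub_nonneg] at h
  exact h

theorem adjoint_comp_resolventSum_comp_le (hm : ∀ j, 0 ≤ m j) (hs : ∀ j, 0 < s j)
    {V : H →L[ℂ] K} (hV : V.adjoint ∘L V = 1) {T : K →L[ℂ] K} (hT : 0 ≤ T) :
    V.adjoint ∘L resolventSum m s T ∘L V ≤ resolventSum m s (V.adjoint ∘L T ∘L V) := by
  have hVv (v : H) : V.adjoint (V v) = v := by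
    rw [← ContinuousLinearMap.comp_apply, hV]; rfl
  have hsum : V.adjoint ∘L resolventSum m s T ∘L V = ∑ j, m j •
      (1 - s j • (V.adjoint ∘L Ring.inverse (T + algebraMap ℝ (K →L[ℂ] K) (s j)) ∘L V)) := by
    ext v
    simp [resolventSum, _root_.sum_apply, hVv]
  rw [hsum]
  refine sum_le_sum fun j _ => smul_le_smul_of_nonneg_left (sub_le_sub_left
    (smul_le_smul_of_nonneg_left ?_ (hs j).le) _) (hm j)
  have hadd : V.adjoint ∘L T ∘L V + algebraMap ℝ (H →L[ℂ] H) (s j) =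
      V.adjoint ∘L (T + algebraMap ℝ (K →L[ℂ] K) (s j)) ∘L V := by
    ext v
    simp [Algebra.algebraMap_eq_smul_one, hVv]
  have hpos := isStrictlyPositive_add_algebraMap (adjoint_comp_comp_nonneg hT V) (hs j)
  rw [hadd] at hpos ⊢
  exact ringInverse_adjoint_comp_comp_le hV (isStrictlyPositive_add_algebraMap hT (hs j)) hpos

theorem adjoint_comp_resolventSum (hs : ∀ j, 0 < s j) (X : H →L[ℂ] K) :
    X.adjoint ∘L resolventSum m s (X ∘L X.adjoint) =
      resolventSum m s (X.adjoint ∘L X) ∘L X.adjoint := by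
  have key (j : Fin n) :
      X.adjoint ∘L Ring.inverse (X ∘L X.adjoint + algebraMap ℝ (K →L[ℂ] K) (s j)) =
      Ring.inverse (X.adjoint ∘L X + algebraMap ℝ (H →L[ℂ] H) (s j)) ∘L X.adjoint := by
    set M := X ∘L X.adjoint + algebraMap ℝ (K →L[ℂ] K) (s j) with hM
    set N := X.adjoint ∘L X + algebraMap ℝ (H →L[ℂ] H) (s j) with hN
    have hMi : M * Ring.inverse M = 1 := Ring.mul_inverse_cancel _
      (isStrictlyPositive_add_algebraMap (comp_adjoint_nonneg X) (hs j)).isUnit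
    have hNi : Ring.inverse N * N = 1 := Ring.inverse_mul_cancel _
      (isStrictlyPositive_add_algebraMap (adjoint_comp_nonneg X) (hs j)).isUnit
    have hNM : N ∘L X.adjoint = X.adjoint ∘L M := by
      ext v
      simp [hM, hN, Algebra.algebraMap_eq_smul_one]
    calc X.adjoint ∘L Ring.inverse M
        = (Ring.inverse N * N) ∘L X.adjoint ∘L Ring.inverse M := by rw [hNi]; rfl
      _ = Ring.inverse N ∘L (N ∘L X.adjoint) ∘L Ring.inverse M := rfl
      _ = Ring.inverse N ∘L X.adjoint ∘L (M * Ring.inverse M) := by rw [hNM]; rfl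
      _ = Ring.inverse N ∘L X.adjoint := by rw [hMi]; rfl
  ext v
  simp only [resolventSum, ContinuousLinearMap.comp_apply, _root_.sum_apply, map_sum, smul_apply,
    sub_apply, one_apply_eq_self]
  refine sum_congr rfl fun j _ => ?_
  have := congrArg (fun Y => Y v) (key j)
  simp only [ContinuousLinearMap.comp_apply] at this
  simp [← this]

theorem sqrt_compression_mul_le (hm : ∀ j, 0 ≤ m j) (hs : ∀ j, 0 < s j)
    {V : H →L[ℂ] K} (hV : V.adjoint ∘L V = 1) {S q : K →L[ℂ] K} (hS : 0 ≤ S) (hq : 0 ≤ q)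
    (hqS : q * q = resolventSum m s (S * S)) :
    CFC.sqrt (star ((V.adjoint ∘L q ∘L V) * (V.adjoint ∘L (S * S) ∘L V)) *
      ((V.adjoint ∘L q ∘L V) * (V.adjoint ∘L (S * S) ∘L V))) ≤
      V.adjoint ∘L (S * q * S) ∘L V := by
  have hSadj : S.adjoint = S := hS.isSelfAdjoint
  have hqadj : q.adjoint = q := hq.isSelfAdjoint
  have hSS : 0 ≤ S * S := hS.isSelfAdjoint.mul_self_nonneg
  set B := V.adjoint ∘L (S * S) ∘L V with hB
  set F := V.adjoint ∘L q ∘L V with hF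
  have hB0 : 0 ≤ B := adjoint_comp_comp_nonneg hSS V
  have hF0 : 0 ≤ F := adjoint_comp_comp_nonneg hq V
  set X := S ∘L V with hX
  have hXX : X.adjoint ∘L X = B := by
    rw [hX, ContinuousLinearMap.adjoint_comp, hSadj]; rfl
  set Z := X ∘L X.adjoint with hZ
  have hZ0 : 0 ≤ Z := comp_adjoint_nonneg X
  have hZS : Z ≤ S * S := by
    have := adjoint_comp_comp_le (comp_adjoint_le_one hV) S
    rw [hSadj] at this
    rw [hZ, hX, ContinuousLinearMap.adjoint_comp, hSadj]
    exact this
  set Q := CFC.sqrt (resolventSum m s Z) with hQ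
  have hQ0 : 0 ≤ Q := CFC.sqrt_nonneg _
  have hQQ : Q * Q = resolventSum m s Z := CFC.sqrt_mul_sqrt_self _ (resolventSum_nonneg hm hs hZ0)
  have hQq : Q ≤ q := by
    rw [← CFC.sqrt_unique hqS hq]
    exact CFC.sqrt_le_sqrt _ _ (resolventSum_mono hm hs hZ0 hZS)
  have hQZ : Commute Q Z := (commute_resolventSum hs hZ0).cfcₙ_nnreal _
  have hFF : F * F ≤ resolventSum m s B := by
    refine le_trans ?_ (adjoint_comp_resolventSum_comp_le hm hs hV hSS)
    rw [← hqS]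
    have := adjoint_comp_comp_le (comp_adjoint_le_one hV) (q ∘L V)
    rw [ContinuousLinearMap.adjoint_comp, hqadj] at this
    exact this
  have hsq : (X.adjoint ∘L Q ∘L X) * (X.adjoint ∘L Q ∘L X) = star B * resolventSum m s B * B := by
    calc (X.adjoint ∘L Q ∘L X) * (X.adjoint ∘L Q ∘L X) = X.adjoint ∘L (Q * Z * Q) ∘L X := rfl
      _ = X.adjoint ∘L (Z * (Q * Q)) ∘L X := by rw [hQZ.eq, mul_assoc]
      _ = (X.adjoint ∘L X) ∘L (X.adjoint ∘L resolventSum m s (X ∘L X.adjoint)) ∘L X := by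
        rw [hQQ]; rfl
      _ = (X.adjoint ∘L X) ∘L resolventSum m s (X.adjoint ∘L X) ∘L (X.adjoint ∘L X) := by
        rw [adjoint_comp_resolventSum hs]; rfl
      _ = star B * resolventSum m s B * B := by
        rw [hXX, hB0.isSelfAdjoint.star_eq]; rfl
  calc CFC.sqrt (star (F * B) * (F * B))
      ≤ CFC.sqrt (star B * resolventSum m s B * B) := by
        refine CFC.sqrt_le_sqrt _ _ ?_
        have : star (F * B) * (F * B) = star B * (F * F) * B := by
          rw [star_mul, hF0.isSelfAdjoint.star_eq]; simp only [mul_assoc]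
        rw [this]
        exact star_left_conjugate_le_conjugate hFF B
    _ = X.adjoint ∘L Q ∘L X := CFC.sqrt_unique hsq (adjoint_comp_comp_nonneg hQ0 X)
    _ ≤ X.adjoint ∘L q ∘L X := adjoint_comp_comp_le hQq X
    _ = V.adjoint ∘L (S * q * S) ∘L V := by
      rw [hX, ContinuousLinearMap.adjoint_comp, hSadj]; rfl

end Compression

set_option synthInstance.maxHeartbeats 200000 in
theorem resolventSum_piLpDiag {ι : Type*} [Fintype ι] {n : ℕ} {m s : Fin n → ℝ}
    (hs : ∀ j, 0 < s j) {a : ι → ℝ} (ha : ∀ i, 0 < a i) :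
    resolventSum m s (piLpDiag H a) = piLpDiag H fun i => ∑ j, m j * (a i / (a i + s j)) := by
  have key (j : Fin n) : Ring.inverse (piLpDiag H a + algebraMap ℝ _ (s j)) =
      piLpDiag H fun i => (a i + s j)⁻¹ := by
    have hu := (isStrictlyPositive_add_algebraMap (piLpDiag_nonneg (H := H) fun i => (ha i).le)
      (hs j)).isUnit
    refine left_inv_eq_right_inv (Ring.inverse_mul_cancel _ hu) ?_
    rw [← AlgHomClass.commutes (piLpDiag H), ← map_add, ← map_mul, ← map_one (piLpDiag H)]
    congr 1
    ext i
    have : a i + s j ≠ 0 := (add_pos (ha i) (hs j)).ne'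
    simp [this]
  simp only [resolventSum, key]
  rw [← map_one (piLpDiag H)]
  simp only [← map_smul, ← map_sub, ← map_sum]
  congr 1
  ext i
  simp only [Finset.sum_apply, Pi.smul_apply, Pi.sub_apply, Pi.one_apply, smul_eq_mul]
  refine sum_congr rfl fun j _ => ?_
  have : a i + s j ≠ 0 := (add_pos (ha i) (hs j)).ne'
  field_simp
  ring

theorem sqrt_sum_mul_sum_le {ι : Type*} [Fintype ι] {E : ι → H →L[ℂ] H} (hE : ∀ i, 0 ≤ E i)
    (hE1 : ∑ i, E i = 1) {n : ℕ} {m s : Fin n → ℝ} (hm : ∀ j, 0 ≤ m j) (hs : ∀ j, 0 < s j)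
    {a q : ι → ℝ} (ha : ∀ i, 0 < a i) (hq : ∀ i, 0 ≤ q i)
    (hqa : ∀ i, q i * q i = ∑ j, m j * (a i / (a i + s j))) :
    CFC.sqrt (star ((∑ i, q i • E i) * ∑ i, a i • E i) * ((∑ i, q i • E i) * ∑ i, a i • E i)) ≤
      ∑ i, (a i * q i) • E i := by
  obtain ⟨V, hV⟩ := exists_adjoint_comp_piLpDiag_comp hE
  have hV1 : V.adjoint ∘L V = 1 := by
    have := hV 1
    rw [map_one] at this
    refine this.trans ?_
    simp [hE1]
  have hSS : piLpDiag H (fun i => √(a i)) * piLpDiag H (fun i => √(a i)) = piLpDiag H a := by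
    rw [← map_mul]
    congr 1
    ext i
    exact Real.mul_self_sqrt (ha i).le
  have hSqS : piLpDiag H (fun i => √(a i)) * piLpDiag H q * piLpDiag H (fun i => √(a i)) =
      piLpDiag H fun i => a i * q i := by
    rw [← map_mul, ← map_mul]
    congr 1
    ext i
    simp only [Pi.mul_apply]
    rw [mul_right_comm, Real.mul_self_sqrt (ha i).le]
  have hqq : piLpDiag H q * piLpDiag H q =
      resolventSum m s (piLpDiag H (fun i => √(a i)) * piLpDiag H (fun i => √(a i))) := by
    rw [hSS, resolventSum_piLpDiag hs ha, ← map_mul]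
    congr 1
    ext i
    exact hqa i
  have h := sqrt_compression_mul_le hm hs hV1
    (piLpDiag_nonneg (H := H) fun i => Real.sqrt_nonneg (a i)) (piLpDiag_nonneg hq) hqq
  rwa [hSS, hSqS, hV, hV, hV] at h

theorem exists_orthonormal_of_injective_mem_spectrum {ι : Type*} [Fintype ι] {A : H →L[ℂ] H}
    (hA : IsSelfAdjoint A) {a : ι → ℝ} (ha : Function.Injective a)
    (hmem : ∀ i, a i ∈ spectrum ℝ A) : ∃ e : ι → H, Orthonormal ℂ e := by
  classical
  let g (i : ι) (t : ℝ) : ℝ := ∏ j ∈ univ.erase i, max 0 (|t - a j| - |t - a i|)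
  have hg (i : ι) : Continuous (g i) := by fun_prop
  have hgne (i : ι) : g i (a i) ≠ 0 := by
    refine prod_ne_zero_iff.2 fun j hj => ?_
    have : 0 < |a i - a j| := abs_pos.2 (sub_ne_zero.2 (ha.ne (mem_erase.1 hj).1.symm))
    simp [this.ne']
  have hgmul {i j : ι} (hij : i ≠ j) (t : ℝ) : g i t * g j t = 0 := by
    rcases le_total |t - a j| |t - a i| with h | h
    · rw [show g i t = 0 from prod_eq_zero (mem_erase.2 ⟨hij.symm, mem_univ j⟩)
        (max_eq_left (sub_nonpos.2 h)), zero_mul]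
    · rw [show g j t = 0 from prod_eq_zero (mem_erase.2 ⟨hij, mem_univ i⟩)
        (max_eq_left (sub_nonpos.2 h)), mul_zero]
  have hne (i : ι) : ∃ v, cfc (g i) A v ≠ 0 := by
    by_contra! h
    have h0 : cfc (g i) A = 0 := ContinuousLinearMap.ext h
    have := norm_apply_le_norm_cfc (g i) A (hmem i) (hg i).continuousOn hA
    rw [h0, norm_zero] at this
    exact hgne i (norm_le_zero_iff.1 this)
  choose v hv using hne
  refine ⟨fun i => ((‖cfc (g i) A (v i)‖ : ℂ)⁻¹) • cfc (g i) A (v i), ?_, fun i j hij => ?_⟩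
  · intro i
    simp [norm_smul, hv i]
  · have h0 : star (cfc (g i) A) * cfc (g j) A = 0 := by
      rw [(cfc_predicate (g i) A : IsSelfAdjoint _).star_eq,
        ← cfc_mul (g i) (g j) A (hg i).continuousOn (hg j).continuousOn]
      simp [hgmul hij]
    change inner ℂ (_ • cfc (g i) A (v i)) (_ • cfc (g j) A (v j)) = 0
    rw [inner_smul_left, inner_smul_right, ← ContinuousLinearMap.adjoint_inner_right,
      ← ContinuousLinearMap.star_eq_adjoint, ← mul_apply_eq_comp, h0]
    simp

theorem exists_partition_of_compact {s : Set ℝ} (hs : IsCompact s) {δ : ℝ} (hδ : 0 < δ) :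
    ∃ (k : ℕ) (a : Fin k → ℝ) (φ : Fin k → ℝ → ℝ), StrictMono a ∧ (∀ i, a i ∈ s) ∧
      (∀ i, ContinuousOn (φ i) s) ∧ (∀ i, ∀ t ∈ s, 0 ≤ φ i t) ∧ (∀ t ∈ s, ∑ i, φ i t = 1) ∧
      ∀ i, ∀ t ∈ s, φ i t ≠ 0 → |a i - t| < δ := by
  obtain ⟨u, hus, hu, hcov⟩ := hs.finite_cover_balls hδ
  lift u to Finset ℝ using hu
  let a := u.orderEmbOfFin rfl
  let ψ (i : Fin #u) (t : ℝ) : ℝ := max 0 (δ - |a i - t|)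
  have hψ (i : Fin #u) : Continuous (ψ i) := by fun_prop
  have hψ0 (i : Fin #u) (t : ℝ) : 0 ≤ ψ i t := le_max_left _ _
  have hpos : ∀ t ∈ s, 0 < ∑ i, ψ i t := by
    intro t ht
    obtain ⟨x, hx, htx⟩ := Set.mem_iUnion₂.1 (hcov ht)
    have : x ∈ Set.range a := by rw [range_orderEmbOfFin]; exact hx
    obtain ⟨i, rfl⟩ := this
    refine sum_pos' (fun i _ => hψ0 i t) ⟨i, mem_univ i, lt_max_of_lt_right (sub_pos.2 ?_)⟩
    rwa [Metric.mem_ball, dist_comm] at htx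
  refine ⟨#u, a, fun i t => ψ i t / ∑ j, ψ j t, a.strictMono,
    fun i => hus (orderEmbOfFin_mem u rfl i), fun i => ?_, fun i t ht => ?_, fun t ht => ?_,
    fun i t ht h => ?_⟩
  · exact (hψ i).continuousOn.div (continuous_finsetSum _ fun j _ => hψ j).continuousOn
      fun t ht => (hpos t ht).ne'
  · exact div_nonneg (hψ0 i t) (hpos t ht).le
  · rw [← sum_div, div_self (hpos t ht).ne']
  · by_contra! h'
    exact h (by simp only [ψ, max_eq_left (sub_nonpos.2 h'), zero_div])

theorem norm_sum_smul_sub_cfc_le {ι : Type*} [Fintype ι] {A : H →L[ℂ] H}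
    {φ : ι → ℝ → ℝ} (hφ : ∀ i, ContinuousOn (φ i) (spectrum ℝ A))
    (hφ0 : ∀ i, ∀ t ∈ spectrum ℝ A, 0 ≤ φ i t) (hφ1 : ∀ t ∈ spectrum ℝ A, ∑ i, φ i t = 1)
    {g : ℝ → ℝ} (hg : ContinuousOn g (spectrum ℝ A)) {c : ι → ℝ} {η : ℝ} (hη : 0 ≤ η)
    (h : ∀ i, ∀ t ∈ spectrum ℝ A, φ i t ≠ 0 → |c i - g t| ≤ η) :
    ‖∑ i, c i • cfc (φ i) A - cfc g A‖ ≤ η := by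
  have : ∑ i, c i • cfc (φ i) A - cfc g A = cfc (fun t => ∑ i, c i * φ i t - g t) A := by
    rw [cfc_sub (fun t => ∑ i, c i * φ i t) g A
      (continuousOn_finsetSum _ fun i _ => continuousOn_const.mul (hφ i)) hg]
    congr 1
    rw [← sum_fn, cfc_sum_univ (fun i t => c i * φ i t) _ fun i => continuousOn_const.mul (hφ i)]
    exact sum_congr rfl fun i _ => (cfc_const_mul (c i) (φ i) A (hφ i)).symm
  rw [this]
  refine norm_cfc_le hη fun t ht => ?_
  calc ‖∑ i, c i * φ i t - g t‖ = ‖∑ i, (c i - g t) * φ i t‖ := by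
        simp only [sub_mul, sum_sub_distrib, ← mul_sum, hφ1 t ht, mul_one]
    _ ≤ ∑ i, ‖(c i - g t) * φ i t‖ := norm_sum_le _ _
    _ ≤ ∑ i, η * φ i t := by
        refine sum_le_sum fun i _ => ?_
        rw [norm_mul, Real.norm_of_nonneg (hφ0 i t ht)]
        rcases eq_or_ne (φ i t) 0 with h0 | h0
        · simp [h0]
        · exact mul_le_mul_of_nonneg_right (h i t ht h0) (hφ0 i t ht)
    _ = η := by rw [← mul_sum, hφ1 t ht, mul_one]

theorem abs_sub_le_of_abs_sq_sub_sq_le {x y η : ℝ} (hx : 0 ≤ x) (hy : 0 ≤ y) (hη : 0 ≤ η)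
    (h : |x * x - y ^ 2| ≤ η ^ 2) : |x - y| ≤ η := by
  refine abs_le_of_sq_le_sq ?_ hη
  obtain ⟨h1, h2⟩ := abs_le.1 h
  rcases le_total x y with hxy | hxy <;> nlinarith

theorem exists_pos_forall_abs_sub_le_of_compact {s : Set ℝ} (hs : IsCompact s) {g : ℝ → ℝ}
    (hg : ContinuousOn g s) {η : ℝ} (hη : 0 < η) :
    ∃ δ > 0, ∀ x ∈ s, ∀ y ∈ s, |x - y| < δ → |g x - g y| ≤ η := by
  obtain ⟨δ, hδ, h⟩ :=
    Metric.uniformContinuousOn_iff.1 (hs.uniformContinuousOn_of_continuous hg) η hη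
  exact ⟨δ, hδ, fun x hx y hy hxy => (h x hx y hy hxy).le⟩

end Operators

/-- **Corollary 2.6 (2.11).** If `f : (0,∞) → (0,∞)` is continuous and `f²` is operator concave,
then `|Φ(f(A)) Φ(A)| ≤ Φ(A f(A))` for every unital positive linear map `Φ` and every positive
invertible operator `A`. -/
theorem abs_le_choi_davis
    (Φ : (H →L[ℂ] H) →ₗ[ℂ] (H →L[ℂ] H)) (hΦ : IsUnitalPositiveMap Φ)
    (f : ℝ → ℝ)
    (hfc : ContinuousOn f (Set.Ioi 0))
    (hfpos : ∀ t ∈ Set.Ioi (0 : ℝ), 0 < f t)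
    (hf2 : IsOperatorConcaveOn H (fun t => f t ^ 2))
    (A : H →L[ℂ] H) (hA : 0 ≤ A) (hAu : IsUnit A) :
    opAbs (Φ (cfc f A) * Φ A) ≤ Φ (A * cfc f A) := by
  have hAsa : IsSelfAdjoint A := hA.isSelfAdjoint
  have hcpt : IsCompact (spectrum ℝ A) := spectrum.isCompact A
  have hσ : spectrum ℝ A ⊆ Set.Ioi 0 := fun t ht =>
    (IsStrictlyPositive.iff_of_unital.2 ⟨hA, hAu⟩).spectrum_pos ht
  have hfσ : ContinuousOn f (spectrum ℝ A) := hfc.mono hσ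
  have hgσ : ContinuousOn (fun t => t * f t) (spectrum ℝ A) := continuousOn_id.mul hfσ
  have hAid : cfc (fun t : ℝ => t) A = A := cfc_id' ℝ A
  have hAf : cfc (fun t => t * f t) A = A * cfc f A := by
    rw [cfc_mul (fun t => t) f A continuousOn_id hfσ, hAid]
  obtain ⟨L, hL⟩ := (PositiveLinearMap.mk₀ Φ hΦ.2).exists_norm_apply_le
  replace hL (X : H →L[ℂ] H) : ‖Φ X‖ ≤ L * ‖X‖ := hL X
  have hclosed : IsClosed {x : (H →L[ℂ] H) × (H →L[ℂ] H) × (H →L[ℂ] H) |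
      CFC.abs (x.1 * x.2.1) ≤ x.2.2} :=
    isClosed_le (CFC.continuous_abs.comp (by fun_prop)) (by fun_prop)
  suffices h : (Φ (cfc f A), Φ A, Φ (A * cfc f A)) ∈ closure
      {x : (H →L[ℂ] H) × (H →L[ℂ] H) × (H →L[ℂ] H) | CFC.abs (x.1 * x.2.1) ≤ x.2.2} by
    rw [hclosed.closure_eq] at h
    exact h
  refine Metric.mem_closure_iff.2 fun ε hε => ?_
  obtain ⟨η, hη, hηε⟩ : ∃ η > 0, L * ((‖A‖ + 2) * η) < ε := by
    refine ⟨ε / ((L + 1) * (‖A‖ + 2)), by positivity, ?_⟩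
    have h2 : 0 < ‖A‖ + 2 := by positivity
    have h1 : (0 : ℝ) < L + 1 := by positivity
    calc L * ((‖A‖ + 2) * (ε / ((L + 1) * (‖A‖ + 2)))) = L / (L + 1) * ε := by field_simp
      _ < 1 * ε := mul_lt_mul_of_pos_right ((div_lt_one h1).2 (lt_add_one _)) hε
      _ = ε := one_mul ε
  obtain ⟨δ₁, hδ₁, hf1⟩ := exists_pos_forall_abs_sub_le_of_compact hcpt hfσ hη
  obtain ⟨δ₂, hδ₂, hf2'⟩ := exists_pos_forall_abs_sub_le_of_compact hcpt hgσ hη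
  obtain ⟨k, a, φ, ha, hamem, hφ, hφ0, hφ1, hφδ⟩ :=
    exists_partition_of_compact hcpt (lt_min hη (lt_min hδ₁ hδ₂))
  obtain ⟨e, he⟩ := exists_orthonormal_of_injective_mem_spectrum hAsa ha.injective hamem
  have hapos (i : Fin k) : 0 < a i := hσ (hamem i)
  have hanorm (i : Fin k) : |a i| ≤ ‖A‖ := by
    simpa [hAid] using norm_apply_le_norm_cfc (fun t : ℝ => t) A (hamem i) continuousOn_id
  have hmono := contractionMonotone_of_isOperatorConcaveOn he hapos (hfc.pow 2)
    (fun t ht => pow_pos (hfpos t ht) 2) hf2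
  obtain ⟨n, m, s, hm, hs, hms⟩ := hmono.exists_sum_div_near ha hapos (pow_pos hη 2)
  let q (i : Fin k) : ℝ := √(∑ j, m j * (a i / (a i + s j)))
  have hqq (i : Fin k) : q i * q i = ∑ j, m j * (a i / (a i + s j)) :=
    Real.mul_self_sqrt (Finset.sum_nonneg fun j _ =>
      mul_nonneg (hm j) (div_nonneg (hapos i).le (add_pos (hapos i) (hs j)).le))
  have hq0 (i : Fin k) : 0 ≤ q i := Real.sqrt_nonneg _
  have hqf (i : Fin k) : |q i - f (a i)| ≤ η :=
    abs_sub_le_of_abs_sq_sub_sq_le (hq0 i) (hfpos _ (hapos i)).le hη.le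
      (by rw [hqq]; exact (hms i).le)
  have hE (i : Fin k) : 0 ≤ Φ (cfc (φ i) A) := hΦ.2 _ (cfc_nonneg fun t ht => hφ0 i t ht)
  have hE1 : ∑ i, Φ (cfc (φ i) A) = 1 := by
    have h : (spectrum ℝ A).EqOn (∑ i, φ i) fun _ => 1 := fun t ht => by simpa using hφ1 t ht
    rw [← map_sum, ← cfc_sum_univ _ _ hφ, cfc_congr h, cfc_const_one ℝ A, hΦ.1]
  have hnear {g : ℝ → ℝ} (hg : ContinuousOn g (spectrum ℝ A)) {c : Fin k → ℝ}
      (h : ∀ i, ∀ t ∈ spectrum ℝ A, φ i t ≠ 0 → |c i - g t| ≤ (‖A‖ + 2) * η) :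
      dist (Φ (cfc g A)) (∑ i, c i • Φ (cfc (φ i) A)) < ε := by
    have hsum : ∑ i, c i • Φ (cfc (φ i) A) = Φ (∑ i, c i • cfc (φ i) A) := by
      rw [map_sum]
      exact Finset.sum_congr rfl fun i _ => by
        rw [← Complex.coe_smul, ← Complex.coe_smul, map_smul]
    rw [dist_comm, dist_eq_norm, hsum, ← map_sub]
    refine ((hL _).trans (mul_le_mul_of_nonneg_left ?_ L.2)).trans_lt hηε
    exact norm_sum_smul_sub_cfc_le hφ hφ0 hφ1 hg (by positivity) h
  have hAnn : 0 ≤ ‖A‖ * η := by positivity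
  refine ⟨(∑ i, q i • Φ (cfc (φ i) A), ∑ i, a i • Φ (cfc (φ i) A),
    ∑ i, (a i * q i) • Φ (cfc (φ i) A)), sqrt_sum_mul_sum_le hE hE1 hm hs hapos hq0 hqq, ?_⟩
  refine max_lt (hnear hfσ fun i t ht h => ?_) (max_lt ?_ ?_)
  · have h1 := hf1 _ (hamem i) t ht
      ((hφδ i t ht h).trans_le ((min_le_right _ _).trans (min_le_left _ _)))
    have := abs_sub_le (q i) (f (a i)) (f t)
    linarith [hqf i]
  · have := hnear (g := fun t => t) (c := a) continuousOn_id fun i t ht h => by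
      have := (hφδ i t ht h).trans_le (min_le_left _ _)
      linarith
    rwa [hAid] at this
  · rw [← hAf]
    refine hnear hgσ fun i t ht h => ?_
    have h1 := hf2' _ (hamem i) t ht
      ((hφδ i t ht h).trans_le ((min_le_right _ _).trans (min_le_right _ _)))
    have h2 := abs_sub_le (a i * q i) (a i * f (a i)) (t * f t)
    have h3 : |a i * q i - a i * f (a i)| ≤ ‖A‖ * η := by
      rw [← mul_sub, abs_mul]
      exact mul_le_mul (hanorm i) (hqf i) (abs_nonneg _) (norm_nonneg _)
    linarith
end

section
/- Let Φ be a unital positive linear map on B(H) and let f : (0,∞) → (0,∞) be a continuous function such that f² is operator concave. Then for every positive invertible operator A ∈ B(H), |Φ(f(A))^{-1} Φ(A)| ≥ Φ(A f(A)^{-1}). -/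
open scoped NNReal

variable {H : Type*} [NormedAddCommGroup H] [InnerProductSpace ℂ H] [CompleteSpace H]

section PositiveFamily

variable {𝒜 : Type*} [CStarAlgebra 𝒜] [PartialOrder 𝒜] [StarOrderedRing 𝒜]

lemma isSelfAdjoint_ringInverse {R : Type*} [Semiring R] [StarRing R] {a : R}
    (ha : IsSelfAdjoint a) : IsSelfAdjoint (Ring.inverse a) := by
  rw [IsSelfAdjoint, ← Ring.inverse_star, ha.star_eq]

lemma commute_ringInverse {R : Type*} [MonoidWithZero R] {a b : R} (h : Commute a b)
    (hb : IsUnit b) : Commute a (Ring.inverse b) := by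
  obtain ⟨u, rfl⟩ := hb
  rw [Ring.inverse_unit]
  exact h.units_inv_right

lemma IsStrictlyPositive.sum_smul {ι : Type*} {s : Finset ι} {P : ι → 𝒜}
    (hP : ∀ i ∈ s, 0 ≤ P i) (hP1 : ∑ i ∈ s, P i = 1) {d : ι → ℝ} (hd : ∀ i ∈ s, 0 < d i) :
    IsStrictlyPositive (∑ i ∈ s, d i • P i) := by
  rcases s.eq_empty_or_nonempty with rfl | hs
  · have : Subsingleton 𝒜 := by
      rw [← subsingleton_iff_zero_eq_one]; simpa using hP1
    exact .of_subsingleton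
  · obtain ⟨i₀, hi₀, hmin⟩ := s.exists_min_image d hs
    have h1 : d i₀ • (1 : 𝒜) ≤ ∑ i ∈ s, d i • P i := by
      rw [← hP1, Finset.smul_sum]
      exact Finset.sum_le_sum fun i hi => smul_le_smul_of_nonneg_right (hmin i hi) (hP i hi)
    refine IsStrictlyPositive.of_le ?_ h1
    exact IsStrictlyPositive.smul (hd i₀ hi₀) isStrictlyPositive_one

/-- The Cauchy–Schwarz inequality for a finite family of positive elements. -/
lemma sum_smul_mul_inverse_mul_le {ι : Type*} {s : Finset ι} {P : ι → 𝒜}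
    (hP : ∀ i ∈ s, 0 ≤ P i) {d : ι → ℝ} (hd : ∀ i ∈ s, 0 < d i) (b : ι → ℝ)
    (hD : IsStrictlyPositive (∑ i ∈ s, d i • P i)) :
    (∑ i ∈ s, b i • P i) * Ring.inverse (∑ i ∈ s, d i • P i) * (∑ i ∈ s, b i • P i)
      ≤ ∑ i ∈ s, (b i ^ 2 / d i) • P i := by
  set B := ∑ i ∈ s, b i • P i with hB
  set D := ∑ i ∈ s, d i • P i with hDdef
  have hBsa : IsSelfAdjoint B := by
    refine isSelfAdjoint_sum _ fun i hi => ?_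
    exact (IsSelfAdjoint.all (b i)).smul (IsSelfAdjoint.of_nonneg (hP i hi))
  have hIsa := isSelfAdjoint_ringInverse (IsSelfAdjoint.of_nonneg hD.nonneg)
  have hDI : D * Ring.inverse D = 1 := Ring.mul_inverse_cancel _ hD.isUnit
  set X := Ring.inverse D * B with hX
  have hXs : star X = B * Ring.inverse D := by
    rw [hX, star_mul, hBsa.star_eq, hIsa.star_eq]
  have key : 0 ≤ ∑ i ∈ s, (d i)⁻¹ • (star (b i • (1 : 𝒜) - d i • X) * P i *
      (b i • (1 : 𝒜) - d i • X)) :=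
    Finset.sum_nonneg fun i hi => smul_nonneg (inv_nonneg.2 (hd i hi).le)
      (star_left_conjugate_nonneg (hP i hi) _)
  have hexp : ∑ i ∈ s, (d i)⁻¹ • (star (b i • (1 : 𝒜) - d i • X) * P i *
      (b i • (1 : 𝒜) - d i • X)) =
      ∑ i ∈ s, (b i ^ 2 / d i) • P i - star X * B - B * X + star X * D * X := by
    rw [hB, hDdef, Finset.mul_sum, Finset.sum_mul, Finset.mul_sum, Finset.sum_mul,
      ← Finset.sum_sub_distrib, ← Finset.sum_sub_distrib, ← Finset.sum_add_distrib]
    refine Finset.sum_congr rfl fun i hi => ?_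
    have hdi := (hd i hi).ne'
    simp only [star_sub, star_smul, star_one, star_trivial, sub_mul, mul_sub, smul_mul_assoc,
      mul_smul_comm, one_mul, mul_one, smul_sub, smul_smul]
    rw [inv_mul_cancel_left₀ hdi, inv_mul_cancel_left₀ hdi,
      show (d i)⁻¹ * (b i * b i) = b i ^ 2 / d i by field_simp,
      show (d i)⁻¹ * (b i * d i) = b i by field_simp]
    abel
  rw [hexp] at key
  have h2 : star X * D * X = B * Ring.inverse D * B := by
    rw [hXs, hX, mul_assoc B, Ring.inverse_mul_cancel _ hD.isUnit, mul_one, ← mul_assoc]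
  rw [h2, hXs, hX, ← mul_assoc] at key
  simpa using key

/-- Jensen's inequality for the parallel sum of affine functions. -/
lemma sum_inv_smul_le_inverse {ι κ : Type*} {s : Finset ι} {J : Finset κ} {P : ι → 𝒜}
    (hP : ∀ i ∈ s, 0 ≤ P i) {d : κ → ι → ℝ} (hd : ∀ j ∈ J, ∀ i ∈ s, 0 < d j i)
    {c : κ → ℝ} (hc : ∀ j ∈ J, 0 ≤ c j) {e : ι → ℝ} (he : ∀ i ∈ s, e i = ∑ j ∈ J, c j / d j i)
    (he0 : ∀ i ∈ s, 0 < e i)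
    (hD : ∀ j ∈ J, IsStrictlyPositive (∑ i ∈ s, d j i • P i))
    (hE : IsStrictlyPositive (∑ j ∈ J, c j • Ring.inverse (∑ i ∈ s, d j i • P i))) :
    ∑ i ∈ s, (e i)⁻¹ • P i ≤
      Ring.inverse (∑ j ∈ J, c j • Ring.inverse (∑ i ∈ s, d j i • P i)) := by
  set D : κ → 𝒜 := fun j => ∑ i ∈ s, d j i • P i with hDdef
  replace hD : ∀ j ∈ J, IsStrictlyPositive (D j) := hD
  set E := ∑ j ∈ J, c j • Ring.inverse (D j) with hEdef
  set W : κ → 𝒜 := fun j => Ring.inverse (D j) * Ring.inverse E with hW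
  have hEsa := isSelfAdjoint_ringInverse (IsSelfAdjoint.of_nonneg hE.nonneg)
  have hW1 : ∑ j ∈ J, c j • W j = 1 := by
    simp only [hW, ← smul_mul_assoc]
    rw [← Finset.sum_mul, ← hEdef, Ring.mul_inverse_cancel _ hE.isUnit]
  have hW2 : ∑ j ∈ J, c j • star (W j) = 1 := by
    have := congrArg star hW1
    simpa [star_sum] using this
  have hEinv : Ring.inverse E = ∑ j ∈ J, c j • (star (W j) * D j * W j) := by
    have : ∀ j ∈ J, c j • (star (W j) * D j * W j) =
        Ring.inverse E * (c j • Ring.inverse (D j)) * Ring.inverse E := by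
      intro j hj
      have hsa := isSelfAdjoint_ringInverse (IsSelfAdjoint.of_nonneg (hD j hj).nonneg)
      rw [hW]
      simp only [star_mul, hsa.star_eq, hEsa.star_eq, mul_smul_comm, smul_mul_assoc]
      congr 1
      rw [mul_assoc (Ring.inverse E), Ring.inverse_mul_cancel _ (hD j hj).isUnit, mul_one,
        ← mul_assoc]
    rw [Finset.sum_congr rfl this, ← Finset.sum_mul, ← Finset.mul_sum, ← hEdef,
      Ring.inverse_mul_cancel _ hE.isUnit, one_mul]
  have hexp : Ring.inverse E = ∑ i ∈ s, ∑ j ∈ J, (c j * d j i) • (star (W j) * P i * W j) := by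
    rw [hEinv, Finset.sum_comm]
    refine Finset.sum_congr rfl fun j hj => ?_
    simp only [hDdef, Finset.mul_sum, Finset.sum_mul, Finset.smul_sum, mul_smul_comm,
      smul_mul_assoc, smul_smul]
  rw [hexp]
  refine Finset.sum_le_sum fun i hi => ?_
  rw [← sub_nonneg]
  have key : 0 ≤ ∑ j ∈ J, (c j * d j i) • (star (W j - (d j i * e i)⁻¹ • (1 : 𝒜)) * P i *
      (W j - (d j i * e i)⁻¹ • (1 : 𝒜))) :=
    Finset.sum_nonneg fun j hj => smul_nonneg (mul_nonneg (hc j hj) (hd j hj i hi).le)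
      (star_left_conjugate_nonneg (hP i hi) _)
  refine key.trans_eq ?_
  have hterm : ∀ j ∈ J, (c j * d j i) • (star (W j - (d j i * e i)⁻¹ • (1 : 𝒜)) * P i *
      (W j - (d j i * e i)⁻¹ • (1 : 𝒜))) =
      (c j * d j i) • (star (W j) * P i * W j) - (e i)⁻¹ • (c j • star (W j) * P i)
        - (e i)⁻¹ • (P i * c j • W j) + (c j / d j i) • ((e i)⁻¹ ^ 2 • P i) := by
    intro j hj
    have hdi := (hd j hj i hi).ne'
    have hei := (he0 i hi).ne'
    simp only [star_sub, star_smul, star_one, star_trivial, sub_mul, mul_sub, smul_mul_assoc,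
      mul_smul_comm, one_mul, mul_one, smul_sub, smul_smul]
    rw [show c j * d j i * (d j i * e i)⁻¹ = (e i)⁻¹ * c j by field_simp,
      show c j * d j i * ((d j i * e i)⁻¹ * (d j i * e i)⁻¹) = c j / d j i * (e i)⁻¹ ^ 2 by
        field_simp]
    abel
  rw [Finset.sum_congr rfl hterm, Finset.sum_add_distrib, Finset.sum_sub_distrib,
    Finset.sum_sub_distrib, ← Finset.smul_sum, ← Finset.smul_sum, ← Finset.sum_mul,
    ← Finset.mul_sum, ← Finset.sum_smul, hW1, hW2, ← he i hi, smul_smul,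
    show e i * (e i)⁻¹ ^ 2 = (e i)⁻¹ by have := (he0 i hi).ne'; field_simp]
  simp

/-- Jensen's inequality for `t ↦ t / ((1 - σ) t + σ)`. -/
lemma sum_div_smul_le_mul_inverse {ι : Type*} {s : Finset ι} {P : ι → 𝒜}
    (hP : ∀ i ∈ s, 0 ≤ P i) (hP1 : ∑ i ∈ s, P i = 1) {a d : ι → ℝ} (hd0 : ∀ i ∈ s, 0 < d i)
    {σ : ℝ} (hσ : σ ∈ Set.Icc (0 : ℝ) 1) (hd : ∀ i ∈ s, d i = (1 - σ) * a i + σ) :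
    ∑ i ∈ s, (a i / d i) • P i ≤
      (∑ i ∈ s, a i • P i) * Ring.inverse (∑ i ∈ s, d i • P i) := by
  have hDpos := IsStrictlyPositive.sum_smul hP hP1 hd0
  have h1 := sum_smul_mul_inverse_mul_le hP hd0 a hDpos
  have h2 := sum_smul_mul_inverse_mul_le hP hd0 (fun _ => 1) hDpos
  set T := ∑ i ∈ s, a i • P i with hT
  set D := ∑ i ∈ s, d i • P i with hDdef
  have hD : D = (1 - σ) • T + σ • (1 : 𝒜) := by
    rw [hDdef, hT, ← hP1, Finset.smul_sum, Finset.smul_sum, ← Finset.sum_add_distrib]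
    exact Finset.sum_congr rfl fun i hi => by rw [hd i hi, add_smul, mul_smul]
  simp only [one_smul, hP1, one_mul, mul_one] at h2
  have hDI : D * Ring.inverse D = 1 := Ring.mul_inverse_cancel _ hDpos.isUnit
  have hID : Ring.inverse D * D = 1 := Ring.inverse_mul_cancel _ hDpos.isUnit
  have hlhs : ∑ i ∈ s, (a i / d i) • P i = T + 1 - (1 - σ) • ∑ i ∈ s, (a i ^ 2 / d i) • P i
      - σ • ∑ i ∈ s, (1 ^ 2 / d i) • P i := by
    rw [hT, ← hP1, Finset.smul_sum, Finset.smul_sum, ← Finset.sum_add_distrib,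
      ← Finset.sum_sub_distrib, ← Finset.sum_sub_distrib]
    refine Finset.sum_congr rfl fun i hi => ?_
    have hdi := (hd0 i hi).ne'
    have : a i / d i = a i + 1 - (1 - σ) * (a i ^ 2 / d i) - σ * (1 ^ 2 / d i) := by
      field_simp
      rw [hd i hi]; ring
    rw [this, sub_smul, sub_smul, add_smul, one_smul, mul_smul, mul_smul]
  have hrhs : T * Ring.inverse D = T + 1 - (1 - σ) • (T * Ring.inverse D * T)
      - σ • Ring.inverse D := by
    have hTD : (1 - σ) • (T * Ring.inverse D * T) = T - σ • (T * Ring.inverse D) := by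
      have : T * Ring.inverse D * D = T := by rw [mul_assoc, hID, mul_one]
      rw [hD] at this
      rw [mul_add, mul_smul_comm, mul_smul_comm, mul_one, ← hD] at this
      exact eq_sub_of_add_eq this
    have h1D : (1 - σ) • (T * Ring.inverse D) = 1 - σ • Ring.inverse D := by
      have := hDI
      nth_rw 1 [hD] at this
      rw [add_mul, smul_mul_assoc, smul_mul_assoc, one_mul] at this
      exact eq_sub_of_add_eq this
    rw [sub_smul, one_smul] at h1D
    rw [hTD]
    linear_combination (norm := abel) h1D
  rw [hlhs, hrhs]
  exact sub_le_sub (sub_le_sub_left (smul_le_smul_of_nonneg_left h1 (by linarith [hσ.2])) _)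
    (smul_le_smul_of_nonneg_left h2 hσ.1)

lemma le_sqrt_star_mul_self {S T E F : 𝒜} (hS : 0 ≤ S) (hT : IsStrictlyPositive T)
    (hE : IsStrictlyPositive E) (hTE : Commute T E) (hF : IsStrictlyPositive F)
    (hSE : S * Ring.inverse T * S ≤ Ring.inverse E) (hFE : F * F ≤ T * E) :
    S ≤ CFC.sqrt (star (Ring.inverse F * T) * (Ring.inverse F * T)) := by
  set r := CFC.sqrt T with hr
  have hrpos : IsStrictlyPositive r := IsStrictlyPositive.sqrt T
  have hrr : r * r = T := CFC.sqrt_mul_sqrt_self T hT.nonneg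
  set r' := Ring.inverse r with hr'
  have h1 : r * r' = 1 := Ring.mul_inverse_cancel _ hrpos.isUnit
  have h2 : r' * r = 1 := Ring.inverse_mul_cancel _ hrpos.isUnit
  have hr'pos : 0 ≤ r' := (CFC.ringInverse_nonneg_iff_nonneg_of_isUnit hrpos.isUnit).2 hrpos.nonneg
  have hT' : Ring.inverse T = r' * r' := by rw [← hrr, Ring.mul_inverse_rev' (.refl r)]
  have hE'pos : 0 ≤ Ring.inverse E :=
    (CFC.ringInverse_nonneg_iff_nonneg_of_isUnit hE.isUnit).2 hE.nonneg
  set q := CFC.sqrt (Ring.inverse E) with hq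
  have hqq : q * q = Ring.inverse E := CFC.sqrt_mul_sqrt_self _ hE'pos
  have hqpos : 0 ≤ q := CFC.sqrt_nonneg _
  have hTE' : Commute T (Ring.inverse E) := commute_ringInverse hTE hE.isUnit
  have hrq : Commute r q := by
    have h3 : Commute T q := (hTE'.symm.cfcₙ_nnreal _).symm
    exact h3.cfcₙ_nnreal _
  have hr'q : Commute r' q := (commute_ringInverse hrq.symm hrpos.isUnit).symm
  have hmid : r' * S * r' ≤ q * r' := by
    have h4 : (r' * S * r') * (r' * S * r') ≤ (q * r') * (q * r') := by
      have h5 := conjugate_le_conjugate_of_nonneg hSE hr'pos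
      calc (r' * S * r') * (r' * S * r') = r' * (S * Ring.inverse T * S) * r' := by
            rw [hT']; simp only [mul_assoc]
        _ ≤ r' * Ring.inverse E * r' := h5
        _ = (q * r') * (q * r') := by
            rw [← hqq, ← mul_assoc r', hr'q.eq, mul_assoc, mul_assoc]
    have h6 := CFC.sqrt_le_sqrt _ _ h4
    rwa [CFC.sqrt_mul_self _ (conjugate_nonneg_of_nonneg hS hr'pos),
      CFC.sqrt_mul_self _ (hr'q.symm.mul_nonneg hqpos hr'pos)] at h6
  have hSle : S ≤ r * q := by
    have h7 := conjugate_le_conjugate_of_nonneg hmid hrpos.nonneg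
    have h8 : r * (r' * S * r') * r = S := by
      rw [mul_assoc r' S, ← mul_assoc r, h1, one_mul, mul_assoc, h2, mul_one]
    have h9 : r * (q * r') * r = r * q := by rw [← mul_assoc, mul_assoc, h2, mul_one]
    rwa [h8, h9] at h7
  refine hSle.trans ?_
  have hFF : IsStrictlyPositive (F * F) :=
    (hF.isUnit.mul hF.isUnit).isStrictlyPositive
      ((Commute.refl F).mul_nonneg hF.nonneg hF.nonneg)
  have hinv := CStarAlgebra.ringInverse_le_ringInverse hFE hFF
  have hconj := conjugate_le_conjugate_of_nonneg hinv hT.nonneg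
  have hFsa := isSelfAdjoint_ringInverse (IsSelfAdjoint.of_nonneg hF.nonneg)
  have e1 : (r * q) * (r * q) = T * Ring.inverse (T * E) * T := by
    rw [Ring.mul_inverse_rev' hTE, mul_assoc T, mul_assoc (Ring.inverse E),
      Ring.inverse_mul_cancel _ hT.isUnit,
      mul_one, ← hqq, ← hrr, mul_assoc, ← mul_assoc q r q, ← hrq.eq]
    simp only [mul_assoc]
  have e2 : T * Ring.inverse (F * F) * T = star (Ring.inverse F * T) * (Ring.inverse F * T) := by
    rw [Ring.mul_inverse_rev' (.refl F), star_mul, hFsa.star_eq, hT.isSelfAdjoint.star_eq]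
    simp only [mul_assoc]
  rw [← e1, e2] at hconj
  have := CFC.sqrt_le_sqrt _ _ hconj
  rwa [CFC.sqrt_mul_self _ (hrq.mul_nonneg hrpos.nonneg hqpos)] at this

/-- The operator inequality for a finite resolution of the identity by positive elements, when
`f²` is interpolated by a nonnegative combination of the functions `t / ((1 - σ) t + σ)`. -/
theorem sum_div_smul_le_abs {ι κ : Type*} {s : Finset ι} {J : Finset κ} {P : ι → 𝒜}
    (hP : ∀ i ∈ s, 0 ≤ P i) (hP1 : ∑ i ∈ s, P i = 1) {a f : ι → ℝ} (ha : ∀ i ∈ s, 0 < a i)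
    (hf : ∀ i ∈ s, 0 < f i) {c σ : κ → ℝ} (hc : ∀ j ∈ J, 0 ≤ c j)
    (hσ : ∀ j ∈ J, σ j ∈ Set.Icc (0 : ℝ) 1)
    (hfc : ∀ i ∈ s, f i ^ 2 = ∑ j ∈ J, c j * (a i / ((1 - σ j) * a i + σ j))) :
    ∑ i ∈ s, (a i / f i) • P i ≤
      CFC.abs (Ring.inverse (∑ i ∈ s, f i • P i) * ∑ i ∈ s, a i • P i) := by
  rcases s.eq_empty_or_nonempty with rfl | ⟨i₀, hi₀⟩
  · simp
  set d : κ → ι → ℝ := fun j i => (1 - σ j) * a i + σ j with hd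
  have hd0 : ∀ j ∈ J, ∀ i ∈ s, 0 < d j i := by
    intro j hj i hi
    obtain ⟨h0, h1⟩ := hσ j hj
    have hai := ha i hi
    rcases h0.eq_or_lt with h | h
    · simp only [hd, ← h]; linarith
    · have : 0 ≤ (1 - σ j) * a i := mul_nonneg (by linarith) hai.le
      simp only [hd]; linarith
  have hT := IsStrictlyPositive.sum_smul hP hP1 ha
  have hF := IsStrictlyPositive.sum_smul hP hP1 hf
  have hD : ∀ j ∈ J, IsStrictlyPositive (∑ i ∈ s, d j i • P i) :=
    fun j hj => IsStrictlyPositive.sum_smul hP hP1 (hd0 j hj)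
  have hDinv : ∀ j ∈ J, IsStrictlyPositive (Ring.inverse (∑ i ∈ s, d j i • P i)) := fun j hj =>
    (hD j hj).isUnit.ringInverse.isStrictlyPositive
      ((CFC.ringInverse_nonneg_iff_nonneg_of_isUnit (hD j hj).isUnit).2 (hD j hj).nonneg)
  have hE : IsStrictlyPositive (∑ j ∈ J, c j • Ring.inverse (∑ i ∈ s, d j i • P i)) := by
    obtain ⟨j₀, hj₀, hcj₀⟩ : ∃ j ∈ J, 0 < c j := by
      by_contra! h
      have h1 := hfc i₀ hi₀
      rw [Finset.sum_eq_zero fun j hj => by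
        rw [le_antisymm (h j hj) (hc j hj), zero_mul]] at h1
      have := pow_pos (hf i₀ hi₀) 2
      linarith
    refine IsStrictlyPositive.of_le (IsStrictlyPositive.smul hcj₀ (hDinv j₀ hj₀)) ?_
    exact Finset.single_le_sum (f := fun j => c j • Ring.inverse (∑ i ∈ s, d j i • P i))
      (fun j hj => smul_nonneg (hc j hj) (hDinv j hj).nonneg) hj₀
  have hcomm : Commute (∑ i ∈ s, a i • P i)
      (∑ j ∈ J, c j • Ring.inverse (∑ i ∈ s, d j i • P i)) := by
    refine Commute.sum_right _ _ _ fun j hj => Commute.smul_right ?_ _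
    refine commute_ringInverse ?_ (hD j hj).isUnit
    have : ∑ i ∈ s, d j i • P i = (1 - σ j) • ∑ i ∈ s, a i • P i + σ j • (1 : 𝒜) := by
      rw [← hP1, Finset.smul_sum, Finset.smul_sum, ← Finset.sum_add_distrib]
      exact Finset.sum_congr rfl fun i hi => by rw [hd, add_smul, mul_smul]
    rw [this]
    exact ((Commute.refl _).smul_right _).add_right ((Commute.one_right _).smul_right _)
  have hfe : ∀ i ∈ s, f i ^ 2 / a i = ∑ j ∈ J, c j / d j i := by
    intro i hi
    have hai := (ha i hi).ne'
    rw [hfc i hi, Finset.sum_div]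
    refine Finset.sum_congr rfl fun j hj => ?_
    have := (hd0 j hj i hi).ne'
    change c j * (a i / d j i) / a i = _
    field_simp
  refine le_sqrt_star_mul_self ?_ hT hE hcomm hF ?_ ?_
  · exact Finset.sum_nonneg fun i hi => smul_nonneg (div_pos (ha i hi) (hf i hi)).le (hP i hi)
  · refine (sum_smul_mul_inverse_mul_le hP ha (fun i => a i / f i) hT).trans ?_
    refine (Finset.sum_le_sum fun i hi => le_of_eq ?_).trans
      (sum_inv_smul_le_inverse hP hd0 hc hfe
        (fun i hi => div_pos (pow_pos (hf i hi) 2) (ha i hi)) hD hE)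
    have hai := (ha i hi).ne'
    have hfi := (hf i hi).ne'
    congr 1
    field_simp
  · have h1 := sum_smul_mul_inverse_mul_le hP (d := fun _ => 1) (fun _ _ => one_pos) f
      (by simp [hP1])
    simp only [one_smul, hP1, Ring.inverse_one, mul_one, div_one] at h1
    refine h1.trans ?_
    rw [Finset.mul_sum]
    calc ∑ i ∈ s, f i ^ 2 • P i = ∑ j ∈ J, c j • ∑ i ∈ s, (a i / d j i) • P i := by
          simp only [Finset.smul_sum, smul_smul]
          rw [Finset.sum_comm]
          exact Finset.sum_congr rfl fun i hi => by rw [hfc i hi, Finset.sum_smul]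
      _ ≤ _ := Finset.sum_le_sum fun j hj => by
          rw [mul_smul_comm]
          exact smul_le_smul_of_nonneg_left
            (sum_div_smul_le_mul_inverse hP hP1 (hd0 j hj) (hσ j hj) fun i hi => rfl) (hc j hj)

end PositiveFamily

section Eigenvectors

/-- The continuous functional calculus acts on eigenvectors by evaluation at the eigenvalue. -/
lemma cfc_apply_eigenvector {A : H →L[ℂ] H} (hA : IsSelfAdjoint A) {g : ℝ → ℝ}
    (hg : ContinuousOn g (spectrum ℝ A)) {l : ℝ} {v : H} (hv : A v = (l : ℂ) • v) :
    cfc g A v = (g l : ℂ) • v := by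
  rcases eq_or_ne v 0 with rfl | hv0
  · simp
  have hl : l ∈ spectrum ℝ A := by
    intro hu
    have h1 : (algebraMap ℝ (H →L[ℂ] H) l - A) v = 0 := by
      rw [sub_apply, hv, sub_eq_zero, Algebra.algebraMap_eq_smul_one]
      simp [Complex.coe_smul]
    have h2 : v = (Ring.inverse (algebraMap ℝ (H →L[ℂ] H) l - A) *
        (algebraMap ℝ (H →L[ℂ] H) l - A)) v := by
      rw [Ring.inverse_mul_cancel _ hu]; rfl
    rw [mul_apply_eq_comp, h1, map_zero] at h2
    exact hv0 h2
  rw [cfc_apply g A hA hg]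
  suffices h : ∀ φ : C(spectrum ℝ A, ℝ), cfcHom hA φ v = (φ ⟨l, hl⟩ : ℂ) • v from h _
  intro φ
  induction φ using ContinuousMap.induction_on_of_compact with
  | const r =>
    have : ContinuousMap.const (spectrum ℝ A) r = algebraMap ℝ C(spectrum ℝ A, ℝ) r := rfl
    rw [this, AlgHomClass.commutes, Algebra.algebraMap_eq_smul_one]
    simp [Complex.coe_smul]
  | id => rw [cfcHom_id hA, hv]; rfl
  | star_id => rw [map_star, cfcHom_id hA, hA.star_eq, hv]; rfl
  | add f g hf hg => rw [map_add, add_apply, hf, hg, ← add_smul]; simp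
  | mul f g hf hg =>
    rw [map_mul, mul_apply_eq_comp, hg, map_smul, hf, smul_smul]
    simp [mul_comm]
  | frequently f hf =>
    have hc : IsClosed {φ : C(spectrum ℝ A, ℝ) | cfcHom hA φ v = (φ ⟨l, hl⟩ : ℂ) • v} := by
      refine isClosed_eq ?_ ?_
      · exact (ContinuousLinearMap.apply ℂ H v).continuous.comp (cfcHom_continuous hA)
      · exact (Complex.continuous_ofReal.comp (ContinuousEvalConst.continuous_eval_const _)).smul
          continuous_const
    exact hc.closure_subset (mem_closure_iff_frequently.2 hf)

lemma spectrum_subset_Ioi_of_smul_one_le {A : H →L[ℂ] H} {c : ℝ} (hc : 0 < c)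
    (hA : c • (1 : H →L[ℂ] H) ≤ A) : spectrum ℝ A ⊆ Set.Ioi 0 := by
  have hpos : IsStrictlyPositive A :=
    IsStrictlyPositive.of_le (IsStrictlyPositive.smul hc isStrictlyPositive_one) hA
  intro x hx
  exact hpos.spectrum_pos hx

/-- Monotonicity of positive operator concave functions, up to an affine rescaling. -/
lemma IsOperatorConcaveOn.smul_cfc_le {g : ℝ → ℝ} (hg : IsOperatorConcaveOn H g)
    (hg0 : ∀ t ∈ Set.Ioi (0 : ℝ), 0 < g t)
    {A D : H →L[ℂ] H} {c : ℝ} (hc : 0 < c) (hA : c • (1 : H →L[ℂ] H) ≤ A) (hD : 0 ≤ D)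
    {θ : ℝ} (hθ : θ ∈ Set.Ioo (0 : ℝ) 1) :
    θ • cfc g A ≤ cfc g (θ • (A + D) + (1 - θ) • (1 : H →L[ℂ] H)) := by
  obtain ⟨h0, h1⟩ := hθ
  have h1' : (0 : ℝ) < 1 - θ := by linarith
  set C : H →L[ℂ] H := (θ / (1 - θ)) • D + 1 with hC
  have hC1 : (1 : ℝ) • (1 : H →L[ℂ] H) ≤ C := by
    rw [one_smul, hC]
    exact le_add_of_nonneg_left (smul_nonneg (div_pos h0 h1').le hD)
  have hApos : IsStrictlyPositive A :=
    IsStrictlyPositive.of_le (IsStrictlyPositive.smul hc isStrictlyPositive_one) hA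
  have hCpos : IsStrictlyPositive C :=
    IsStrictlyPositive.of_le (IsStrictlyPositive.smul one_pos isStrictlyPositive_one) hC1
  have h := hg A C hApos.nonneg hApos.isUnit hCpos.nonneg hCpos.isUnit θ ⟨h0.le, h1.le⟩
  have hcomb : θ • A + (1 - θ) • C = θ • (A + D) + (1 - θ) • (1 : H →L[ℂ] H) := by
    rw [hC, smul_add, smul_add, smul_smul, mul_div_cancel₀ _ h1'.ne', add_assoc]
  rw [hcomb, cfc_neg, cfc_neg, cfc_neg, smul_neg, smul_neg, ← neg_add, neg_le_neg_iff] at h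
  refine le_trans ?_ h
  refine le_add_of_nonneg_right (smul_nonneg h1'.le ?_)
  exact cfc_nonneg fun x hx => (hg0 x (spectrum_subset_Ioi_of_smul_one_le one_pos hC1 hx)).le

/-- Monotonicity of positive operator concave functions, tested on an eigenvector expansion. -/
lemma IsOperatorConcaveOn.sum_le_sum {g : ℝ → ℝ} (hg : IsOperatorConcaveOn H g)
    (hgc : ContinuousOn g (Set.Ioi 0)) (hg0 : ∀ t ∈ Set.Ioi (0 : ℝ), 0 < g t)
    {A D : H →L[ℂ] H} {c : ℝ} (hc : 0 < c) (hA : c • (1 : H →L[ℂ] H) ≤ A) (hD : 0 ≤ D)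
    {ι : Type*} [Fintype ι] {l m a b : ι → ℝ} {e y : ι → H} {v : H}
    (hm : ∀ i, 0 < m i)
    (he : ∀ i, A (e i) = (l i : ℂ) • e i) (hy : ∀ i, (A + D) (y i) = (m i : ℂ) • y i)
    (hva : v = ∑ i, (a i : ℂ) • e i) (hvb : v = ∑ i, (b i : ℂ) • y i) :
    ∑ i, g (l i) * (a i * (inner ℂ v (e i)).re) ≤ ∑ i, g (m i) * (b i * (inner ℂ v (y i)).re) := by
  have hApos : IsStrictlyPositive A :=
    IsStrictlyPositive.of_le (IsStrictlyPositive.smul hc isStrictlyPositive_one) hA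
  have hfA : (inner ℂ v (cfc g A v)).re = ∑ i, g (l i) * (a i * (inner ℂ v (e i)).re) := by
    nth_rw 2 [hva]
    have := fun i => cfc_apply_eigenvector hApos.isSelfAdjoint
      (hgc.mono (spectrum_subset_Ioi_of_smul_one_le hc hA)) (he i)
    simp only [map_sum, map_smul, this, inner_sum, inner_smul_right, Complex.re_sum,
      Complex.re_ofReal_mul]
    exact Finset.sum_congr rfl fun i _ => by ring
  have key : ∀ θ ∈ Set.Ioo (0 : ℝ) 1, θ * ∑ i, g (l i) * (a i * (inner ℂ v (e i)).re) ≤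
      ∑ i, g (θ * m i + (1 - θ)) * (b i * (inner ℂ v (y i)).re) := by
    intro θ hθ
    have h := hg.smul_cfc_le hg0 hc hA hD hθ
    obtain ⟨h0, h1⟩ := hθ
    set B := θ • (A + D) + (1 - θ) • (1 : H →L[ℂ] H) with hB
    have hAD : 0 ≤ A + D := add_nonneg hApos.nonneg hD
    have hB1 : (1 - θ) • (1 : H →L[ℂ] H) ≤ B := le_add_of_nonneg_left (smul_nonneg h0.le hAD)
    have hBy : ∀ i, B (y i) = ((θ * m i + (1 - θ) : ℝ) : ℂ) • y i := by
      intro i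
      rw [hB, add_apply, smul_apply, smul_apply, hy i]
      simp only [one_apply_eq_self, ← Complex.coe_smul, smul_smul, ← add_smul]
      push_cast; rfl
    have hBpos : IsStrictlyPositive B := IsStrictlyPositive.of_le
      (IsStrictlyPositive.smul (by linarith) isStrictlyPositive_one) hB1
    have hfB : (inner ℂ v (cfc g B v)).re =
        ∑ i, g (θ * m i + (1 - θ)) * (b i * (inner ℂ v (y i)).re) := by
      nth_rw 2 [hvb]
      have := fun i => cfc_apply_eigenvector hBpos.isSelfAdjoint
        (hgc.mono (spectrum_subset_Ioi_of_smul_one_le (by linarith) hB1)) (hBy i)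
      simp only [map_sum, map_smul, this, inner_sum, inner_smul_right, Complex.re_sum,
        Complex.re_ofReal_mul]
      exact Finset.sum_congr rfl fun i _ => by ring
    rw [ContinuousLinearMap.le_def] at h
    have h2 := h.re_inner_nonneg_right v
    rw [sub_apply, inner_sub_right, smul_apply, ← Complex.coe_smul, inner_smul_right] at h2
    simp only [RCLike.re_eq_complex_re, Complex.sub_re, Complex.re_ofReal_mul, hfA, hfB] at h2
    linarith
  have hlim1 : Filter.Tendsto (fun θ : ℝ => θ * ∑ i, g (l i) * (a i * (inner ℂ v (e i)).re))
      (nhdsWithin 1 (Set.Ioo 0 1)) (nhds (1 * ∑ i, g (l i) * (a i * (inner ℂ v (e i)).re))) :=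
    ((continuous_id.mul continuous_const).tendsto 1).mono_left nhdsWithin_le_nhds
  have hlim2 : Filter.Tendsto
      (fun θ : ℝ => ∑ i, g (θ * m i + (1 - θ)) * (b i * (inner ℂ v (y i)).re))
      (nhdsWithin 1 (Set.Ioo 0 1))
      (nhds (∑ i, g (1 * m i + (1 - 1)) * (b i * (inner ℂ v (y i)).re))) := by
    refine tendsto_finsetSum _ fun i _ => Filter.Tendsto.mul_const _ ?_
    have hgi : ContinuousAt g (1 * m i + (1 - 1)) :=
      hgc.continuousAt (Ioi_mem_nhds (by simpa using hm i))
    refine (hgi.tendsto.comp ?_).mono_left nhdsWithin_le_nhds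
    exact (by fun_prop : Continuous fun θ : ℝ => θ * m i + (1 - θ)).tendsto 1
  have : (nhdsWithin (1 : ℝ) (Set.Ioo 0 1)).NeBot := by
    rw [← mem_closure_iff_nhdsWithin_neBot, closure_Ioo (by norm_num)]
    exact ⟨zero_le_one, le_rfl⟩
  have := le_of_tendsto_of_tendsto hlim1 hlim2 (eventually_mem_nhdsWithin.mono key)
  simpa using this

end Eigenvectors

section DividedDifferences

open Polynomial

lemma Lagrange.sum_eval_mul_nodalWeight_div_sub {ι : Type*} [DecidableEq ι] {s : Finset ι}
    {v : ι → ℝ} (hv : Set.InjOn v s) {p : ℝ[X]} (hp : p.degree < s.card) {z : ℝ}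
    (hz : ∀ i ∈ s, z ≠ v i) :
    ∑ i ∈ s, p.eval (v i) * nodalWeight s v i / (v i - z) = - (p.eval z / (nodal s v).eval z) := by
  have h1 := eval_interpolate_not_at_node (fun i => p.eval (v i)) hz
  rw [← eq_interpolate hv hp] at h1
  rw [h1, mul_div_cancel_left₀ _ (eval_nodal_not_at_node hz), ← Finset.sum_neg_distrib]
  refine Finset.sum_congr rfl fun i hi => ?_
  have h2 := sub_ne_zero.2 (hz i hi)
  have h3 := sub_ne_zero.2 (hz i hi).symm
  have h4 : (v i - z)⁻¹ = -(z - v i)⁻¹ := by rw [← inv_neg, neg_sub]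
  rw [div_eq_mul_inv, h4]; ring

/-- The inequality between two interlacing spectra differing by a rank one perturbation. -/
lemma IsOperatorConcaveOn.sum_nodalWeight_nonneg_of_weight_pos {g : ℝ → ℝ}
    (hg : IsOperatorConcaveOn H g)
    (hgc : ContinuousOn g (Set.Ioi 0)) (hg0 : ∀ t ∈ Set.Ioi (0 : ℝ), 0 < g t)
    {ι : Type*} [Fintype ι] [DecidableEq ι] {e : ι → H} (he : Orthonormal ℂ e) {l m : ι → ℝ}
    (hl : Function.Injective l) (hm : Function.Injective m) (hlm : ∀ i j, l i ≠ m j)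
    (hl0 : ∀ i, 0 < l i) (hm0 : ∀ i, 0 < m i)
    (hw : ∀ i, 0 < -((Lagrange.nodal Finset.univ m).eval (l i) *
      Lagrange.nodalWeight Finset.univ l i))
    {p : ℝ[X]} (hp : p.degree < Fintype.card ι) :
    0 ≤ ∑ i, Lagrange.nodalWeight Finset.univ l i / (Lagrange.nodal Finset.univ m).eval (l i) *
        (p.eval (l i) ^ 2 * g (l i)) +
      ∑ i, Lagrange.nodalWeight Finset.univ m i / (Lagrange.nodal Finset.univ l).eval (m i) *
        (p.eval (m i) ^ 2 * g (m i)) := by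
  rcases isEmpty_or_nonempty ι with hι | hι
  · simp
  set P := Lagrange.nodal Finset.univ l with hP
  set Q := Lagrange.nodal Finset.univ m with hQ
  set w := Lagrange.nodalWeight Finset.univ l with hwdef
  set w' := Lagrange.nodalWeight Finset.univ m with hwdef'
  have hQl : ∀ i, Q.eval (l i) ≠ 0 := fun i =>
    Lagrange.eval_nodal_not_at_node fun j _ => hlm i j
  have hPm : ∀ i, P.eval (m i) ≠ 0 := fun i =>
    Lagrange.eval_nodal_not_at_node fun j _ => (hlm j i).symm
  have hlmsub : ∀ i j, l i - m j ≠ 0 := fun i j => sub_ne_zero.2 (hlm i j)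
  set x : ι → ℝ := fun i => √(-(Q.eval (l i) * w i)) with hx
  have hx0 : ∀ i, x i ≠ 0 := fun i => (Real.sqrt_pos.2 (hw i)).ne'
  have hxx : ∀ i, x i * x i = -(Q.eval (l i) * w i) := fun i => Real.mul_self_sqrt (hw i).le
  have hxsum : ∀ j, ∑ i, x i * x i / (l i - m j) = -1 := by
    intro j
    have hdeg : (Q - P).degree < (Finset.univ : Finset ι).card := by
      have := Polynomial.degree_sub_lt_left (p := Q) (q := P)
        (by rw [Lagrange.degree_nodal, Lagrange.degree_nodal]) Lagrange.nodal_ne_zero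
        (by rw [Lagrange.nodal_monic.leadingCoeff, Lagrange.nodal_monic.leadingCoeff])
      rwa [Lagrange.degree_nodal] at this
    have h := Lagrange.sum_eval_mul_nodalWeight_div_sub (s := Finset.univ) hl.injOn hdeg
      (z := m j) fun i _ => (hlm i j).symm
    simp only [eval_sub] at h
    rw [hQ, Lagrange.eval_nodal_at_node (Finset.mem_univ j), ← hQ, ← hP, zero_sub, neg_div,
      neg_neg, div_self (hPm j)] at h
    rw [← h, ← Finset.sum_neg_distrib]
    refine Finset.sum_congr rfl fun i _ => ?_
    rw [hxx i, hP, Lagrange.eval_nodal_at_node (Finset.mem_univ i)]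
    ring
  set c := Finset.univ.inf' Finset.univ_nonempty l with hc
  have hc0 : 0 < c := by
    rw [hc, Finset.lt_inf'_iff]; exact fun i _ => hl0 i
  have hcl : ∀ i, c ≤ l i := fun i => Finset.inf'_le _ (Finset.mem_univ i)
  set A : H →L[ℂ] H := c • (1 : H →L[ℂ] H) +
    ∑ i, (l i - c) • InnerProductSpace.rankOne ℂ (e i) (e i) with hA
  set ξ : H := ∑ i, (x i : ℂ) • e i with hξ
  set D : H →L[ℂ] H := InnerProductSpace.rankOne ℂ ξ ξ with hD
  set y : ι → H := fun j => ∑ i, ((x i / (l i - m j) : ℝ) : ℂ) • e i with hy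
  set v : H := ∑ i, ((p.eval (l i) * w i / x i : ℝ) : ℂ) • e i with hv
  have hpos : ∀ z : H, 0 ≤ InnerProductSpace.rankOne ℂ z z := fun z =>
    (ContinuousLinearMap.nonneg_iff_isPositive _).2 (InnerProductSpace.isPositive_rankOne_self z)
  have hAc : c • (1 : H →L[ℂ] H) ≤ A := le_add_of_nonneg_right <|
    Finset.sum_nonneg fun i _ => smul_nonneg (sub_nonneg.2 (hcl i)) (hpos _)
  have hAe : ∀ i, A (e i) = (l i : ℂ) • e i := by
    intro i
    have h1 : ∀ j, inner ℂ (e j) (e i) = if j = i then (1 : ℂ) else 0 :=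
      orthonormal_iff_ite.1 he |> fun h j => h j i
    rw [hA, add_apply, sum_apply]
    simp only [smul_apply, InnerProductSpace.rankOne_apply, h1, one_apply_eq_self, ite_smul,
      one_smul, zero_smul, smul_ite, smul_zero, Finset.sum_ite_eq', Finset.mem_univ, if_true,
      ← Complex.coe_smul, ← add_smul]
    push_cast; ring_nf
  have hinner : ∀ a b : ι → ℝ, inner ℂ (∑ i, (a i : ℂ) • e i) (∑ i, (b i : ℂ) • e i) =
      ((∑ i, a i * b i : ℝ) : ℂ) := by
    intro a b
    rw [he.inner_sum]
    simp
  have hADy : ∀ j, (A + D) (y j) = (m j : ℂ) • y j := by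
    intro j
    have h1 : inner ℂ ξ (y j) = -1 := by
      rw [hξ, hy, hinner]
      have : ∑ i, x i * (x i / (l i - m j)) = -1 := by
        rw [← hxsum j]; exact Finset.sum_congr rfl fun i _ => by ring
      rw [this]; simp
    rw [add_apply, hD, InnerProductSpace.rankOne_apply, h1]
    simp only [hy, hξ, map_sum, map_smul, hAe, Finset.smul_sum, smul_smul]
    rw [← Finset.sum_add_distrib]
    refine Finset.sum_congr rfl fun i _ => ?_
    rw [← add_smul]
    congr 1
    have := hlmsub i j
    have h2 : x i / (l i - m j) * l i + -1 * x i = m j * (x i / (l i - m j)) := by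
      field_simp; ring
    have h3 := congrArg (fun r : ℝ => (r : ℂ)) h2
    push_cast at h3 ⊢
    exact h3
  have hvy : v = ∑ j, ((-(p.eval (m j) * w' j) : ℝ) : ℂ) • y j := by
    simp only [hy, Finset.smul_sum, smul_smul]
    rw [Finset.sum_comm, hv]
    refine Finset.sum_congr rfl fun i _ => ?_
    rw [← Finset.sum_smul]
    congr 1
    norm_cast
    have h := Lagrange.sum_eval_mul_nodalWeight_div_sub (s := Finset.univ) hm.injOn hp
      (z := l i) fun j _ => hlm i j
    have h2 : ∑ j, -(p.eval (m j) * w' j) * (x i / (l i - m j)) =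
        x i * ∑ j, p.eval (m j) * w' j / (m j - l i) := by
      rw [Finset.mul_sum]
      refine Finset.sum_congr rfl fun j _ => ?_
      have h4 : (m j - l i)⁻¹ = -(l i - m j)⁻¹ := by rw [← inv_neg, neg_sub]
      rw [div_eq_mul_inv (_ * _), h4]; ring
    rw [h2, h, ← hQ]
    have h3 := hxx i
    have := hQl i
    have := hx0 i
    field_simp
    linear_combination (p.eval (l i)) * h3
  have hvl : ∀ i, (inner ℂ v (e i)).re = p.eval (l i) * w i / x i := by
    intro i
    rw [hv, he.inner_left_fintype, Complex.conj_ofReal, Complex.ofReal_re]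
  have hvy' : ∀ j, (inner ℂ v (y j)).re = -(p.eval (m j) / P.eval (m j)) := by
    intro j
    rw [hv, hy, hinner, Complex.ofReal_re, ← Lagrange.sum_eval_mul_nodalWeight_div_sub
      (s := Finset.univ) hl.injOn hp (z := m j) fun i _ => (hlm i j).symm]
    refine Finset.sum_congr rfl fun i _ => ?_
    have := hx0 i
    field_simp
    rfl
  have hmain := hg.sum_le_sum hgc hg0 hc0 hAc (hpos ξ) hm0 hAe hADy hv hvy
  simp only [hvl, hvy'] at hmain
  rw [← sub_nonneg] at hmain
  refine hmain.trans_eq ?_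
  rw [add_comm, sub_eq_add_neg, ← Finset.sum_neg_distrib]
  congr 1
  · exact Finset.sum_congr rfl fun i _ => by ring
  · refine Finset.sum_congr rfl fun i _ => ?_
    have h3 := hxx i
    have h4 := hQl i
    have h5 := hx0 i
    field_simp
    linear_combination (-(w i * p.eval (l i) ^ 2 * g (l i))) * h3

end DividedDifferences

section DividedDifferences

open Polynomial

lemma Lagrange.nodalWeight_image {ι : Type*} [Fintype ι] [DecidableEq ι] {ψ : ι → ℝ}
    (hψ : Function.Injective ψ) (a : ι) :
    nodalWeight (Finset.univ.image ψ) id (ψ a) = nodalWeight Finset.univ ψ a := by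
  rw [nodalWeight, nodalWeight, ← Finset.image_erase hψ, Finset.prod_image hψ.injOn]
  rfl

lemma Lagrange.nodalWeight_sumElim_inl {ι κ : Type*} [Fintype ι] [DecidableEq ι] [Fintype κ]
    [DecidableEq κ] (l : ι → ℝ) (m : κ → ℝ) (i : ι) :
    nodalWeight Finset.univ (Sum.elim l m) (Sum.inl i) =
      nodalWeight Finset.univ l i / (nodal Finset.univ m).eval (l i) := by
  have : (Finset.univ : Finset (ι ⊕ κ)).erase (Sum.inl i) =
      (Finset.univ.erase i).disjSum Finset.univ := by
    ext (a | a) <;> simp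
  rw [nodalWeight, this, Finset.prod_disjSum, nodalWeight, eval_nodal, div_eq_mul_inv,
    ← Finset.prod_inv_distrib]
  rfl

lemma Lagrange.nodalWeight_sumElim_inr {ι κ : Type*} [Fintype ι] [DecidableEq ι] [Fintype κ]
    [DecidableEq κ] (l : ι → ℝ) (m : κ → ℝ) (i : κ) :
    nodalWeight Finset.univ (Sum.elim l m) (Sum.inr i) =
      nodalWeight Finset.univ m i / (nodal Finset.univ l).eval (m i) := by
  have : (Finset.univ : Finset (ι ⊕ κ)).erase (Sum.inr i) =
      Finset.univ.disjSum (Finset.univ.erase i) := by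
    ext (a | a) <;> simp
  rw [nodalWeight, this, Finset.prod_disjSum, nodalWeight, eval_nodal, div_eq_mul_inv, mul_comm,
    ← Finset.prod_inv_distrib]
  rfl

/-- The divided difference of `p² g` over an even number of nodes is nonnegative. -/
theorem IsOperatorConcaveOn.sum_nodalWeight_nonneg {g : ℝ → ℝ} (hg : IsOperatorConcaveOn H g)
    (hgc : ContinuousOn g (Set.Ioi 0)) (hg0 : ∀ t ∈ Set.Ioi (0 : ℝ), 0 < g t)
    {k : ℕ} {e : Fin k → H} (he : Orthonormal ℂ e) {s : Finset ℝ} (hs : ∀ t ∈ s, 0 < t)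
    (hk : s.card = 2 * k) {p : ℝ[X]} (hp : p.degree < k) :
    0 ≤ ∑ t ∈ s, Lagrange.nodalWeight s id t * (p.eval t ^ 2 * g t) := by
  set τ := s.orderEmbOfFin hk with hτ
  set l : Fin k → ℝ := fun i => τ ⟨2 * i, by lia⟩ with hl
  set m : Fin k → ℝ := fun i => τ ⟨2 * i + 1, by lia⟩ with hm
  have hlm_lt : ∀ i j, l i < m j ↔ i ≤ j := by
    intro i j
    simp only [hl, hm, τ.lt_iff_lt, Fin.mk_lt_mk, Fin.le_def]; lia
  have hml_lt : ∀ i j, m i < l j ↔ i < j := by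
    intro i j
    simp only [hl, hm, τ.lt_iff_lt, Fin.lt_def]; lia
  have hll_lt : ∀ i j, l i < l j ↔ i < j := by
    intro i j
    simp only [hl, τ.lt_iff_lt, Fin.lt_def]; lia
  have hl_inj : Function.Injective l := by
    intro i j h
    have := τ.injective h
    ext; simpa using this
  have hm_inj : Function.Injective m := by
    intro i j h
    have := τ.injective h
    ext; simpa using this
  have hlm : ∀ i j, l i ≠ m j := by
    intro i j h
    have := congrArg Fin.val (τ.injective h)
    simp only at this; lia
  have hψ : Function.Injective (Sum.elim l m) := hl_inj.sumElim hm_inj hlm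
  have himage : Finset.univ.image (Sum.elim l m) = s := by
    refine Finset.eq_of_subset_of_card_le ?_ ?_
    · intro t ht
      obtain ⟨i | i, -, rfl⟩ := Finset.mem_image.1 ht
      · exact s.orderEmbOfFin_mem hk _
      · exact s.orderEmbOfFin_mem hk _
    · rw [Finset.card_image_of_injective _ hψ, hk, Finset.card_univ, Fintype.card_sum,
        Fintype.card_fin]
      lia
  rw [← himage, Finset.sum_image hψ.injOn]
  simp only [Lagrange.nodalWeight_image hψ]
  rw [Fintype.sum_sum_type]
  simp only [Lagrange.nodalWeight_sumElim_inl, Lagrange.nodalWeight_sumElim_inr, Sum.elim_inl,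
    Sum.elim_inr]
  refine hg.sum_nodalWeight_nonneg_of_weight_pos hgc hg0 he hl_inj hm_inj hlm
    (fun i => hs _ (s.orderEmbOfFin_mem hk _)) (fun i => hs _ (s.orderEmbOfFin_mem hk _)) ?_
    (by simpa using hp)
  intro i
  rw [Lagrange.eval_nodal, Lagrange.nodalWeight, ← Finset.mul_prod_erase _ _ (Finset.mem_univ i),
    mul_assoc, ← Finset.prod_mul_distrib, ← neg_mul]
  refine mul_pos (by linarith [(hlm_lt i i).2 le_rfl]) (Finset.prod_pos fun j hj => ?_)
  rcases lt_or_gt_of_ne (Finset.ne_of_mem_erase hj) with h | h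
  · exact mul_pos (sub_pos.2 ((hml_lt j i).2 h)) (inv_pos.2 (sub_pos.2 ((hll_lt j i).2 h)))
  · exact mul_pos_of_neg_of_neg (sub_neg.2 ((hlm_lt i j).2 h.le))
      (inv_neg''.2 (sub_neg.2 ((hll_lt i j).2 h)))

end DividedDifferences

section DividedDifferences

open Polynomial Filter

lemma Lagrange.sum_nodalWeight_insert {s : Finset ℝ} {d : ℝ} (hd : d ∉ s) (h : ℝ → ℝ) :
    ∑ t ∈ insert d s, nodalWeight (insert d s) id t * h t =
      ((nodal s id).eval d)⁻¹ * h d + ∑ t ∈ s, nodalWeight s id t * (t - d)⁻¹ * h t := by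
  rw [Finset.sum_insert hd]
  congr 1
  · rw [nodalWeight_eq_eval_nodal_erase_inv, Finset.erase_insert hd]; rfl
  · refine Finset.sum_congr rfl fun t ht => ?_
    have htd : d ≠ t := fun h => hd (h ▸ ht)
    rw [nodalWeight, Finset.erase_insert_of_ne htd, Finset.prod_insert (by simp [hd]),
      nodalWeight, mul_comm (id t - id d)⁻¹]
    rfl

lemma IsOperatorConcaveOn.le_mul_two [Nontrivial H] {g : ℝ → ℝ} (hg : IsOperatorConcaveOn H g)
    (hg0 : ∀ t ∈ Set.Ioi (0 : ℝ), 0 < g t) {d : ℝ} (hd : 2 < d) : g d ≤ d * g 2 := by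
  have hpos : ∀ r : ℝ, 0 < r → IsStrictlyPositive (algebraMap ℝ (H →L[ℂ] H) r) := fun r hr => by
    rw [Algebra.algebraMap_eq_smul_one]
    exact IsStrictlyPositive.smul hr isStrictlyPositive_one
  have hd1 : 0 < d - 1 := by linarith
  have h := hg _ _ (hpos d (by linarith)).nonneg (hpos d (by linarith)).isUnit
    (hpos 1 one_pos).nonneg (hpos 1 one_pos).isUnit (d - 1)⁻¹
    ⟨by positivity, inv_le_one_of_one_le₀ (by linarith)⟩
  have hcomb : (d - 1)⁻¹ • algebraMap ℝ (H →L[ℂ] H) d +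
      (1 - (d - 1)⁻¹) • algebraMap ℝ (H →L[ℂ] H) 1 = algebraMap ℝ (H →L[ℂ] H) 2 := by
    simp only [Algebra.algebraMap_eq_smul_one, smul_smul, ← add_smul]
    congr 1
    field_simp
    ring
  rw [hcomb, cfc_algebraMap, cfc_algebraMap, cfc_algebraMap] at h
  simp only [Algebra.algebraMap_eq_smul_one, smul_smul, ← add_smul] at h
  have h2 : -g 2 ≤ (d - 1)⁻¹ * -g d + (1 - (d - 1)⁻¹) * -g 1 := by
    by_contra! hlt
    have h3 : (0 : H →L[ℂ] H) ≤ (((d - 1)⁻¹ * -g d + (1 - (d - 1)⁻¹) * -g 1) - -g 2) • 1 := by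
      rw [sub_smul]; exact sub_nonneg.2 h
    have h4 : (((d - 1)⁻¹ * -g d + (1 - (d - 1)⁻¹) * -g 1) - -g 2) • (1 : H →L[ℂ] H) ≤ 0 :=
      smul_nonpos_of_nonpos_of_nonneg (by linarith) zero_le_one
    have h5 := le_antisymm h4 h3
    rcases smul_eq_zero.1 h5 with h6 | h6
    · linarith
    · exact one_ne_zero h6
  have h1 := hg0 1 (Set.mem_Ioi.2 one_pos)
  have h22 := hg0 2 (Set.mem_Ioi.2 two_pos)
  have hinv : (d - 1)⁻¹ ≤ 1 := inv_le_one_of_one_le₀ (by linarith)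
  have h7 : (d - 1)⁻¹ * g d ≤ g 2 := by nlinarith
  rw [inv_mul_le_iff₀ hd1] at h7
  linarith

/-- The divided difference of `w² g` over an odd number of nodes is nonpositive when `w` has
small degree. -/
theorem IsOperatorConcaveOn.sum_nodalWeight_nonpos {g : ℝ → ℝ} (hg : IsOperatorConcaveOn H g)
    (hgc : ContinuousOn g (Set.Ioi 0)) (hg0 : ∀ t ∈ Set.Ioi (0 : ℝ), 0 < g t)
    {k : ℕ} {e : Fin (k + 1) → H} (he : Orthonormal ℂ e) {s : Finset ℝ} (hs : ∀ t ∈ s, 0 < t)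
    (hk : s.card = 2 * k + 1) {w : ℝ[X]} (hw : w.degree < k) :
    ∑ t ∈ s, Lagrange.nodalWeight s id t * (w.eval t ^ 2 * g t) ≤ 0 := by
  have : Nontrivial H := ⟨⟨e 0, 0, he.ne_zero 0⟩⟩
  obtain ⟨M, hM⟩ := s.bddAbove
  have hev : ∀ᶠ d in atTop,
      ∑ t ∈ s, Lagrange.nodalWeight s id t * (w.eval t ^ 2 * g t) * (1 - t / d)⁻¹ ≤
      g 2 * ((X ^ 2 * w ^ 2).eval d / (Lagrange.nodal s id).eval d) := by
    filter_upwards [eventually_gt_atTop M, eventually_gt_atTop 2] with d hdM hd2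
    have hlt : ∀ t ∈ s, t < d := fun t ht => (hM ht).trans_lt hdM
    have hds : d ∉ s := fun h => (hlt d h).false
    have h := hg.sum_nodalWeight_nonneg hgc hg0 he (s := insert d s) (p := w)
      (fun t ht => by
        rcases Finset.mem_insert.1 ht with rfl | ht
        · linarith
        · exact hs t ht)
      (by rw [Finset.card_insert_of_notMem hds, hk]; lia)
      (hw.trans_le (by exact_mod_cast Nat.le_succ k))
    rw [Lagrange.sum_nodalWeight_insert hds (fun t => w.eval t ^ 2 * g t)] at h
    have hnodal : 0 < (Lagrange.nodal s id).eval d := by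
      rw [Lagrange.eval_nodal]; exact Finset.prod_pos fun t ht => sub_pos.2 (hlt t ht)
    have hd0 : 0 < d := by linarith
    have hsum : ∑ t ∈ s, Lagrange.nodalWeight s id t * (w.eval t ^ 2 * g t) * (1 - t / d)⁻¹ =
        -(d * ∑ t ∈ s, Lagrange.nodalWeight s id t * (t - d)⁻¹ * (w.eval t ^ 2 * g t)) := by
      rw [Finset.mul_sum, ← Finset.sum_neg_distrib]
      refine Finset.sum_congr rfl fun t ht => ?_
      have h1 : (1 - t / d)⁻¹ = -(d * (t - d)⁻¹) := by
        have h2 := sub_ne_zero.2 (hlt t ht).ne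
        have h3 : 1 - t / d = -((t - d) / d) := by field_simp; ring
        rw [h3, inv_neg, inv_div, div_eq_mul_inv]
      rw [h1]; ring
    rw [hsum]
    have hgd := hg.le_mul_two hg0 hd2
    have h4 : d * (((Lagrange.nodal s id).eval d)⁻¹ * (w.eval d ^ 2 * g d)) ≤
        g 2 * ((X ^ 2 * w ^ 2).eval d / (Lagrange.nodal s id).eval d) := by
      have h5 : 0 ≤ d * ((Lagrange.nodal s id).eval d)⁻¹ * w.eval d ^ 2 := by positivity
      have h6 := mul_le_mul_of_nonneg_left hgd h5
      simp only [eval_mul, eval_pow, eval_X]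
      calc _ = d * ((Lagrange.nodal s id).eval d)⁻¹ * w.eval d ^ 2 * g d := by ring
        _ ≤ _ := h6
        _ = _ := by ring
    have h7 := mul_nonneg hd0.le h
    linarith
  refine le_of_tendsto_of_tendsto ?_ ?_ hev
  · refine tendsto_finsetSum _ fun t _ => ?_
    have h1 : Tendsto (fun d : ℝ => (1 - t / d)⁻¹) atTop (nhds (1 - 0)⁻¹) :=
      (tendsto_const_nhds.sub (tendsto_const_nhds.div_atTop tendsto_id)).inv₀ (by simp)
    simpa using h1.const_mul (Lagrange.nodalWeight s id t * (w.eval t ^ 2 * g t))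
  · have hdeg : (X ^ 2 * w ^ 2).degree < (Lagrange.nodal s id).degree := by
      rw [Lagrange.degree_nodal, hk]
      rcases eq_or_ne w 0 with rfl | hw0
      · rw [zero_pow two_ne_zero, mul_zero, degree_zero]
        exact WithBot.bot_lt_coe (2 * k + 1)
      · rw [degree_eq_natDegree hw0] at hw
        have hwk : w.natDegree < k := by exact_mod_cast hw
        rw [degree_eq_natDegree (by simp [hw0]), natDegree_mul (by simp) (by simp [hw0]),
          natDegree_pow, natDegree_pow, natDegree_X]
        exact_mod_cast (by lia)
    simpa using (div_tendsto_atTop_zero_of_degree_lt _ _ hdeg).const_mul (g 2)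

/-- The divided difference of `u² g / t` over an odd number of nodes is nonnegative. -/
theorem IsOperatorConcaveOn.sum_nodalWeight_div_nonneg {g : ℝ → ℝ}
    (hg : IsOperatorConcaveOn H g)
    (hgc : ContinuousOn g (Set.Ioi 0)) (hg0 : ∀ t ∈ Set.Ioi (0 : ℝ), 0 < g t)
    {k : ℕ} {e : Fin (k + 1) → H} (he : Orthonormal ℂ e) {s : Finset ℝ} (hs : ∀ t ∈ s, 0 < t)
    (hk : s.card = 2 * k + 1) {u : ℝ[X]} (hu : u.degree < (k + 1 : ℕ)) :
    0 ≤ ∑ t ∈ s, Lagrange.nodalWeight s id t * (u.eval t ^ 2 * g t) / t := by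
  have hev : ∀ᶠ d in nhdsWithin (0 : ℝ) (Set.Ioi 0),
      0 ≤ ∑ t ∈ s, Lagrange.nodalWeight s id t * (u.eval t ^ 2 * g t) * (t - d)⁻¹ := by
    have h1 : ∀ᶠ d in nhds (0 : ℝ), ∀ t ∈ s, d < t :=
      (Finset.eventually_all s).2 fun t ht => eventually_lt_nhds (hs t ht)
    filter_upwards [h1.filter_mono nhdsWithin_le_nhds, self_mem_nhdsWithin] with d hlt hd0
    have hds : d ∉ s := fun h => (hlt d h).false
    have h := hg.sum_nodalWeight_nonneg hgc hg0 he (s := insert d s) (p := u)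
      (fun t ht => by
        rcases Finset.mem_insert.1 ht with rfl | ht
        · exact hd0
        · exact hs t ht)
      (by rw [Finset.card_insert_of_notMem hds, hk]; lia) hu
    rw [Lagrange.sum_nodalWeight_insert hds (fun t => u.eval t ^ 2 * g t)] at h
    have hnodal : (Lagrange.nodal s id).eval d ≤ 0 := by
      have h2 : (Lagrange.nodal s id).eval d = -∏ t ∈ s, (t - d) := by
        rw [Lagrange.eval_nodal, Finset.prod_congr rfl fun t _ => show d - id t = -(t - d) from
          (neg_sub t d).symm, Finset.prod_neg, hk, Odd.neg_one_pow ⟨k, rfl⟩, neg_one_mul]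
      rw [h2, neg_nonpos]
      exact Finset.prod_nonneg fun t ht => (sub_pos.2 (hlt t ht)).le
    have h3 : ((Lagrange.nodal s id).eval d)⁻¹ * (u.eval d ^ 2 * g d) ≤ 0 :=
      mul_nonpos_of_nonpos_of_nonneg (inv_nonpos.2 hnodal)
        (mul_nonneg (sq_nonneg _) (hg0 d hd0).le)
    refine (by linarith : (0 : ℝ) ≤ _).trans_eq (Finset.sum_congr rfl fun t _ => ?_)
    ring
  refine ge_of_tendsto ?_ hev
  refine (tendsto_finsetSum _ fun t ht => ?_).mono_left nhdsWithin_le_nhds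
  have h1 : Tendsto (fun d : ℝ => (t - d)⁻¹) (nhds 0) (nhds (t - 0)⁻¹) :=
    (tendsto_const_nhds.sub tendsto_id).inv₀ (by simpa using (hs t ht).ne')
  rw [sub_zero] at h1
  exact h1.const_mul _

end DividedDifferences

section Interpolation

open Polynomial

/-- The squares and `-X` times squares of degree at most `n`: elementary polynomials that are
nonnegative on `(-∞, 0]`. -/
def negHalfLineSquares (n : ℕ) : Set ℝ[X] :=
  {p | (∃ u : ℝ[X], p = u ^ 2 ∨ p = -X * u ^ 2) ∧ p.natDegree ≤ n}

lemma mul_mem_closure_negHalfLineSquares {a b : ℕ} {p q : ℝ[X]}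
    (hp : p ∈ AddSubmonoid.closure (negHalfLineSquares a))
    (hq : q ∈ AddSubmonoid.closure (negHalfLineSquares b)) :
    p * q ∈ AddSubmonoid.closure (negHalfLineSquares (a + b)) := by
  have h := AddSubmonoid.mul_mem_mul hp hq
  rw [AddSubmonoid.closure_mul_closure] at h
  refine AddSubmonoid.closure_mono ?_ h
  rintro _ ⟨p, ⟨⟨u, hu⟩, hpa⟩, q, ⟨⟨w, hw⟩, hqb⟩, rfl⟩
  refine ⟨?_, natDegree_mul_le.trans (add_le_add hpa hqb)⟩
  rcases hu with rfl | rfl <;> rcases hw with rfl | rfl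
  · exact ⟨u * w, .inl (by ring)⟩
  · exact ⟨u * w, .inr (by ring)⟩
  · exact ⟨u * w, .inr (by ring)⟩
  · exact ⟨X * u * w, .inl (by ring)⟩

lemma C_sub_X_mem_closure_negHalfLineSquares {r : ℝ} (hr : 0 ≤ r) :
    C r - X ∈ AddSubmonoid.closure (negHalfLineSquares 1) := by
  have : (C r - X : ℝ[X]) = C (√r) ^ 2 + -X * 1 ^ 2 := by
    rw [← C_pow, Real.sq_sqrt hr]; ring
  rw [this]
  refine add_mem (AddSubmonoid.subset_closure ⟨⟨_, .inl rfl⟩, ?_⟩)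
    (AddSubmonoid.subset_closure ⟨⟨_, .inr rfl⟩, ?_⟩)
  · rw [← C_pow, natDegree_C]; exact zero_le_one
  · simp

lemma quadratic_mem_closure_negHalfLineSquares {a b : ℝ} (h : |a| ≤ b) :
    X ^ 2 - C (2 * a) * X + C (b ^ 2) ∈ AddSubmonoid.closure (negHalfLineSquares 2) := by
  have hab : 0 ≤ 2 * (a + b) := by linarith [neg_abs_le a]
  have : (X ^ 2 - C (2 * a) * X + C (b ^ 2) : ℝ[X]) =
      (X + C b) ^ 2 + -X * C (√(2 * (a + b))) ^ 2 := by
    rw [← C_pow (a := √_), Real.sq_sqrt hab]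
    simp only [C_mul, C_add, C_pow, show (C 2 : ℝ[X]) = 2 from C_ofNat 2]
    ring
  rw [this]
  refine add_mem (AddSubmonoid.subset_closure ⟨⟨_, .inl rfl⟩, ?_⟩)
    (AddSubmonoid.subset_closure ⟨⟨_, .inr rfl⟩, ?_⟩)
  · rw [natDegree_pow, natDegree_X_add_C]
  · rw [← C_pow, neg_mul, natDegree_neg]
    exact (natDegree_mul_C_le _ _).trans (by simp)

/-- A polynomial that is positive on `(-∞, 0]` is a sum of squares and `-X` times squares. -/
theorem mem_closure_negHalfLineSquares_of_pos (n : ℕ) {q : ℝ[X]} (hn : q.natDegree ≤ n)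
    (hq : ∀ z ≤ 0, 0 < q.eval z) : q ∈ AddSubmonoid.closure (negHalfLineSquares n) := by
  induction n using Nat.strong_induction_on generalizing q with
  | _ n ih =>
  have hq0 : q ≠ 0 := by
    rintro rfl
    simpa using hq 0 le_rfl
  rcases Nat.eq_zero_or_pos q.natDegree with hdeg | hdeg
  · obtain ⟨c, rfl⟩ := natDegree_eq_zero.1 hdeg
    have hc : 0 ≤ c := by simpa using (hq 0 le_rfl).le
    refine AddSubmonoid.subset_closure ⟨⟨C (√c), .inl ?_⟩, hn⟩
    rw [← C_pow, Real.sq_sqrt hc]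
  obtain ⟨z, hz⟩ := Complex.exists_root (f := q.map (algebraMap ℝ ℂ))
    (by rw [degree_map]; exact natDegree_pos_iff_degree_pos.1 hdeg)
  have hz : aeval z q = 0 := by rwa [IsRoot, eval_map_algebraMap] at hz
  have split : ∀ (d : ℕ) (p r : ℝ[X]), 0 < d → p.natDegree = d → (∀ z ≤ 0, 0 < p.eval z) →
      p ∈ AddSubmonoid.closure (negHalfLineSquares d) → q = p * r →
      q ∈ AddSubmonoid.closure (negHalfLineSquares n) := by
    rintro d p r hd hpd hppos hp rfl
    rw [natDegree_mul (left_ne_zero_of_mul hq0) (right_ne_zero_of_mul hq0)] at hn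
    have hr := ih (n - d) (by lia) (q := r) (by lia) fun z hz => by
      have := hq z hz
      rw [eval_mul] at this
      exact (mul_pos_iff_of_pos_left (hppos z hz)).1 this
    have := mul_mem_closure_negHalfLineSquares hp hr
    rwa [show d + (n - d) = n by lia] at this
  by_cases him : z.im = 0
  · have hzr : z = (z.re : ℂ) := Complex.ext rfl (by simpa using him)
    have hroot : q.eval z.re = 0 := by
      rw [hzr] at hz
      exact (aeval_algebraMap_eq_zero_iff ℂ z.re q).1 hz
    have hpos : 0 < z.re := by
      by_contra! h
      exact (hq _ h).ne' hroot
    obtain ⟨r, hr⟩ := dvd_iff_isRoot.2 hroot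
    refine split 1 (C z.re - X) (-r) one_pos ?_ ?_
      (C_sub_X_mem_closure_negHalfLineSquares hpos.le) (by rw [hr]; ring)
    · rw [← neg_sub, natDegree_neg, natDegree_X_sub_C]
    · intro x hx
      rw [eval_sub, eval_C, eval_X]
      linarith
  · obtain ⟨r, hr⟩ := quadratic_dvd_of_aeval_eq_zero_im_ne_zero q hz him
    refine split 2 _ r two_pos ?_ ?_
      (quadratic_mem_closure_negHalfLineSquares (Complex.abs_re_le_norm z)) hr
    · have : (X ^ 2 - C (2 * z.re) * X + C (‖z‖ ^ 2) : ℝ[X]) =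
        C 1 * X ^ 2 + C (-(2 * z.re)) * X + C (‖z‖ ^ 2) := by
        rw [C_1, C_neg]; ring
      rw [this]
      exact natDegree_quadratic one_ne_zero
    · intro x _
      have h1 : (0 : ℝ) < z.im ^ 2 := by positivity
      have h2 := Complex.sq_norm_sub_sq_re z
      simp only [eval_add, eval_sub, eval_mul, eval_pow, eval_X, eval_C]
      nlinarith [sq_nonneg (x - z.re)]

/-- A functional that is positive on the functions `t / ((1 - σ) t + σ)` is nonnegative at `g`. -/
theorem IsOperatorConcaveOn.sum_mul_nonneg {g : ℝ → ℝ} (hg : IsOperatorConcaveOn H g)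
    (hgc : ContinuousOn g (Set.Ioi 0)) (hg0 : ∀ t ∈ Set.Ioi (0 : ℝ), 0 < g t)
    {k : ℕ} {e : Fin (k + 1) → H} (he : Orthonormal ℂ e) {s : Finset ℝ} (hs : ∀ t ∈ s, 0 < t)
    (hk : s.card = 2 * k + 1) {c : ℝ → ℝ}
    (hc : ∀ σ ∈ Set.Icc (0 : ℝ) 1, 0 < ∑ t ∈ s, c t * (t / ((1 - σ) * t + σ))) :
    0 ≤ ∑ t ∈ s, c t * g t := by
  set N := Lagrange.nodalWeight s id with hN
  have hN0 : ∀ t ∈ s, N t ≠ 0 := fun t ht =>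
    Lagrange.nodalWeight_ne_zero Function.injective_id.injOn ht
  set q := Lagrange.interpolate s id (fun t => c t * t / N t) with hq
  have hqt : ∀ t ∈ s, q.eval t = c t * t / N t := fun t ht =>
    Lagrange.eval_interpolate_at_node (v := id) (fun t => c t * t / N t)
      Function.injective_id.injOn ht
  have hqdeg : q.natDegree ≤ 2 * k := by
    have h := Lagrange.degree_interpolate_lt (v := id) (fun t => c t * t / N t) (s := s)
      Function.injective_id.injOn
    rw [hk] at h
    rcases eq_or_ne q 0 with h0 | h0
    · rw [h0, natDegree_zero]; exact Nat.zero_le _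
    · exact Nat.lt_succ_iff.1 ((natDegree_lt_iff_degree_lt h0).2 h)
  have hqpos : ∀ z ≤ 0, 0 < q.eval z := by
    intro z hz
    have hzt : ∀ t ∈ s, z < t := fun t ht => hz.trans_lt (hs t ht)
    rw [hq, Lagrange.eval_interpolate_not_at_node (v := id) _ fun t ht => (hzt t ht).ne]
    have h1z : 0 < 1 - z := by linarith
    have hσ := hc (-z / (1 - z)) ⟨div_nonneg (by linarith) h1z.le, (div_le_one h1z).2 (by linarith)⟩
    have hnodal : (Lagrange.nodal s id).eval z < 0 := by
      rw [Lagrange.eval_nodal, Finset.prod_congr rfl fun t _ => show z - id t = -(t - z) from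
        (neg_sub t z).symm, Finset.prod_neg, hk, Odd.neg_one_pow ⟨k, rfl⟩, neg_one_mul, neg_lt_zero]
      exact Finset.prod_pos fun t ht => sub_pos.2 (hzt t ht)
    refine mul_pos_of_neg_of_neg hnodal ?_
    have hsum : ∑ t ∈ s, N t * (z - id t)⁻¹ * (c t * t / N t) =
        -((1 - z)⁻¹ * ∑ t ∈ s, c t * (t / ((1 - -z / (1 - z)) * t + -z / (1 - z)))) := by
      rw [Finset.mul_sum, ← Finset.sum_neg_distrib]
      refine Finset.sum_congr rfl fun t ht => ?_
      have h1 := hN0 t ht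
      have h2 : t - z ≠ 0 := (sub_pos.2 (hzt t ht)).ne'
      have h3 : (z - id t)⁻¹ = -(t - z)⁻¹ := by rw [← inv_neg, neg_sub]; rfl
      have h4 : (1 - -z / (1 - z)) * t + -z / (1 - z) = (t - z) / (1 - z) := by
        field_simp; ring
      rw [h3, h4]
      field_simp
    rw [hsum, neg_lt_zero]
    exact mul_pos (inv_pos.2 h1z) hσ
  have hL : ∀ p ∈ AddSubmonoid.closure (negHalfLineSquares (2 * k)),
      0 ≤ ∑ t ∈ s, N t * (p.eval t * g t) / t := by
    intro p hp
    induction hp using AddSubmonoid.closure_induction with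
    | mem p hp =>
      obtain ⟨⟨u, rfl | rfl⟩, hdeg⟩ := hp
      · rw [natDegree_pow] at hdeg
        have hu : u.degree < (k + 1 : ℕ) :=
          degree_le_natDegree.trans_lt (by exact_mod_cast (by lia))
        simpa only [eval_pow] using hg.sum_nodalWeight_div_nonneg hgc hg0 he hs hk hu
      · have hu : u.degree < k := by
          rcases eq_or_ne u 0 with rfl | hu0
          · rw [degree_zero]; exact WithBot.bot_lt_coe k
          · rw [natDegree_mul (by simp) (by simp [hu0]), natDegree_pow, natDegree_neg,
              natDegree_X] at hdeg
            exact degree_le_natDegree.trans_lt (by exact_mod_cast (by lia))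
        have h := hg.sum_nodalWeight_nonpos hgc hg0 he hs hk hu
        rw [← neg_nonneg, ← Finset.sum_neg_distrib] at h
        refine h.trans_eq (Finset.sum_congr rfl fun t ht => ?_)
        have := (hs t ht).ne'
        simp only [eval_mul, eval_neg, eval_X, eval_pow]
        field_simp
        rw [hN]
        ring
    | zero => simp
    | add p r _ _ hp hr =>
      refine (add_nonneg hp hr).trans_eq ?_
      rw [← Finset.sum_add_distrib]
      exact Finset.sum_congr rfl fun t _ => by rw [eval_add]; ring
  refine (hL q (mem_closure_negHalfLineSquares_of_pos _ hqdeg hqpos)).trans_eq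
    (Finset.sum_congr rfl fun t ht => ?_)
  have h1 := hN0 t ht
  have h2 := (hs t ht).ne'
  rw [hqt t ht]
  field_simp

/-- In finite dimension, the convex hull of a compact set is compact. -/
theorem IsCompact.isCompact_convexHull_of_finiteDimensional {E : Type*} [NormedAddCommGroup E]
    [NormedSpace ℝ E] [FiniteDimensional ℝ E] {K : Set E} (hK : IsCompact K) :
    IsCompact (convexHull ℝ K) := by
  have heq : convexHull ℝ K = ⋃ m ∈ Finset.range (Module.finrank ℝ E + 2),
      (fun p : (Fin m → ℝ) × (Fin m → E) => ∑ i, p.1 i • p.2 i) ''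
        (stdSimplex ℝ (Fin m) ×ˢ Set.univ.pi fun _ => K) := by
    apply Set.Subset.antisymm
    · intro x hx
      obtain ⟨ι, _, z, w, hz, hind, hw, hw1, rfl⟩ := eq_pos_convex_span_of_mem_convexHull hx
      let φ := Fintype.equivFin ι
      have hcard := hind.card_le_finrank_succ
      have hcard' := (vectorSpan ℝ (Set.range z)).finrank_le
      refine Set.mem_biUnion (x := Fintype.card ι) (Finset.mem_coe.2 (Finset.mem_range.2 (by lia)))
        ⟨(w ∘ φ.symm, z ∘ φ.symm), ⟨⟨fun i => (hw _).le, ?_⟩, fun i _ => hz ⟨_, rfl⟩⟩, ?_⟩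
      · exact (φ.symm.sum_comp w).trans hw1
      · exact φ.symm.sum_comp fun i => w i • z i
    · refine Set.iUnion₂_subset fun m _ => ?_
      rintro _ ⟨⟨w, z⟩, ⟨⟨hw, hw1⟩, hz⟩, rfl⟩
      exact (convex_convexHull ℝ K).sum_mem (fun i _ => hw i) hw1 fun i _ =>
        subset_convexHull ℝ K (hz i trivial)
  rw [heq]
  exact (Finset.finite_toSet _).isCompact_biUnion fun m _ =>
    ((isCompact_stdSimplex ℝ (Fin m)).prod (isCompact_univ_pi fun _ => hK)).image (by fun_prop)

/-- A positive operator concave function is interpolated at finitely many points by nonnegative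
combinations of the functions `t / ((1 - σ) t + σ)`. -/
theorem IsOperatorConcaveOn.exists_interpolation {g : ℝ → ℝ} (hg : IsOperatorConcaveOn H g)
    (hgc : ContinuousOn g (Set.Ioi 0)) (hg0 : ∀ t ∈ Set.Ioi (0 : ℝ), 0 < g t)
    {k : ℕ} {e : Fin (k + 1) → H} (he : Orthonormal ℂ e) {s : Finset ℝ} (hs : ∀ t ∈ s, 0 < t)
    (hk : s.card = 2 * k + 1) :
    ∃ (κ : Type) (_ : Fintype κ) (c σ : κ → ℝ), (∀ j, 0 ≤ c j) ∧
      (∀ j, σ j ∈ Set.Icc (0 : ℝ) 1) ∧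
      ∀ t ∈ s, g t = ∑ j, c j * (t / ((1 - σ j) * t + σ j)) := by
  obtain ⟨t₀, ht₀⟩ : s.Nonempty := Finset.card_pos.1 (by lia)
  have hden : ∀ t ∈ s, ∀ σ ∈ Set.Icc (0 : ℝ) 1, 0 < (1 - σ) * t + σ := by
    rintro t ht σ ⟨h0, h1⟩
    have ht0 := hs t ht
    rcases h0.eq_or_lt with h | h
    · rw [← h]; linarith
    · have : 0 ≤ (1 - σ) * t := mul_nonneg (by linarith) ht0.le
      linarith
  have hgt₀ := hg0 t₀ (hs t₀ ht₀)
  set γ : ℝ → s → ℝ := fun σ t =>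
    (t / ((1 - σ) * t + σ)) / (t₀ / ((1 - σ) * t₀ + σ)) with hγ
  have hγ₀ : ∀ σ ∈ Set.Icc (0 : ℝ) 1, γ σ ⟨t₀, ht₀⟩ = 1 := fun σ hσ =>
    div_self (div_pos (hs t₀ ht₀) (hden t₀ ht₀ σ hσ)).ne'
  have hγc : ContinuousOn γ (Set.Icc 0 1) := by
    refine continuousOn_pi.2 fun t => ContinuousOn.div ?_ ?_ fun σ hσ =>
      (div_pos (hs t₀ ht₀) (hden t₀ ht₀ σ hσ)).ne'
    · exact ContinuousOn.div (by fun_prop) (by fun_prop) fun σ hσ => (hden t t.2 σ hσ).ne'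
    · exact ContinuousOn.div (by fun_prop) (by fun_prop) fun σ hσ => (hden t₀ ht₀ σ hσ).ne'
  have hK : IsCompact (convexHull ℝ (γ '' Set.Icc 0 1)) :=
    (isCompact_Icc.image_of_continuousOn hγc).isCompact_convexHull_of_finiteDimensional
  have hmem : (fun t : s => g t / g t₀) ∈ convexHull ℝ (γ '' Set.Icc 0 1) := by
    by_contra hnot
    obtain ⟨f, u, hf, hu⟩ :=
      geometric_hahn_banach_closed_point (convex_convexHull ℝ _) hK.isClosed hnot
    set a : s → ℝ := fun t => (if t = ⟨t₀, ht₀⟩ then u else 0) -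
      f (fun t' => if t = t' then 1 else 0) with ha
    have hfa : ∀ x : s → ℝ, ∑ t, a t * x t = u * x ⟨t₀, ht₀⟩ - f x := by
      intro x
      have h1 := LinearMap.pi_apply_eq_sum_univ (f : (s → ℝ) →ₗ[ℝ] ℝ) x
      simp only [ContinuousLinearMap.coe_coe, smul_eq_mul] at h1
      rw [h1]
      simp only [ha, sub_mul, Finset.sum_sub_distrib, ite_mul, zero_mul, Finset.sum_ite_eq',
        Finset.mem_univ, if_true]
      congr 1
      exact Finset.sum_congr rfl fun t _ => mul_comm _ _
    set c : ℝ → ℝ := fun t => if h : t ∈ s then a ⟨t, h⟩ else 0 with hcdef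
    have hca : ∀ x : ℝ → ℝ, ∑ t ∈ s, c t * x t = ∑ t : s, a t * x t := by
      intro x
      rw [← Finset.sum_coe_sort s]
      exact Finset.sum_congr rfl fun t _ => by simp [hcdef]
    have hpos := hg.sum_mul_nonneg hgc hg0 he hs hk (c := c) (by
      intro σ hσ
      have h1 := hf (γ σ) (subset_convexHull ℝ _ ⟨σ, hσ, rfl⟩)
      have h2 := hfa (γ σ)
      rw [hγ₀ σ hσ, mul_one] at h2
      have hκ := div_pos (hs t₀ ht₀) (hden t₀ ht₀ σ hσ)
      rw [hca fun t => t / ((1 - σ) * t + σ)]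
      have h3 : ∑ t : s, a t * ((t : ℝ) / ((1 - σ) * t + σ)) =
          (t₀ / ((1 - σ) * t₀ + σ)) * ∑ t : s, a t * γ σ t := by
        rw [Finset.mul_sum]
        refine Finset.sum_congr rfl fun t _ => ?_
        simp only [hγ]
        rw [mul_left_comm, mul_div_cancel₀ _ hκ.ne']
      rw [h3, h2]
      exact mul_pos hκ (by linarith))
    have h4 := hfa fun t => g t / g t₀
    simp only [div_self hgt₀.ne', mul_one] at h4
    have h5 : ∑ t : s, a t * (g t / g t₀) = (∑ t ∈ s, c t * g t) / g t₀ := by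
      rw [hca g, Finset.sum_div]
      exact Finset.sum_congr rfl fun t _ => by ring
    have h6 := div_nonneg hpos hgt₀.le
    linarith
  obtain ⟨κ, hκ, w, z, hw0, -, hz, hx⟩ := mem_convexHull_iff_exists_fintype.1 hmem
  choose σ hσ hσz using hz
  refine ⟨κ, hκ, fun j => w j * g t₀ / (t₀ / ((1 - σ j) * t₀ + σ j)), σ, fun j => ?_, hσ, ?_⟩
  · exact div_nonneg (mul_nonneg (hw0 j) hgt₀.le)
      (div_pos (hs t₀ ht₀) (hden t₀ ht₀ _ (hσ j))).le
  · intro t ht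
    have h1 := congrFun hx ⟨t, ht⟩
    simp only [Finset.sum_apply, Pi.smul_apply, smul_eq_mul] at h1
    rw [eq_div_iff hgt₀.ne'] at h1
    rw [← h1, Finset.sum_mul]
    refine Finset.sum_congr rfl fun j _ => ?_
    rw [← hσz j]
    simp only [hγ]
    ring

end Interpolation

section SpectralPoints

/-- Distinct points of the spectrum of a self-adjoint operator give an orthonormal family. -/
theorem exists_orthonormal_of_subset_spectrum {A : H →L[ℂ] H} (hA : IsSelfAdjoint A)
    {t : Finset ℝ} (ht : ↑t ⊆ spectrum ℝ A) : ∃ e : t → H, Orthonormal ℂ e := by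
  obtain ⟨δ, hδt, hδ⟩ : ∃ δ : ℝ, (∀ p ∈ t.offDiag, δ < |p.1 - p.2|) ∧ 0 < δ := by
    have h1 : ∀ᶠ δ in nhdsWithin (0 : ℝ) (Set.Ioi 0), ∀ p ∈ t.offDiag, δ < |p.1 - p.2| :=
      (Filter.eventually_all_finset _).2 fun p hp => nhdsWithin_le_nhds <|
        Iio_mem_nhds (abs_pos.2 (sub_ne_zero.2 (Finset.mem_offDiag.1 hp).2.2))
    exact (h1.and self_mem_nhdsWithin).exists
  set h : ℝ → ℝ → ℝ := fun a x => max 0 (δ - 2 * |x - a|) with hh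
  have hcont : ∀ a, Continuous (h a) := fun a => by fun_prop
  have hne : ∀ a : t, ∃ x : H, cfc (h a) A x ≠ 0 := by
    intro a
    by_contra! hx
    have h0 : cfc (h a) A = 0 := ContinuousLinearMap.ext hx
    have h1 := norm_apply_le_norm_cfc (h a) A (ht a.2) (hcont a).continuousOn hA
    rw [h0, norm_zero] at h1
    have h2 : h a a = δ := by simp [hh, hδ.le]
    rw [h2, Real.norm_of_nonneg hδ.le] at h1
    exact absurd h1 hδ.not_ge
  choose x hx using hne
  refine ⟨fun a => ((‖cfc (h a) A (x a)‖⁻¹ : ℝ) : ℂ) • cfc (h a) A (x a), fun a => ?_, ?_⟩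
  · rw [norm_smul, Complex.norm_real, norm_inv, norm_norm,
      inv_mul_cancel₀ (norm_ne_zero_iff.2 (hx a))]
  · intro a b hab
    have hmul : cfc (h a) A * cfc (h b) A = 0 := by
      rw [← cfc_mul (h a) (h b) A (hcont a).continuousOn (hcont b).continuousOn]
      have hzero : (fun y => h a y * h b y) = fun _ => 0 := by
        funext y
        have hsep := hδt (a, b) (Finset.mem_offDiag.2 ⟨a.2, b.2, fun e => hab (Subtype.ext e)⟩)
        have htri : |(a : ℝ) - b| ≤ |y - a| + |y - b| := by
          rw [abs_sub_comm y a]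
          exact abs_sub_le _ _ _
        rcases le_total δ (2 * |y - a|) with h1 | h1
        · simp [hh, h1]
        · have h2 : δ ≤ 2 * |y - b| := by
            dsimp only at hsep
            linarith
          simp [hh, h2]
      rw [hzero, cfc_const_zero]
    have hadj : ∀ u v : H, inner ℂ (cfc (h a) A u) v = inner ℂ u (cfc (h a) A v) := fun u v => by
      have hsa : IsSelfAdjoint (cfc (h a) A) := cfc_predicate _ _
      rw [← ContinuousLinearMap.adjoint_inner_right, hsa.adjoint_eq]
    have h0 : cfc (h a) A (cfc (h b) A (x b)) = 0 := congrArg (fun T : H →L[ℂ] H => T (x b)) hmul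
    rw [inner_smul_left, inner_smul_right, hadj, h0, inner_zero_right, mul_zero, mul_zero]

/-- A positive operator concave function is interpolated on finite subsets of the spectrum of a
positive invertible operator by nonnegative combinations of the functions
`t / ((1 - σ) t + σ)`. -/
theorem IsOperatorConcaveOn.exists_interpolation_of_subset_spectrum {g : ℝ → ℝ}
    (hg : IsOperatorConcaveOn H g) (hgc : ContinuousOn g (Set.Ioi 0))
    (hg0 : ∀ t ∈ Set.Ioi (0 : ℝ), 0 < g t) {A : H →L[ℂ] H} (hA : IsStrictlyPositive A)
    {s : Finset ℝ} (hs : ↑s ⊆ spectrum ℝ A) :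
    ∃ (κ : Type) (_ : Fintype κ) (c σ : κ → ℝ), (∀ j, 0 ≤ c j) ∧
      (∀ j, σ j ∈ Set.Icc (0 : ℝ) 1) ∧
      ∀ t ∈ s, g t = ∑ j, c j * (t / ((1 - σ j) * t + σ j)) := by
  rcases s.eq_empty_or_nonempty with rfl | hne
  · exact ⟨Empty, inferInstance, 0, 0, by simp, by simp, by simp⟩
  have hpos : ∀ t ∈ s, 0 < t := fun t ht => hA.spectrum_pos (hs ht)
  obtain ⟨e, he⟩ := exists_orthonormal_of_subset_spectrum hA.isSelfAdjoint hs
  have hcard := hne.card_pos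
  have family : ∀ k, k + 1 ≤ s.card → ∃ e : Fin (k + 1) → H, Orthonormal ℂ e := fun k hk =>
    ⟨_, he.comp (s.equivFin.symm ∘ Fin.castLE hk)
      (s.equivFin.symm.injective.comp (Fin.castLE_injective hk))⟩
  rcases Nat.even_or_odd' s.card with ⟨k, hk | hk⟩
  · obtain ⟨e, he⟩ := family k (by lia)
    have hmax : s.max' hne + 1 ∉ s := fun h => by linarith [s.le_max' _ h]
    obtain ⟨κ, hκ, c, σ, hc, hσ, hgt⟩ := hg.exists_interpolation hgc hg0 he
      (s := insert (s.max' hne + 1) s) (fun t ht => by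
        rcases Finset.mem_insert.1 ht with rfl | ht
        · linarith [hpos _ (s.max'_mem hne)]
        · exact hpos t ht)
      (by rw [Finset.card_insert_of_notMem hmax, hk])
    exact ⟨κ, hκ, c, σ, hc, hσ, fun t ht => hgt t (Finset.mem_insert_of_mem ht)⟩
  · obtain ⟨e, he⟩ := family k (by lia)
    exact hg.exists_interpolation hgc hg0 he hpos hk

end SpectralPoints

section Resolution

variable {𝒜 : Type*} [CStarAlgebra 𝒜] [PartialOrder 𝒜] [StarOrderedRing 𝒜]

/-- Finitely many functions of a self-adjoint element are simultaneously approximated by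
combinations of a finite positive resolution of the identity indexed by spectral values. -/
theorem exists_resolution_norm_sub_cfc_le {a : 𝒜} (ha : IsSelfAdjoint a) {ι : Type*} [Fintype ι]
    {h : ι → ℝ → ℝ} (hh : ∀ j, ContinuousOn (h j) (spectrum ℝ a)) {ω : ℝ} (hω : 0 < ω) :
    ∃ (s : Finset ℝ) (E : ℝ → 𝒜), ↑s ⊆ spectrum ℝ a ∧ (∀ i ∈ s, 0 ≤ E i) ∧ ∑ i ∈ s, E i = 1 ∧
      ∀ j, ‖∑ i ∈ s, h j i • E i - cfc (h j) a‖ ≤ ω := by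
  have hcpt : IsCompact (spectrum ℝ a) := ContinuousFunctionalCalculus.isCompact_spectrum a
  have huc := hcpt.uniformContinuousOn_of_continuous (f := fun x j => h j x) (continuousOn_pi.2 hh)
  obtain ⟨δ, hδ, hosc⟩ := Metric.uniformContinuousOn_iff.1 huc ω hω
  obtain ⟨s', hs', hfin, hcover⟩ := hcpt.finite_cover_balls hδ
  lift s' to Finset ℝ using hfin
  set hat : ℝ → ℝ → ℝ := fun i x => max 0 (δ - |x - i|) with hhat
  have hhat0 : ∀ i x, 0 ≤ hat i x := fun i x => le_max_left _ _
  have hhatc : ∀ i, Continuous (hat i) := fun i => by fun_prop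
  set η : ℝ → ℝ := fun x => ∑ i ∈ s', hat i x with hη
  have hη0 : ∀ x ∈ spectrum ℝ a, 0 < η x := by
    intro x hx
    obtain ⟨i, hi, hxi⟩ := Set.mem_iUnion₂.1 (hcover hx)
    refine Finset.sum_pos' (fun i _ => hhat0 i x) ⟨i, hi, lt_max_of_lt_right ?_⟩
    rw [Metric.mem_ball, Real.dist_eq] at hxi
    linarith
  have hec : ∀ i, ContinuousOn (fun x => hat i x / η x) (spectrum ℝ a) := fun i =>
    (hhatc i).continuousOn.div (continuous_finsetSum _ fun i _ => hhatc i).continuousOn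
      fun x hx => (hη0 x hx).ne'
  have hcec : ∀ c i, ContinuousOn (fun x => c * (hat i x / η x)) (spectrum ℝ a) := fun c i =>
    continuousOn_const.mul (hec i)
  have hsum : ∀ c : ℝ → ℝ, ∑ i ∈ s', c i • cfc (fun x => hat i x / η x) a =
      cfc (fun x => ∑ i ∈ s', c i * (hat i x / η x)) a := by
    intro c
    rw [show (fun x => ∑ i ∈ s', c i * (hat i x / η x)) =
      ∑ i ∈ s', fun x => c i * (hat i x / η x) by ext; simp,
      cfc_sum _ _ _ fun i _ => hcec (c i) i]
    exact Finset.sum_congr rfl fun i _ => (cfc_smul (c i) _ a (hec i)).symm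
  have hunit : ∀ x ∈ spectrum ℝ a, ∑ i ∈ s', hat i x / η x = 1 := fun x hx => by
    rw [← Finset.sum_div, div_self (hη0 x hx).ne']
  refine ⟨s', fun i => cfc (fun x => hat i x / η x) a, hs', fun i _ => cfc_nonneg fun x hx =>
    div_nonneg (hhat0 i x) (hη0 x hx).le, ?_, fun j => ?_⟩
  · have h1 := hsum fun _ => 1
    simp only [one_smul, one_mul] at h1
    rw [h1, cfc_congr hunit, cfc_const_one ℝ a]
  · rw [hsum, ← cfc_sub _ _ a (continuousOn_finsetSum _ fun i _ => hcec (h j i) i) (hh j)]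
    refine norm_cfc_le hω.le fun x hx => ?_
    have hdiff : ∑ i ∈ s', h j i * (hat i x / η x) - h j x =
        ∑ i ∈ s', (h j i - h j x) * (hat i x / η x) := by
      simp only [sub_mul, Finset.sum_sub_distrib]
      rw [← Finset.mul_sum _ _ (h j x), hunit x hx, mul_one]
    rw [hdiff]
    calc ‖∑ i ∈ s', (h j i - h j x) * (hat i x / η x)‖
        ≤ ∑ i ∈ s', ω * (hat i x / η x) := by
          refine norm_sum_le_of_le _ fun i hi => ?_
          have he0 : 0 ≤ hat i x / η x := div_nonneg (hhat0 i x) (hη0 x hx).le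
          rw [norm_mul, Real.norm_of_nonneg he0]
          rcases le_or_gt δ |x - i| with hxi | hxi
          · have : hat i x = 0 := max_eq_left (by linarith)
            simp [this]
          · have h2 := hosc i (hs' hi) x hx (by rwa [dist_comm, Real.dist_eq])
            have h3 := (dist_le_pi_dist (fun j => h j i) (fun j => h j x) j).trans h2.le
            rw [Real.dist_eq] at h3
            exact mul_le_mul_of_nonneg_right h3 he0
      _ = ω := by rw [← Finset.mul_sum, hunit x hx, mul_one]

end Resolution

/-- A unital positive linear map is continuous. -/
lemma IsUnitalPositiveMap.continuous {Φ : (H →L[ℂ] H) →ₗ[ℂ] (H →L[ℂ] H)}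
    (hΦ : IsUnitalPositiveMap Φ) : Continuous Φ := by
  obtain ⟨C, hC⟩ := (PositiveLinearMap.mk₀ Φ hΦ.2).exists_norm_apply_le
  exact AddMonoidHomClass.continuous_of_bound Φ C hC

/-- A unital positive linear map preserves strict positivity. -/
lemma IsUnitalPositiveMap.isStrictlyPositive {Φ : (H →L[ℂ] H) →ₗ[ℂ] (H →L[ℂ] H)}
    (hΦ : IsUnitalPositiveMap Φ) {X : H →L[ℂ] H} (hX : IsStrictlyPositive X) :
    IsStrictlyPositive (Φ X) := by
  rcases subsingleton_or_nontrivial (H →L[ℂ] H) with _ | _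
  · exact Subsingleton.elim X (Φ X) ▸ hX
  obtain ⟨r, hr, hrX⟩ := (CFC.exists_pos_algebraMap_le_iff hX.isSelfAdjoint).2
    fun x hx => hX.spectrum_pos hx
  have h := hΦ.2 _ (sub_nonneg.2 hrX)
  rw [Algebra.algebraMap_eq_smul_one, map_sub, Φ.map_smul_of_tower, hΦ.1, sub_nonneg] at h
  exact (isStrictlyPositive_one.smul hr).of_le h

/-- **Corollary 2.6 (2.12).** If `f : (0,∞) → (0,∞)` is continuous and `f²` is operator concave,
then `|Φ(f(A))⁻¹ Φ(A)| ≥ Φ(A f(A)⁻¹)` for every unital positive linear map `Φ` and every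
positive invertible operator `A`. -/
theorem abs_ge_choi_davis_inverse
    (Φ : (H →L[ℂ] H) →ₗ[ℂ] (H →L[ℂ] H)) (hΦ : IsUnitalPositiveMap Φ)
    (f : ℝ → ℝ)
    (hfc : ContinuousOn f (Set.Ioi 0))
    (hfpos : ∀ t ∈ Set.Ioi (0 : ℝ), 0 < f t)
    (hf2 : IsOperatorConcaveOn H (fun t => f t ^ 2))
    (A : H →L[ℂ] H) (hA : 0 ≤ A) (hAu : IsUnit A) :
    Φ (A * cfc (fun t => (f t)⁻¹) A) ≤ opAbs (Ring.inverse (Φ (cfc f A)) * Φ A) := by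
  have hAp : IsStrictlyPositive A := hAu.isStrictlyPositive hA
  have hspec : spectrum ℝ A ⊆ Set.Ioi 0 := fun t ht => hAp.spectrum_pos ht
  have hfA := hfc.mono hspec
  have hinv : ContinuousOn (fun t => (f t)⁻¹) (spectrum ℝ A) :=
    hfA.inv₀ fun t ht => (hfpos t (hspec ht)).ne'
  have hfAp : IsStrictlyPositive (cfc f A) := by
    refine IsUnit.isStrictlyPositive ?_ (cfc_nonneg fun t ht => (hfpos t (hspec ht)).le)
    exact (isUnit_cfc_iff f A).2 fun t ht => (hfpos t (hspec ht)).ne'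
  have hdiv : A * cfc (fun t => (f t)⁻¹) A = cfc (fun t => t / f t) A := by
    nth_rewrite 1 [← cfc_id ℝ A]
    exact (cfc_mul id _ A continuousOn_id hinv).symm
  have happrox := fun n : ℕ => exists_resolution_norm_sub_cfc_le hAp.isSelfAdjoint
    (h := ![id, f, fun t => t / f t]) (Fin.forall_fin_succ.2 ⟨continuousOn_id,
      Fin.forall_fin_two.2 ⟨hfA, continuousOn_id.mul hinv⟩⟩) (Nat.one_div_pos_of_nat (n := n))
  choose s E hs hE hE1 hclose using happrox
  have hlim : ∀ j, Filter.Tendsto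
      (fun n => ∑ i ∈ s n, ![id, f, fun t => t / f t] j i • Φ (E n i)) Filter.atTop
      (nhds (Φ (cfc (![id, f, fun t => t / f t] j) A))) := by
    intro j
    have h1 := (hΦ.continuous.tendsto _).comp (tendsto_iff_norm_sub_tendsto_zero.2
      (squeeze_zero (fun _ => norm_nonneg _) (fun n => hclose n j)
        tendsto_one_div_add_atTop_nhds_zero_nat))
    refine h1.congr fun n => ?_
    simp only [Function.comp_apply, map_sum, Φ.map_smul_of_tower]
  have hT := hlim 0
  have hF := hlim 1
  have hS := hlim 2
  simp only [Matrix.cons_val, cfc_id ℝ A] at hT hF hS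
  have hFinv := (NormedRing.inverse_continuousAt
    (hΦ.isStrictlyPositive hfAp).isUnit.unit).tendsto.comp hF
  rw [hdiv]
  refine le_of_tendsto_of_tendsto' hS
    ((CFC.continuous_abs.tendsto _).comp (hFinv.mul hT)) fun n => ?_
  obtain ⟨κ, _, c, σ, hc, hσ, hg⟩ := hf2.exists_interpolation_of_subset_spectrum (hfc.pow 2)
    (fun t ht => pow_pos (hfpos t ht) 2) hAp (hs n)
  exact sum_div_smul_le_abs (fun i hi => hΦ.2 _ (hE n i hi)) (by rw [← map_sum, hE1, hΦ.1])
    (fun i hi => hspec (hs n hi)) (fun i hi => hfpos i (hspec (hs n hi)))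
    (fun j (_ : j ∈ Finset.univ) => hc j) (fun j _ => hσ j) hg
end
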